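/- Let T be a triangulation of a set S of N points in the plane in general position with N even, and suppose flip(T) = N/2 − 3 + κN for some κ ≥ 0. Let x ≈ 1.17965 be the unique real root of 1 + 4x² − 4x³, and set γ = x · e^{−(x²−1)/(4(4+(x²−1)κ))}. Then the sum, over all spanning cycles C of S contained in T, of 1/supp(C) is strictly less than 8 · ( (3 + (γ²−1)(κ + 1/2)) · (4 + (x²−1)κ) / x^{4κ} )^{N/4}. -/

import Mathlib

open scoped Classical

noncomputable section

/-- Points of the plane. -/
abbrev Pt : Type := ℝ × ℝ

/-- A finite point set is in general position if no three of its points are collinear. -/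
def GenPos (S : Finset Pt) : Prop :=
  ∀ p ∈ S, ∀ q ∈ S, ∀ r ∈ S, p ≠ q → p ≠ r → q ≠ r →
    ¬ Collinear ℝ ({p, q, r} : Set Pt)

/-- The closed straight segment spanned by an unordered pair of points. -/
def seg2 (e : Sym2 Pt) : Set Pt :=
  Sym2.lift ⟨fun p q => segment ℝ p q, fun p q => segment_symm ℝ p q⟩ e

/-- A crossing-free straight-edge graph (plane graph) on the point set `S`:
its edges are straight segments between points of `S`, any two of which
meet only at shared endpoints. -/
structure PlaneGraph (S : Finset Pt) where
  edges : Finset (Sym2 Pt)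
  endpoint_mem : ∀ e ∈ edges, ∀ p, p ∈ e → p ∈ S
  not_isDiag : ∀ e ∈ edges, ¬ e.IsDiag
  noncrossing : ∀ e₁ ∈ edges, ∀ e₂ ∈ edges, e₁ ≠ e₂ →
    ∀ x ∈ seg2 e₁ ∩ seg2 e₂, x ∈ e₁ ∧ x ∈ e₂

/-- A triangulation of `S` is a maximal plane graph on `S`. -/
def IsTriangulation {S : Finset Pt} (T : PlaneGraph S) : Prop :=
  ∀ G : PlaneGraph S, T.edges ⊆ G.edges → G.edges = T.edges

/-- `tr S`: the number of triangulations of `S`. -/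
def triCount (S : Finset Pt) : ℕ :=
  Nat.card {T : PlaneGraph S // IsTriangulation T}

/-- A plane graph is a spanning cycle of `S` if its edges form a Hamiltonian
cycle on `S`. -/
def IsSpanningCycle {S : Finset Pt} (G : PlaneGraph S) : Prop :=
  3 ≤ S.card ∧ ∃ f : Fin S.card ≃ {p : Pt // p ∈ S},
    G.edges =
      Finset.image (fun i : Fin S.card => s(((f i : Pt)), ((f (finRotate S.card i) : Pt)))) Finset.univ

/-- `sc S`: the number of crossing-free straight-edge spanning cycles of `S`. -/
def scCount (S : Finset Pt) : ℕ :=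
  Nat.card {G : PlaneGraph S // IsSpanningCycle G}

/-- A plane graph is a perfect matching of `S` if every point of `S` is incident
to exactly one edge. -/
def IsPerfectMatching {S : Finset Pt} (G : PlaneGraph S) : Prop :=
  ∀ p ∈ S, ∃! e, e ∈ G.edges ∧ p ∈ e

/-- `pm S`: the number of crossing-free straight-edge perfect matchings of `S`. -/
def pmCount (S : Finset Pt) : ℕ :=
  Nat.card {G : PlaneGraph S // IsPerfectMatching G}

/-- The support of a plane graph `G` on `S`: the number of triangulations of `S`
containing all edges of `G`. -/
def supp {S : Finset Pt} (G : PlaneGraph S) : ℕ :=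
  Nat.card {T : PlaneGraph S // IsTriangulation T ∧ G.edges ⊆ T.edges}

/-- A finite set of points is in (strictly) convex position. -/
def InConvexPosition (Q : Finset Pt) : Prop :=
  ∀ p ∈ Q, p ∉ convexHull ℝ (↑(Q.erase p) : Set Pt)

/-- `p q` is an edge of the convex hull boundary of `Q`. -/
def IsHullEdgeOf (Q : Finset Pt) (p q : Pt) : Prop :=
  p ∈ Q ∧ q ∈ Q ∧ p ≠ q ∧
    segment ℝ p q ⊆ frontier (convexHull ℝ (Q : Set Pt))

/-- `e` is a diagonal of the convex polygon with vertex set `Q`. -/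
def IsDiagonalOf (Q : Finset Pt) (e : Sym2 Pt) : Prop :=
  ∃ p ∈ Q, ∃ q ∈ Q, e = s(p, q) ∧
    openSegment ℝ p q ⊆ interior (convexHull ℝ (Q : Set Pt))

/-- `F` is a set of ps-flippable (pseudo-simultaneously flippable) edges of the
triangulation `T`: the edges of `F` are diagonals of pairwise interior-disjoint
(empty) convex polygons whose boundary edges all belong to `T`. -/
def IsPsFlippable {S : Finset Pt} (T : PlaneGraph S) (F : Finset (Sym2 Pt)) : Prop :=
  F ⊆ T.edges ∧
  ∃ 𝒬 : Finset (Finset Pt),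
    (∀ Q ∈ 𝒬, ↑Q ⊆ (S : Set Pt) ∧ 3 ≤ Q.card ∧ InConvexPosition Q ∧
      (∀ p q, IsHullEdgeOf Q p q → s(p, q) ∈ T.edges) ∧
      (∀ p ∈ S, p ∉ interior (convexHull ℝ (Q : Set Pt)))) ∧
    (∀ Q ∈ 𝒬, ∀ Q' ∈ 𝒬, Q ≠ Q' →
      interior (convexHull ℝ (Q : Set Pt)) ∩ interior (convexHull ℝ (Q' : Set Pt)) = ∅) ∧
    (∀ e ∈ F, ∃ Q ∈ 𝒬, IsDiagonalOf Q e)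

/-- The drawing of a plane graph: the union of its (closed) edge segments and
its vertex set. -/
def drawing {S : Finset Pt} (G : PlaneGraph S) : Set Pt :=
  (⋃ e ∈ G.edges, seg2 e) ∪ (S : Set Pt)

/-- A convex decomposition of `S`: a plane graph containing all convex hull
boundary edges, whose bounded faces are all convex, and with no isolated
vertices. -/
def IsConvexDecomposition {S : Finset Pt} (D : PlaneGraph S) : Prop :=
  (∀ p q, IsHullEdgeOf S p q → s(p, q) ∈ D.edges) ∧
  (∀ x ∉ drawing D, Bornology.IsBounded (connectedComponentIn (drawing D)ᶜ x) →
    Convex ℝ (connectedComponentIn (drawing D)ᶜ x)) ∧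
  (∀ p ∈ S, ∃ e ∈ D.edges, p ∈ e)

/-- `p` is an interior vertex of `S` (not on the convex hull boundary). -/
def InteriorVtx (S : Finset Pt) (p : Pt) : Prop :=
  p ∈ S ∧ p ∉ frontier (convexHull ℝ (S : Set Pt))

/-- `p` has a valid triple of edges in `G`. -/
def IsValidAt {S : Finset Pt} (G : PlaneGraph S) (p : Pt) : Prop :=
  ∃ a ∈ S, ∃ b ∈ S, ∃ c ∈ S,
    p ∈ convexHull ℝ ({a, b, c} : Set Pt) ∧
    s(p, a) ∈ G.edges ∧ s(p, b) ∈ G.edges ∧ s(p, c) ∈ G.edges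

/-- The degree of a point in a plane graph. -/
def degree {S : Finset Pt} (G : PlaneGraph S) (p : Pt) : ℕ :=
  (G.edges.filter (fun e => p ∈ e)).card

/-- `a b c` span a triangular face of the triangulation `T`. -/
def IsTriFace {S : Finset Pt} (T : PlaneGraph S) (a b c : Pt) : Prop :=
  a ∈ S ∧ b ∈ S ∧ c ∈ S ∧
  s(a, b) ∈ T.edges ∧ s(b, c) ∈ T.edges ∧ s(a, c) ∈ T.edges ∧
  ∀ p ∈ S, p ∉ interior (convexHull ℝ ({a, b, c} : Set Pt))

/-- An edge of a triangulation is flippable if its two incident triangles form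
a convex quadrilateral. -/
def IsFlippable {S : Finset Pt} (T : PlaneGraph S) (e : Sym2 Pt) : Prop :=
  e ∈ T.edges ∧ ∃ a b c d : Pt, e = s(a, b) ∧ c ≠ d ∧
    IsTriFace T a b c ∧ IsTriFace T a b d ∧
    (openSegment ℝ a b ∩ openSegment ℝ c d).Nonempty

/-- `flip T`: the number of flippable edges of `T`. -/
def flipCount {S : Finset Pt} (T : PlaneGraph S) : ℕ :=
  (T.edges.filter (fun e => IsFlippable T e)).card

/-- `v3 T`: the number of interior vertices of degree 3 in `T`. -/
def v3 {S : Finset Pt} (T : PlaneGraph S) : ℕ :=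
  (S.filter (fun p => p ∉ frontier (convexHull ℝ (S : Set Pt)) ∧ degree T p = 3)).card

/-- The number of vertices of `S` on its convex hull boundary. -/
def hullVtxCount (S : Finset Pt) : ℕ :=
  (S.filter (fun p => p ∈ frontier (convexHull ℝ (S : Set Pt)))).card

section

/-- The signed sum over all permutations, a multiple of the Pfaffian. -/
def pfSum {k : ℕ} (A : Matrix (Fin k × Fin 2) (Fin k × Fin 2) ℝ) : ℝ :=
  ∑ σ : Equiv.Perm (Fin k × Fin 2), ((Equiv.Perm.sign σ : ℤ) : ℝ) *
    ∏ i : Fin k, A (σ (i, 0)) (σ (i, 1))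

def pfG (k : ℕ) : Finset (Equiv.Perm (Fin k × Fin 2)) :=
  Finset.univ.filter (fun ρ => ∀ i, (ρ (i, 0)).1 = (ρ (i, 1)).1)

lemma pfSum_conj {k : ℕ} (A B : Matrix (Fin k × Fin 2) (Fin k × Fin 2) ℝ) :
    pfSum (B * A * B.transpose) = B.det * pfSum A := by
  -- expand
  have h1 : ∀ σ : Equiv.Perm (Fin k × Fin 2),
      ∏ i : Fin k, (B * A * B.transpose) (σ (i, 0)) (σ (i, 1)) =
      ∑ f : Fin k × Fin 2 → Fin k × Fin 2,
        (∏ u, B (σ u) (f u)) * ∏ i, A (f (i, 0)) (f (i, 1)) := by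
    intro σ
    have h2 : ∀ i : Fin k, (B * A * B.transpose) (σ (i, 0)) (σ (i, 1)) =
        ∑ g : Fin 2 → Fin k × Fin 2, (∏ j, B (σ (i, j)) (g j)) * A (g 0) (g 1) := by
      intro i
      rw [← (finTwoArrowEquiv (Fin k × Fin 2)).symm.sum_comp, Fintype.sum_prod_type]
      simp only [Matrix.mul_apply, Matrix.transpose_apply, finTwoArrowEquiv_symm_apply,
        Fin.prod_univ_two, Matrix.cons_val_zero, Matrix.cons_val_one]
      rw [Finset.sum_comm]
      refine Finset.sum_congr rfl fun p _ => ?_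
      rw [Finset.sum_mul]
      refine Finset.sum_congr rfl fun q _ => by ring
    simp only [h2]
    rw [Finset.prod_univ_sum]
    simp only [Fintype.piFinset_univ]
    rw [← (Equiv.curry (Fin k) (Fin 2) (Fin k × Fin 2)).sum_comp]
    refine Finset.sum_congr rfl fun f _ => ?_
    rw [Finset.prod_mul_distrib, Fintype.prod_prod_type]
    rfl
  unfold pfSum
  simp only [h1, Finset.mul_sum]
  rw [Finset.sum_comm]
  have h3 : ∀ f : Fin k × Fin 2 → Fin k × Fin 2,
      ∑ σ : Equiv.Perm (Fin k × Fin 2), ((Equiv.Perm.sign σ : ℤ) : ℝ) *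
        ((∏ u, B (σ u) (f u)) * ∏ i, A (f (i, 0)) (f (i, 1))) =
      (B.submatrix id f).det * ∏ i, A (f (i, 0)) (f (i, 1)) := by
    intro f
    rw [Matrix.det_apply', Finset.sum_mul]
    refine Finset.sum_congr rfl fun σ _ => ?_
    simp [mul_assoc]
  simp only [h3]
  have h4 : ∀ f : Fin k × Fin 2 → Fin k × Fin 2, ¬ Function.Bijective f →
      (B.submatrix id f).det = 0 := by
    intro f hf
    have : ¬ Function.Injective f := fun h => hf (Finite.injective_iff_bijective.mp h)
    simp only [Function.Injective, not_forall] at this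
    obtain ⟨a, b, hab, hne⟩ := this
    exact Matrix.det_zero_of_column_eq hne (fun i => by simp [hab])
  rw [← Finset.sum_filter_of_ne (p := fun f => Function.Bijective f)]
  · rw [Finset.sum_filter, ← Finset.sum_filter]
    symm
    refine Finset.sum_bij (fun σ _ => (σ : Fin k × Fin 2 → Fin k × Fin 2)) ?_ ?_ ?_ ?_
    · intro σ _; simp
    · intro a _ b _ h; exact Equiv.ext (fun i => congrFun h i)
    · intro f hf
      exact ⟨Equiv.ofBijective f (by simpa using hf), Finset.mem_univ _, rfl⟩
    · intro σ _
      have : (B.submatrix id σ).det = ((Equiv.Perm.sign σ : ℤ) : ℝ) * B.det :=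
        Matrix.det_permute' σ B
      rw [this]; ring
  · intro f _ h
    by_contra hf
    exact h (by rw [h4 f hf, zero_mul])

lemma orth_extend {k : ℕ} {V : Type} [NormedAddCommGroup V] [InnerProductSpace ℝ V]
    (v w : V) (hv : ‖v‖ = 1) (hw : ‖w‖ = 1) (hvw : inner ℝ v w = 0) (b : Fin k × Fin 2 → V)
    (hb : Orthonormal ℝ b) (h1 : ∀ u, inner ℝ v (b u) = 0) (h2 : ∀ u, inner ℝ w (b u) = 0) :
    Orthonormal ℝ (fun u : Fin (k+1) × Fin 2 =>
      (Fin.cases (if u.2 = 0 then v else w) (fun i => b (i, u.2)) u.1 : V)) := by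
  have h1' : ∀ u, inner ℝ (b u) v = 0 := fun u => by rw [real_inner_comm]; exact h1 u
  have h2' : ∀ u, inner ℝ (b u) w = 0 := fun u => by rw [real_inner_comm]; exact h2 u
  have hwv : inner ℝ w v = 0 := by rw [real_inner_comm]; exact hvw
  rw [orthonormal_iff_ite] at hb ⊢
  rintro ⟨i, j⟩ ⟨i', j'⟩
  refine Fin.cases ?_ (fun i => ?_) i <;> refine Fin.cases ?_ (fun i' => ?_) i'
  · fin_cases j <;> fin_cases j' <;> simp [hv, hw, hvw, hwv]
  · fin_cases j <;> simp [h1, h2, (Fin.succ_ne_zero i').symm]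
  · fin_cases j' <;> simp [h1', h2', Fin.succ_ne_zero i]
  · have h := hb (i, j) (i', j')
    simpa using h

lemma skew_normal : ∀ (k : ℕ) (V : Type) [NormedAddCommGroup V] [InnerProductSpace ℝ V]
    [FiniteDimensional ℝ V] (_ : Module.finrank ℝ V = 2 * k) (L : V →ₗ[ℝ] V)
    (_ : ∀ u v, inner ℝ (L u) v = - inner ℝ u (L v)),
    ∃ (b : Fin k × Fin 2 → V) (l : Fin k → ℝ), Orthonormal ℝ b ∧
      (∀ i, L (b (i, 0)) = l i • b (i, 1)) ∧ (∀ i, L (b (i, 1)) = - (l i) • b (i, 0)) := by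
  intro k
  induction k with
  | zero =>
    intro V _ _ _ _ L _
    refine ⟨fun u => u.1.elim0, fun i => i.elim0, ⟨fun u => u.1.elim0, fun u => u.1.elim0⟩,
      fun i => i.elim0, fun i => i.elim0⟩
  | succ k ih =>
    intro V _ _ _ hV L hL
    -- get an invariant plane
    have key : ∃ (v w : V) (c : ℝ), ‖v‖ = 1 ∧ ‖w‖ = 1 ∧ inner ℝ v w = 0 ∧ L v = c • w ∧
        L w = -c • v := by
      by_cases h0 : L = 0
      · obtain b := stdOrthonormalBasis ℝ V
        have h0' : 0 < Module.finrank ℝ V := by omega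
        have h1' : 1 < Module.finrank ℝ V := by omega
        refine ⟨b ⟨0, h0'⟩, b ⟨1, h1'⟩, 0, b.orthonormal.1 _, b.orthonormal.1 _,
          b.orthonormal.2 (by simp), by simp [h0], by simp [h0]⟩
      · have hsym : (L ∘ₗ L).IsSymmetric := by
          intro u v
          simp only [LinearMap.comp_apply]
          rw [hL, hL]; simp
        have hex : ∃ i, (L ∘ₗ L) (hsym.eigenvectorBasis rfl i) ≠ 0 := by
          by_contra hcon
          push Not at hcon
          apply h0
          have hz : L ∘ₗ L = 0 := by
            apply (hsym.eigenvectorBasis rfl).toBasis.ext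
            intro i
            simpa using hcon i
          ext v
          have : inner ℝ (L v) (L v) = 0 := by
            rw [hL]
            have : L (L v) = 0 := by
              have := LinearMap.congr_fun hz v
              simpa using this
            simp [this]
          simpa using this
        obtain ⟨i, hi⟩ := hex
        set v := hsym.eigenvectorBasis rfl i with hv
        have hev : L (L v) = (hsym.eigenvalues rfl i) • v := by
          exact hsym.apply_eigenvectorBasis rfl i
        have hvn : ‖v‖ = 1 := (hsym.eigenvectorBasis rfl).orthonormal.1 i
        set mu := hsym.eigenvalues rfl i
        have hLv : L v ≠ 0 := by
          intro h; apply hi; simp [h]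
        have hn : ‖L v‖ ≠ 0 := by simpa using hLv
        have hmu : ‖L v‖ ^ 2 = - mu := by
          rw [← real_inner_self_eq_norm_sq, hL, hev, inner_smul_right,
            real_inner_self_eq_norm_sq, hvn]; ring
        refine ⟨v, ‖L v‖⁻¹ • L v, ‖L v‖, hvn, ?_, ?_, ?_, ?_⟩
        · rw [norm_smul, norm_inv, norm_norm, inv_mul_cancel₀ hn]
        · rw [inner_smul_right]
          have h1 : inner ℝ v (L v) = 0 := by
            have := hL v v
            rw [real_inner_comm] at this
            linarith
          rw [h1, mul_zero]
        · rw [smul_smul, mul_inv_cancel₀ hn, one_smul]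
        · rw [map_smul, hev, smul_smul]
          congr 1
          have : mu = - ‖L v‖ ^ 2 := by linarith
          rw [this]; field_simp
    obtain ⟨v, w, c, hv, hw, hvw, hLv, hLw⟩ := key
    set U : Submodule ℝ V := Submodule.span ℝ {v, w} with hU
    have hwv : inner ℝ w v = 0 := by rw [real_inner_comm]; exact hvw
    have hmem : ∀ z : V, z ∈ Uᗮ ↔ inner ℝ v z = 0 ∧ inner ℝ w z = 0 := by
      intro z
      rw [Submodule.mem_orthogonal]
      constructor
      · intro h
        exact ⟨h v (Submodule.subset_span (by simp)), h w (Submodule.subset_span (by simp))⟩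
      · rintro ⟨h1, h2⟩ u hu
        obtain ⟨a, b, rfl⟩ := Submodule.mem_span_pair.mp hu
        rw [inner_add_left, inner_smul_left, inner_smul_left, h1, h2]; simp
    have hli : LinearIndependent ℝ ![v, w] := by
      have : Orthonormal ℝ ![v, w] := by
        refine ⟨?_, ?_⟩
        · intro i; fin_cases i <;> simp [hv, hw]
        · intro i j hij; fin_cases i <;> fin_cases j <;> simp_all
      exact this.linearIndependent
    have hUr : Module.finrank ℝ U = 2 := by
      have := finrank_span_eq_card hli
      have hr : Set.range ![v, w] = {v, w} := by
        ext z; simp [eq_comm]; tauto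
      rw [hr] at this
      rw [hU, this]; simp
    have hUo : Module.finrank ℝ Uᗮ = 2 * k := by
      have := Submodule.finrank_add_finrank_orthogonal U
      omega
    have hinv : ∀ z ∈ Uᗮ, L z ∈ Uᗮ := by
      intro z hz
      rw [hmem] at hz ⊢
      constructor
      · have := hL v z
        rw [hLv, inner_smul_left, hz.2] at this
        simp at this; linarith
      · have := hL w z
        rw [hLw, inner_smul_left, hz.1] at this
        simp at this; linarith
    obtain ⟨b, l, hb, hb0, hb1⟩ := ih Uᗮ hUo (L.restrict hinv) (by
      intro a b
      have := hL a b
      simpa using this)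
    refine ⟨fun u => Fin.cases (if u.2 = 0 then v else w) (fun i => (b (i, u.2) : V)) u.1,
      Fin.cases c l, ?_, ?_, ?_⟩
    · refine orth_extend v w hv hw hvw (fun u => (b u : V)) ?_ ?_ ?_
      · exact hb.comp_linearIsometry Uᗮ.subtypeₗᵢ
      · exact fun u => ((hmem _).1 (b u).2).1
      · exact fun u => ((hmem _).1 (b u).2).2
    · intro i
      refine Fin.cases ?_ (fun i => ?_) i
      · simpa using hLv
      · have := congrArg (Subtype.val) (hb0 i)
        simpa using this
    · intro i
      refine Fin.cases ?_ (fun i => ?_) i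
      · simpa using hLw
      · have := congrArg (Subtype.val) (hb1 i)
        simpa using this


lemma pfSum_bound_aux {k : ℕ} (A : Matrix (Fin k × Fin 2) (Fin k × Fin 2) ℝ)
    (hA : ∀ p q, A p q = - A q p) :
    ∃ l : Fin k → ℝ, |pfSum A| ≤ (pfG k).card * ∏ i, |l i| ∧
      ∑ p, ∑ q, A p q ^ 2 = 2 * ∑ i, l i ^ 2 := by
  let V := EuclideanSpace ℝ (Fin k × Fin 2)
  have hAT : A.transpose = -A := by
    ext p q; simp [hA p q]
  have hdot : ∀ u v : V, inner ℝ u v = (v.ofLp) ⬝ᵥ (u.ofLp) := by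
    intro u v; rw [PiLp.inner_apply]; rfl
  have hneg : ∀ u v : Fin k × Fin 2 → ℝ, -(A.mulVec v ⬝ᵥ u) = A.mulVec u ⬝ᵥ v := by
    intro u v
    rw [dotProduct_comm, Matrix.dotProduct_mulVec, ← Matrix.mulVec_transpose, hAT,
      Matrix.neg_mulVec, neg_dotProduct, neg_neg]
  obtain ⟨b, l, hb, hb0, hb1⟩ := skew_normal k V (by simp [V]; ring)
    (Matrix.toEuclideanLin A) (by
      intro u v
      rw [hdot, hdot, Matrix.toLpLin_apply, Matrix.toLpLin_apply]
      simp only [WithLp.ofLp_toLp]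
      rw [dotProduct_comm v.ofLp, ← hneg])
  set B : Matrix (Fin k × Fin 2) (Fin k × Fin 2) ℝ := Matrix.of (fun p q => (b p).ofLp q) with hB
  have hBB : B * B.transpose = 1 := by
    ext p q
    have := (orthonormal_iff_ite.mp hb) q p
    rw [hdot] at this
    rw [Matrix.mul_apply, Matrix.one_apply]
    simp only [dotProduct] at this
    have e : (if p = q then (1:ℝ) else 0) = if q = p then 1 else 0 := by
      by_cases h : p = q
      · simp [h]
      · simp [h, Ne.symm h]
    rw [e]
    exact this
  set Lam := B * A * B.transpose with hLam
  have hLamv : ∀ p q, Lam p q = inner ℝ (b p) (Matrix.toEuclideanLin A (b q)) := by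
    intro p q
    rw [hdot, Matrix.toLpLin_apply, hLam, Matrix.mul_assoc, Matrix.mul_apply, dotProduct]
    refine Finset.sum_congr rfl fun r _ => ?_
    rw [mul_comm]
    congr 1
  have hL0 : ∀ p i, Lam p (i, 0) = if p = (i, 1) then l i else 0 := by
    intro p i
    rw [hLamv, hb0, inner_smul_right, (orthonormal_iff_ite.mp hb)]
    split_ifs <;> simp
  have hL1 : ∀ p i, Lam p (i, 1) = if p = (i, 0) then - l i else 0 := by
    intro p i
    rw [hLamv, hb1, inner_smul_right, (orthonormal_iff_ite.mp hb)]
    split_ifs <;> simp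
  have hdet : |B.det| = 1 := by
    have := congrArg Matrix.det hBB
    rw [Matrix.det_mul, Matrix.det_transpose, Matrix.det_one] at this
    have h2 : |B.det| * |B.det| = 1 := by rw [← abs_mul, this, abs_one]
    nlinarith [abs_nonneg B.det]
  refine ⟨l, ?_, ?_⟩
  · have h1 : |pfSum A| = |pfSum Lam| := by
      rw [hLam, pfSum_conj, abs_mul, hdet, one_mul]
    rw [h1]
    unfold pfSum
    refine (Finset.abs_sum_le_sum_abs _ _).trans ?_
    have h2 : ∀ σ : Equiv.Perm (Fin k × Fin 2),
        |((Equiv.Perm.sign σ : ℤ) : ℝ) * ∏ i : Fin k, Lam (σ (i, 0)) (σ (i, 1))| ≤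
        if σ ∈ pfG k then ∏ i, |l i| else 0 := by
      intro σ
      have hs : |((Equiv.Perm.sign σ : ℤ) : ℝ)| = 1 := by
        rcases Int.units_eq_one_or (Equiv.Perm.sign σ) with h | h <;> simp [h]
      rw [abs_mul, hs, one_mul, Finset.abs_prod]
      have h3 : ∀ p q, p.1 ≠ q.1 → Lam p q = 0 := by
        rintro ⟨p, p'⟩ ⟨q, q'⟩ h
        simp only at h
        fin_cases q'
        · have := hL0 (p, p') q
          simpa [h] using this
        · have := hL1 (p, p') q
          simpa [h] using this
      have h4 : ∀ p q, |Lam p q| ≤ |l p.1| := by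
        rintro ⟨p, p'⟩ ⟨q, q'⟩
        fin_cases q'
        · have := hL0 (p, p') q
          simp only [Fin.zero_eta]
          rw [this]
          split_ifs with h
          · simp at h; simp [h.1]
          · simp
        · have := hL1 (p, p') q
          simp only [Fin.mk_one]
          rw [this]
          split_ifs with h
          · simp at h; simp [h.1]
          · simp
      split_ifs with hG
      · simp only [pfG, Finset.mem_filter, Finset.mem_univ, true_and] at hG
        have hinj : Function.Injective (fun i => (σ (i, 0)).1) := by
          intro i j hij
          simp only at hij
          by_contra hne
          -- σ(i,0), σ(i,1), σ(j,0) all in one block of size 2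
          have e1 : σ (i,0) ≠ σ (i,1) := by simp
          have e2 : σ (i,0) ≠ σ (j,0) := by simp [hne]
          have e3 : σ (i,1) ≠ σ (j,0) := by simp
          have f1 := hG i
          revert e1 e2 e3 hij f1
          generalize σ (i,0) = a
          generalize σ (i,1) = b
          generalize σ (j,0) = c
          obtain ⟨a, a'⟩ := a
          obtain ⟨b, b'⟩ := b
          obtain ⟨c, c'⟩ := c
          simp only
          rintro rfl e1 e2 e3 rfl
          simp at e1 e2 e3
          omega
        have hbij := Finite.injective_iff_bijective.mp hinj
        rw [← (Equiv.ofBijective _ hbij).prod_comp (fun i => |l i|)]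
        refine Finset.prod_le_prod (fun i _ => abs_nonneg _) fun i _ => h4 _ _
      · simp only [pfG, Finset.mem_filter, Finset.mem_univ, true_and, not_forall] at hG
        obtain ⟨i, hi⟩ := hG
        rw [Finset.prod_eq_zero (Finset.mem_univ i)]
        rw [h3 _ _ hi, abs_zero]
    refine (Finset.sum_le_sum fun σ _ => h2 σ).trans ?_
    rw [Finset.sum_ite_mem, Finset.univ_inter, Finset.sum_const, nsmul_eq_mul]
  · have htr : ∀ M : Matrix (Fin k × Fin 2) (Fin k × Fin 2) ℝ,
        ∑ p, ∑ q, M p q ^ 2 = (M * M.transpose).trace := by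
      intro M
      simp only [Matrix.trace, Matrix.diag, Matrix.mul_apply, Matrix.transpose_apply, sq]
    have hBB' : B.transpose * B = 1 := mul_eq_one_comm.mp hBB
    have h1 : ∑ p, ∑ q, A p q ^ 2 = ∑ p, ∑ q, Lam p q ^ 2 := by
      rw [htr, htr, hLam]
      have : B * A * B.transpose * (B * A * B.transpose).transpose =
          B * (A * A.transpose * B.transpose) := by
        simp only [Matrix.transpose_mul, Matrix.transpose_transpose]
        calc _ = B * A * (B.transpose * B) * A.transpose * B.transpose := by
              simp only [Matrix.mul_assoc]
          _ = _ := by rw [hBB']; simp only [Matrix.mul_assoc, Matrix.mul_one]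
      rw [this, Matrix.trace_mul_comm B, Matrix.mul_assoc (A * A.transpose), hBB', Matrix.mul_one]
    rw [h1, Finset.sum_comm, Fintype.sum_prod_type]
    simp only [Fin.sum_univ_two, hL0, hL1, ite_pow]
    rw [Finset.mul_sum]
    refine Finset.sum_congr rfl fun i _ => ?_
    simp
    ring

lemma pfSum_bound {k : ℕ} (hk : 0 < k) (A : Matrix (Fin k × Fin 2) (Fin k × Fin 2) ℝ)
    (hA : ∀ p q, A p q = - A q p) :
    |pfSum A| ≤ (pfG k).card * ((∑ p, ∑ q, A p q ^ 2) / (2 * k)) ^ ((k : ℝ) / 2) := by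
  obtain ⟨l, h1, h2⟩ := pfSum_bound_aux A hA
  refine h1.trans ?_
  refine mul_le_mul_of_nonneg_left ?_ (Nat.cast_nonneg _)
  rw [h2]
  have hk' : (0:ℝ) < k := by exact_mod_cast hk
  have am := Real.geom_mean_le_arith_mean_weighted Finset.univ (fun _ : Fin k => (1 / (k:ℝ)))
    (fun i => l i ^ 2) (fun i _ => by positivity) (by simp; field_simp) (fun i _ => sq_nonneg _)
  have e1 : (2 * ∑ i, l i ^ 2) / (2 * (k:ℝ)) = ∑ i, 1 / (k:ℝ) * l i ^ 2 := by
    rw [← Finset.mul_sum]; field_simp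
  rw [e1]
  have h0 : 0 ≤ ∏ i, (l i ^ 2) ^ (1 / (k:ℝ)) := Finset.prod_nonneg fun i _ => by positivity
  calc ∏ i, |l i| = (∏ i, (l i ^ 2) ^ (1 / (k:ℝ))) ^ ((k:ℝ)/2) := by
        rw [← Real.finset_prod_rpow _ _ (fun i _ => by positivity)]
        refine Finset.prod_congr rfl fun i _ => ?_
        rw [← Real.rpow_mul (by positivity), ← sq_abs, ← Real.rpow_natCast,
          ← Real.rpow_mul (abs_nonneg _)]
        have : ((2:ℕ):ℝ) * (1 / (k:ℝ) * ((k:ℝ)/2)) = 1 := by push_cast; field_simp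
        rw [this, Real.rpow_one]
    _ ≤ _ := Real.rpow_le_rpow h0 am (by positivity)

end

section

/-- Orientation determinant. -/
def cr (p q r : Pt) : ℝ := (q.1 - p.1) * (r.2 - p.2) - (q.2 - p.2) * (r.1 - p.1)

/-- Proper crossing of segments `pq` and `rs`. -/
def Cross (p q r s : Pt) : Prop := cr p q r * cr p q s < 0 ∧ cr r s p * cr r s q < 0

lemma cr_rot (p q r : Pt) : cr q r p = cr p q r := by unfold cr; ring
lemma cr_swap (p q r : Pt) : cr q p r = - cr p q r := by unfold cr; ring
lemma cr_swap' (p q r : Pt) : cr p r q = - cr p q r := by unfold cr; ring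
lemma cr_self1 (p q : Pt) : cr p p q = 0 := by unfold cr; ring
lemma cr_self2 (p q : Pt) : cr p q p = 0 := by unfold cr; ring
lemma cr_self3 (p q : Pt) : cr p q q = 0 := by unfold cr; ring
lemma cr_gp (p a b c d : Pt) :
    cr p a b * cr p c d - cr p a c * cr p b d + cr p a d * cr p b c = 0 := by unfold cr; ring
lemma cr_sum (a b c p : Pt) : cr a b p + cr b c p + cr c a p = cr a b c := by unfold cr; ring

lemma Cross.symm1 {p q r s : Pt} (h : Cross p q r s) : Cross q p r s := by
  refine ⟨?_, ?_⟩
  · rw [cr_swap p q r, cr_swap p q s]; nlinarith [h.1]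
  · linarith [h.2, mul_comm (cr r s q) (cr r s p)]
lemma Cross.symm2 {p q r s : Pt} (h : Cross p q r s) : Cross p q s r := by
  refine ⟨?_, ?_⟩
  · linarith [h.1, mul_comm (cr p q s) (cr p q r)]
  · rw [cr_swap r s p, cr_swap r s q]; nlinarith [h.2]
lemma Cross.swap {p q r s : Pt} (h : Cross p q r s) : Cross r s p q := ⟨h.2, h.1⟩

lemma Cross.ne {p q r s : Pt} (h : Cross p q r s) :
    p ≠ q ∧ r ≠ s ∧ p ≠ r ∧ p ≠ s ∧ q ≠ r ∧ q ≠ s := by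
  obtain ⟨h1, h2⟩ := h
  refine ⟨?_, ?_, ?_, ?_, ?_, ?_⟩ <;> rintro rfl <;>
    simp [cr_self1, cr_self2, cr_self3] at h1 h2

/-- General position, in terms of the determinant. -/
def GP (S : Finset Pt) : Prop :=
  ∀ p ∈ S, ∀ q ∈ S, ∀ r ∈ S, p ≠ q → p ≠ r → q ≠ r → cr p q r ≠ 0

lemma GenPos.gp {S : Finset Pt} (h : GenPos S) : GP S := by
  intro p hp q hq r hr hpq hpr hqr h0
  refine h p hp q hq r hr hpq hpr hqr ?_
  rw [collinear_iff_of_mem (p₀ := p) (by simp)]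
  refine ⟨q - p, ?_⟩
  intro z hz
  simp only [Set.mem_insert_iff, Set.mem_singleton_iff] at hz
  rcases hz with rfl | rfl | rfl
  · exact ⟨0, by simp⟩
  · exact ⟨1, by simp⟩
  · unfold cr at h0
    by_cases h1 : q.1 - p.1 = 0
    · have h2 : q.2 - p.2 ≠ 0 := by
        intro h2; apply hpq
        ext <;> linarith
      rw [h1] at h0
      refine ⟨(z.2 - p.2) / (q.2 - p.2), ?_⟩
      have h3 : z.1 - p.1 = 0 := by
        have : (q.2 - p.2) * (z.1 - p.1) = 0 := by linarith
        rcases mul_eq_zero.mp this with h | h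
        · exact absurd h h2
        · exact h
      ext
      · simp [h1]; linarith
      · simp; field_simp; ring
    · refine ⟨(z.1 - p.1) / (q.1 - p.1), ?_⟩
      ext
      · simp; field_simp; ring
      · simp; field_simp; linarith

/-! ### Kasteleyn signs -/

/-- sheared first coordinate -/
def gx (t : ℝ) (p : Pt) : ℝ := p.1 + t * p.2

lemma cr_gx (t : ℝ) (p q r : Pt) :
    cr p q r = (gx t q - gx t p) * (r.2 - p.2) - (q.2 - p.2) * (gx t r - gx t p) := by
  unfold cr gx; ring

lemma exists_gx_inj (S : Finset Pt) : ∃ t : ℝ, Set.InjOn (gx t) S := by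
  -- avoid finitely many slopes
  let bad : Finset ℝ := (S ×ˢ S).image (fun pq : Pt × Pt => -(pq.1.1 - pq.2.1) / (pq.1.2 - pq.2.2))
  obtain ⟨t, ht⟩ := Infinite.exists_notMem_finset bad
  refine ⟨t, ?_⟩
  intro p hp q hq h
  by_contra hne
  unfold gx at h
  by_cases h2 : p.2 - q.2 = 0
  · apply hne
    have h3 : p.2 = q.2 := by linarith
    rw [h3] at h
    ext
    · linarith
    · exact h3
  · apply ht
    simp only [bad, Finset.mem_image, Finset.mem_product]
    refine ⟨(p, q), ⟨hp, hq⟩, ?_⟩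
    simp only
    rw [div_eq_iff h2]; linarith

def sg (t : ℝ) (p q : Pt) : ℝ := if gx t p < gx t q then 1 else -1

def ab (t : ℝ) (p q r : Pt) : ℝ :=
  if (gx t r - gx t p) * (gx t r - gx t q) < 0 ∧ 0 < cr p q r * (gx t q - gx t p) then -1 else 1

lemma ab_symm (t : ℝ) (p q r : Pt) : ab t q p r = ab t p q r := by
  unfold ab
  have : cr q p r * (gx t p - gx t q) = cr p q r * (gx t q - gx t p) := by rw [cr_swap]; ring
  rw [this, mul_comm (gx t r - gx t q)]

lemma sg_anti (t : ℝ) {p q : Pt} (h : gx t p ≠ gx t q) : sg t q p = - sg t p q := by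
  unfold sg
  rcases lt_or_gt_of_ne h with h | h
  · rw [if_pos h, if_neg (not_lt.mpr h.le)]
  · rw [if_pos h, if_neg (not_lt.mpr h.le)]; simp

set_option maxHeartbeats 2000000 in
lemma kast4_aux (t : ℝ) (p q r s : Pt) (hpq : gx t p < gx t q) (hrs : gx t r < gx t s)
    (hpr : gx t p < gx t r) (hqr : gx t q ≠ gx t r) (hqs : gx t q ≠ gx t s)
    (c1 : cr p q r ≠ 0) (c2 : cr p q s ≠ 0) (c3 : cr r s p ≠ 0) (c4 : cr r s q ≠ 0)
    (hX : ¬ Cross p q r s) :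
    (sg t p r * sg t p s * sg t q r * sg t q s) *
      ((ab t p q r * ab t p q s) * (ab t r s p * ab t r s q)) = 1 := by
  have i1 : (gx t q - gx t p) * cr r s p =
      - cr p q r * (gx t s - gx t p) + cr p q s * (gx t r - gx t p) := by
    simp only [cr_gx t]; ring
  have i2 : (gx t q - gx t p) * cr r s q =
      - cr p q r * (gx t s - gx t q) + cr p q s * (gx t r - gx t q) := by
    simp only [cr_gx t]; ring
  set P := gx t p
  set Q := gx t q
  set R := gx t r
  set U := gx t s
  have hap : ab t r s p = 1 := by
    unfold ab; rw [if_neg]; rintro ⟨h, _⟩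
    nlinarith
  have s1 : sg t p r = 1 := if_pos hpr
  have s2 : sg t p s = 1 := if_pos (hpr.trans hrs)
  rw [s1, s2, hap]
  rcases lt_or_gt_of_ne hqr with h1 | h1
  · -- disjoint
    have s3 : sg t q r = 1 := if_pos h1
    have s4 : sg t q s = 1 := if_pos (h1.trans hrs)
    have e1 : ab t p q r = 1 := by
      unfold ab; rw [if_neg]; rintro ⟨h, _⟩
      nlinarith
    have e2 : ab t p q s = 1 := by
      unfold ab; rw [if_neg]; rintro ⟨h, _⟩
      nlinarith
    have e3 : ab t r s q = 1 := by
      unfold ab; rw [if_neg]; rintro ⟨h, _⟩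
      nlinarith
    rw [s3, s4, e1, e2, e3]; norm_num
  · have s3 : sg t q r = -1 := if_neg (not_lt.mpr h1.le)
    have hQP : 0 < Q - P := by linarith
    have er : ab t p q r = if 0 < cr p q r then -1 else 1 := by
      unfold ab
      have : (R - P) * (R - Q) < 0 := by nlinarith
      simp only [this, true_and, P, Q, R]
      congr 1
      exact propext (mul_pos_iff_of_pos_right hQP)
    rcases lt_or_gt_of_ne hqs with h2 | h2
    · -- interleaved
      have s4 : sg t q s = 1 := if_pos h2
      have e2 : ab t p q s = 1 := by
        unfold ab; rw [if_neg]; rintro ⟨h, _⟩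
        nlinarith
      have e3 : ab t r s q = if 0 < cr r s q then -1 else 1 := by
        unfold ab
        have : (Q - R) * (Q - U) < 0 := by nlinarith
        simp only [this, true_and, R, U, Q]
        congr 1
        exact propext (mul_pos_iff_of_pos_right (by linarith))
      rw [s3, s4, e2, e3, er]
      have key : ¬ (0 < cr p q r ↔ 0 < cr r s q) := by
        intro hiff
        apply hX
        rcases lt_or_gt_of_ne c1 with ha | ha
        · have hb : cr r s q < 0 := by
            rcases lt_or_gt_of_ne c4 with h | h
            · exact h
            · exact absurd (hiff.mpr h) (not_lt.mpr ha.le)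
          have hs : 0 < cr p q s := by
            by_contra hcon
            push Not at hcon
            nlinarith
          have hp : 0 < cr r s p := by
            by_contra hcon
            push Not at hcon
            nlinarith [mul_pos (neg_pos.mpr ha) (show 0 < U - P by linarith), mul_pos hs (show 0 < R - P by linarith), mul_nonneg hQP.le (neg_nonneg.mpr hcon)]
          exact ⟨by nlinarith, by nlinarith⟩
        · have hb : 0 < cr r s q := hiff.mp ha
          have hs : cr p q s < 0 := by
            by_contra hcon
            push Not at hcon
            nlinarith
          have hp : cr r s p < 0 := by
            by_contra hcon
            push Not at hcon
            nlinarith [mul_pos ha (show 0 < U - P by linarith), mul_pos (neg_pos.mpr hs) (show 0 < R - P by linarith), mul_nonneg hQP.le hcon]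
          exact ⟨by nlinarith, by nlinarith⟩
      by_cases g1 : 0 < cr p q r <;> by_cases g2 : 0 < cr r s q <;> simp [g1, g2] at key ⊢
    · -- nested
      have s4 : sg t q s = -1 := if_neg (not_lt.mpr h2.le)
      have e2 : ab t p q s = if 0 < cr p q s then -1 else 1 := by
        unfold ab
        have : (U - P) * (U - Q) < 0 := by nlinarith
        simp only [this, true_and, P, Q, U]
        congr 1
        exact propext (mul_pos_iff_of_pos_right hQP)
      have e3 : ab t r s q = 1 := by
        unfold ab; rw [if_neg]; rintro ⟨h, _⟩
        nlinarith
      rw [s3, s4, e2, e3, er]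
      have key : (0 < cr p q r ↔ 0 < cr p q s) := by
        by_contra hiff
        apply hX
        rcases lt_or_gt_of_ne c1 with ha | ha
        · have hs : 0 < cr p q s := by
            by_contra h
            exact hiff ⟨fun h' => absurd h' (not_lt.mpr ha.le), fun h' => absurd h' h⟩
          have hp : 0 < cr r s p := by
            by_contra hcon
            push Not at hcon
            nlinarith [mul_pos (neg_pos.mpr ha) (show 0 < U - P by linarith), mul_pos hs (show 0 < R - P by linarith), mul_nonneg hQP.le (neg_nonneg.mpr hcon)]
          have hq : cr r s q < 0 := by
            by_contra hcon
            push Not at hcon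
            nlinarith [mul_pos (neg_pos.mpr ha) (show 0 < Q - U by linarith), mul_pos hs (show 0 < Q - R by linarith), mul_nonneg hQP.le hcon]
          exact ⟨by nlinarith, by nlinarith⟩
        · have hs : cr p q s < 0 := by
            rcases lt_or_gt_of_ne c2 with h | h
            · exact h
            · exact absurd ⟨fun _ => h, fun _ => ha⟩ hiff
          have hp : cr r s p < 0 := by
            by_contra hcon
            push Not at hcon
            nlinarith [mul_pos ha (show 0 < U - P by linarith), mul_pos (neg_pos.mpr hs) (show 0 < R - P by linarith), mul_nonneg hQP.le hcon]
          have hq : 0 < cr r s q := by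
            by_contra hcon
            push Not at hcon
            nlinarith [mul_pos ha (show 0 < Q - U by linarith), mul_pos (neg_pos.mpr hs) (show 0 < Q - R by linarith), mul_nonneg hQP.le (neg_nonneg.mpr hcon)]
          exact ⟨by nlinarith, by nlinarith⟩
      by_cases g1 : 0 < cr p q r <;> by_cases g2 : 0 < cr p q s <;> simp [g1, g2] at key ⊢

lemma kast4 (t : ℝ) (p q r s : Pt) (hpq : gx t p ≠ gx t q) (hrs : gx t r ≠ gx t s)
    (hpr : gx t p ≠ gx t r) (hps : gx t p ≠ gx t s) (hqr : gx t q ≠ gx t r) (hqs : gx t q ≠ gx t s)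
    (c1 : cr p q r ≠ 0) (c2 : cr p q s ≠ 0) (c3 : cr r s p ≠ 0) (c4 : cr r s q ≠ 0)
    (hX : ¬ Cross p q r s) :
    (sg t p r * sg t p s * sg t q r * sg t q s) *
      ((ab t p q r * ab t p q s) * (ab t r s p * ab t r s q)) = 1 := by
  -- reduce to p<q, r<s, p<r
  have A1 : ∀ p q r s : Pt, gx t p < gx t q → gx t r < gx t s → gx t p ≠ gx t r →
      gx t p ≠ gx t s → gx t q ≠ gx t r → gx t q ≠ gx t s →
      cr p q r ≠ 0 → cr p q s ≠ 0 → cr r s p ≠ 0 → cr r s q ≠ 0 → ¬ Cross p q r s →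
      (sg t p r * sg t p s * sg t q r * sg t q s) *
      ((ab t p q r * ab t p q s) * (ab t r s p * ab t r s q)) = 1 := by
    intro p q r s hpq hrs hpr hps hqr hqs c1 c2 c3 c4 hX
    rcases lt_or_gt_of_ne hpr with h | h
    · exact kast4_aux t p q r s hpq hrs h hqr hqs c1 c2 c3 c4 hX
    · have := kast4_aux t r s p q hrs hpq h hps.symm hqs.symm c3 c4 c1 c2 (fun h => hX h.swap)
      rw [sg_anti t hpr, sg_anti t hqr, sg_anti t hps, sg_anti t hqs] at this
      linarith
  have A2 : ∀ p q r s : Pt, gx t p < gx t q → gx t r ≠ gx t s → gx t p ≠ gx t r →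
      gx t p ≠ gx t s → gx t q ≠ gx t r → gx t q ≠ gx t s →
      cr p q r ≠ 0 → cr p q s ≠ 0 → cr r s p ≠ 0 → cr r s q ≠ 0 → ¬ Cross p q r s →
      (sg t p r * sg t p s * sg t q r * sg t q s) *
      ((ab t p q r * ab t p q s) * (ab t r s p * ab t r s q)) = 1 := by
    intro p q r s hpq hrs hpr hps hqr hqs c1 c2 c3 c4 hX
    rcases lt_or_gt_of_ne hrs with h | h
    · exact A1 p q r s hpq h hpr hps hqr hqs c1 c2 c3 c4 hX
    · have := A1 p q s r hpq h hps hpr hqs hqr c2 c1 (by rw [cr_swap]; simpa using c3)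
        (by rw [cr_swap]; simpa using c4) (fun h => hX h.symm2)
      rw [ab_symm t r s p, ab_symm t r s q] at this
      linarith
  rcases lt_or_gt_of_ne hpq with h | h
  · exact A2 p q r s h hrs hpr hps hqr hqs c1 c2 c3 c4 hX
  · have := A2 q p r s h hrs hqr hqs hpr hps (by rw [cr_swap]; simpa using c1)
      (by rw [cr_swap]; simpa using c2) c4 c3 (fun h => hX h.symm1)
    rw [ab_symm t p q r, ab_symm t p q s] at this
    linarith

end

section

/-- product over pairs of blocks -/
def blockProd {k : ℕ} (f : Fin k × Fin 2 → Fin k × Fin 2 → ℝ) : ℝ :=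
  (∏ i, f (i, 0) (i, 1)) * ∏ i, ∏ j, if i < j then
    f (i, 0) (j, 0) * f (i, 0) (j, 1) * f (i, 1) (j, 0) * f (i, 1) (j, 1) else 1

lemma blockProd_eq {k : ℕ} (f : Fin k × Fin 2 → Fin k × Fin 2 → ℝ) :
    ∏ a : Fin (k * 2), ∏ b ∈ Finset.Ioi a, f (finProdFinEquiv.symm a) (finProdFinEquiv.symm b) =
      blockProd f := by
  have h1 : ∀ a : Fin (k*2), ∏ b ∈ Finset.Ioi a, f (finProdFinEquiv.symm a) (finProdFinEquiv.symm b) =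
      ∏ v : Fin k × Fin 2, if a < finProdFinEquiv v then f (finProdFinEquiv.symm a) v else 1 := by
    intro a
    rw [← finProdFinEquiv.symm.prod_comp, ← Finset.prod_filter]
    simp only [Equiv.apply_symm_apply]
    congr 1
    ext b; simp
  simp only [h1]
  rw [← finProdFinEquiv.prod_comp]
  simp only [Equiv.symm_apply_apply]
  rw [Fintype.prod_prod_type]
  have h2 : ∀ (i : Fin k), (∏ a : Fin 2, ∏ v : Fin k × Fin 2,
      if finProdFinEquiv (i, a) < finProdFinEquiv v then f (i, a) v else 1) =
      f (i, 0) (i, 1) * ∏ j, if i < j then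
    f (i, 0) (j, 0) * f (i, 0) (j, 1) * f (i, 1) (j, 0) * f (i, 1) (j, 1) else 1 := by
    intro i
    have h3 : f (i, 0) (i, 1) = ∏ j, if i = j then f (i, 0) (i, 1) else 1 := by
      rw [Finset.prod_ite_eq]; simp
    rw [h3, ← Finset.prod_mul_distrib]
    rw [Fin.prod_univ_two, Fintype.prod_prod_type, Fintype.prod_prod_type,
      ← Finset.prod_mul_distrib]
    refine Finset.prod_congr rfl fun j _ => ?_
    have lt_iff : ∀ (a b : Fin 2), (finProdFinEquiv (i, a) < finProdFinEquiv (j, b)) ↔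
        (i < j ∨ (i = j ∧ a < b)) := by
      intro a b
      rw [Fin.lt_def, Fin.lt_def, Fin.lt_def, Fin.ext_iff]
      simp only [finProdFinEquiv_apply_val]
      have := a.2; have := b.2
      omega
    simp only [Fin.prod_univ_two, lt_iff]
    rcases lt_trichotomy i j with h | h | h
    · simp [h, h.ne]; ring
    · subst h; simp
    · simp [h.ne', not_lt.mpr h.le]
  simp only [h2, Finset.prod_mul_distrib]
  rfl

lemma blockProd_perm {k : ℕ} (f : Fin k × Fin 2 → Fin k × Fin 2 → ℝ) (hf : ∀ u v, f u v = - f v u)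
    (σ : Equiv.Perm (Fin k × Fin 2)) :
    blockProd (fun u v => f (σ u) (σ v)) = ((Equiv.Perm.sign σ : ℤ) : ℝ) * blockProd f := by
  rw [← blockProd_eq, ← blockProd_eq]
  have := Equiv.Perm.prod_Ioi_comp_eq_sign_mul_prod (finProdFinEquiv.permCongr σ)
    (f := fun a b => f (finProdFinEquiv.symm a) (finProdFinEquiv.symm b)) (fun i j => hf _ _)
  simp only [Equiv.permCongr_apply, Equiv.symm_apply_apply, Equiv.Perm.sign_permCongr] at this
  exact this

lemma pfG_inj {k : ℕ} {σ : Equiv.Perm (Fin k × Fin 2)} (hG : σ ∈ pfG k) :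
    Function.Bijective (fun i => (σ (i, 0)).1) := by
  simp only [pfG, Finset.mem_filter, Finset.mem_univ, true_and] at hG
  apply Finite.injective_iff_bijective.mp
  intro i j hij
  simp only at hij
  by_contra hne
  have e1 : σ (i,0) ≠ σ (i,1) := by simp
  have e2 : σ (i,0) ≠ σ (j,0) := by simp [hne]
  have e3 : σ (i,1) ≠ σ (j,0) := by simp
  have f1 := hG i
  revert e1 e2 e3 hij f1
  generalize σ (i,0) = a
  generalize σ (i,1) = b
  generalize σ (j,0) = c
  obtain ⟨a, a'⟩ := a
  obtain ⟨b, b'⟩ := b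
  obtain ⟨c, c'⟩ := c
  simp only
  rintro rfl e1 e2 e3 rfl
  simp at e1 e2 e3
  omega

lemma one_pfG (k : ℕ) : (1 : Equiv.Perm (Fin k × Fin 2)) ∈ pfG k := by simp [pfG]

/-- perfect matchings of `S` using edges of `E` -/
def pmSet (S : Finset Pt) (E : Finset (Sym2 Pt)) : Finset (Finset (Sym2 Pt)) :=
  E.powerset.filter (fun M => ∀ p ∈ S, ∃! e, e ∈ M ∧ p ∈ e)

/-- An edge set with endpoints in `S` without crossings. -/
structure PlaneE (S : Finset Pt) (E : Finset (Sym2 Pt)) : Prop where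
  mem : ∀ p q, s(p, q) ∈ E → p ∈ S ∧ q ∈ S ∧ p ≠ q
  nc : ∀ p q r s, s(p, q) ∈ E → s(r, s) ∈ E → ¬ Cross p q r s

lemma PlaneE.mono {S : Finset Pt} {E E' : Finset (Sym2 Pt)} (h : PlaneE S E) (hs : E' ⊆ E) :
    PlaneE S E' :=
  ⟨fun p q h' => h.mem p q (hs h'), fun p q r s h1 h2 => h.nc p q r s (hs h1) (hs h2)⟩

/-- edges of a block enumeration -/
def edgesOf {k : ℕ} (g : Fin k × Fin 2 → Pt) : Finset (Sym2 Pt) :=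
  Finset.univ.image (fun i => s(g (i, 0), g (i, 1)))

lemma edge_inj {k : ℕ} {g : Fin k × Fin 2 → Pt} (hg : Function.Injective g) :
    Function.Injective (fun i => s(g (i, 0), g (i, 1))) := by
  intro i j h
  simp only [Sym2.eq_iff] at h
  rcases h with ⟨h, _⟩ | ⟨h, _⟩
  · have := hg h; simp at this; exact this
  · have := hg h; simp at this

lemma pm_enum {k : ℕ} {S : Finset Pt} (hk : S.card = k * 2) {E M : Finset (Sym2 Pt)}
    (hE : PlaneE S E) (hM : M ∈ pmSet S E) (e0 : Fin k × Fin 2 ≃ {p // p ∈ S}) :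
    ∃ σ : Equiv.Perm (Fin k × Fin 2), edgesOf (fun u => (e0 (σ u) : Pt)) = M := by
  simp only [pmSet, Finset.mem_filter, Finset.mem_powerset] at hM
  obtain ⟨hME, hM⟩ := hM
  have hrep : ∀ e : {e // e ∈ M}, ∃ a : Fin 2 → Pt, e.1 = s(a 0, a 1) := by
    rintro ⟨e, he⟩
    induction e with | h p q => exact ⟨![p, q], by simp⟩
  choose a ha using hrep
  have hne : ∀ e, a e 0 ≠ a e 1 ∧ a e 0 ∈ S ∧ a e 1 ∈ S := by
    intro e
    have := hE.mem (a e 0) (a e 1) (by rw [← ha]; exact hME e.2)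
    exact ⟨this.2.2, this.1, this.2.1⟩
  have hmem : ∀ e j, a e j ∈ S := by
    intro e j; fin_cases j
    · exact (hne e).2.1
    · exact (hne e).2.2
  have hin : ∀ e j, a e j ∈ e.1 := by
    intro e j; rw [ha]; fin_cases j <;> simp
  let φ : {e // e ∈ M} × Fin 2 → {p // p ∈ S} := fun u => ⟨a u.1 u.2, hmem _ _⟩
  have hφ : Function.Bijective φ := by
    constructor
    · rintro ⟨e, j⟩ ⟨e', j'⟩ h
      simp only [φ, Subtype.mk.injEq] at h
      have hee : e = e' := by
        apply Subtype.ext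
        refine (hM _ (hmem e j)).unique ⟨e.2, hin e j⟩ ⟨e'.2, ?_⟩
        rw [h]; exact hin e' j'
      subst hee
      have : j = j' := by
        by_contra hjj
        have := (hne e).1
        fin_cases j <;> fin_cases j' <;> simp at hjj h <;> first | exact this h | exact this h.symm
      rw [this]
    · rintro ⟨p, hp⟩
      obtain ⟨e, ⟨heM, hpe⟩, _⟩ := hM p hp
      have := ha ⟨e, heM⟩
      simp only at this
      rw [this, Sym2.mem_iff] at hpe
      rcases hpe with h | h
      · exact ⟨(⟨e, heM⟩, 0), Subtype.ext h.symm⟩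
      · exact ⟨(⟨e, heM⟩, 1), Subtype.ext h.symm⟩
  have hcard : Fintype.card {e // e ∈ M} = k := by
    have := Fintype.card_of_bijective hφ
    rw [Fintype.card_prod, Fintype.card_fin, Fintype.card_coe S, hk] at this
    omega
  let en : Fin k ≃ {e // e ∈ M} := (Fintype.equivFinOfCardEq hcard).symm
  let g : Fin k × Fin 2 ≃ {p // p ∈ S} :=
    (Equiv.prodCongr en (Equiv.refl _)).trans (Equiv.ofBijective φ hφ)
  refine ⟨g.trans e0.symm, ?_⟩
  ext e
  simp only [edgesOf, Finset.mem_image, Finset.mem_univ, true_and, Equiv.trans_apply,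
    Equiv.apply_symm_apply]
  have hg : ∀ i, s((g (i, 0) : Pt), (g (i, 1) : Pt)) = (en i).1 := by
    intro i; rw [ha (en i)]; rfl
  simp only [hg]
  constructor
  · rintro ⟨i, rfl⟩; exact (en i).2
  · intro he; exact ⟨en.symm ⟨e, he⟩, by simp⟩

lemma edgesOf_G {k : ℕ} (g : Fin k × Fin 2 → Pt) {ρ : Equiv.Perm (Fin k × Fin 2)} (hρ : ρ ∈ pfG k) :
    edgesOf (fun u => g (ρ u)) = edgesOf g := by
  have hb := pfG_inj hρ
  have hρ' := hρ
  simp only [pfG, Finset.mem_filter, Finset.mem_univ, true_and] at hρ'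
  have key : ∀ i, s(g (ρ (i, 0)), g (ρ (i, 1))) = s(g ((ρ (i, 0)).1, 0), g ((ρ (i, 0)).1, 1)) := by
    intro i
    have h1 := hρ' i
    have h2 : ρ (i, 0) ≠ ρ (i, 1) := by simp
    revert h1 h2
    generalize ρ (i, 0) = u
    generalize ρ (i, 1) = v
    obtain ⟨u, u'⟩ := u
    obtain ⟨v, v'⟩ := v
    simp only
    rintro rfl h
    fin_cases u' <;> fin_cases v' <;> simp at h ⊢
  ext e
  simp only [edgesOf, Finset.mem_image, Finset.mem_univ, true_and, key]
  constructor
  · rintro ⟨i, rfl⟩; exact ⟨_, rfl⟩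
  · rintro ⟨j, rfl⟩
    obtain ⟨i, hi⟩ := hb.2 j
    simp only at hi
    exact ⟨i, by rw [hi]⟩

/-- Kasteleyn weight. -/
def eps (t : ℝ) (S : Finset Pt) (p q : Pt) : ℝ := sg t p q * ∏ r ∈ S, ab t p q r

lemma ab_end1 (t : ℝ) (p q : Pt) : ab t p q p = 1 := by unfold ab; simp
lemma ab_end2 (t : ℝ) (p q : Pt) : ab t p q q = 1 := by unfold ab; simp
lemma sg_sq (t : ℝ) (p q : Pt) : sg t p q * sg t p q = 1 := by unfold sg; split_ifs <;> norm_num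
lemma ab_sq (t : ℝ) (p q r : Pt) : ab t p q r * ab t p q r = 1 := by unfold ab; split_ifs <;> norm_num

lemma kast_sign {k : ℕ} {S : Finset Pt} (hS : GP S) {t : ℝ} (ht : Set.InjOn (gx t) S)
    {E : Finset (Sym2 Pt)} (hE : PlaneE S E) (g : Fin k × Fin 2 ≃ {p // p ∈ S})
    (hg : ∀ i, s((g (i, 0) : Pt), (g (i, 1) : Pt)) ∈ E) :
    blockProd (fun u v => sg t (g u) (g v)) * ∏ i, eps t S (g (i, 0)) (g (i, 1)) = 1 := by
  have hS' : ∀ p q : Pt, ∏ r ∈ S, ab t p q r =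
      ∏ j : Fin k, (ab t p q (g (j, 0)) * ab t p q (g (j, 1))) := by
    intro p q
    rw [← Finset.prod_coe_sort, ← g.prod_comp (fun r => ab t p q (r : Pt)), Fintype.prod_prod_type]
    simp only [Fin.prod_univ_two]
  unfold blockProd eps
  simp only [hS']
  set K : Fin k → Fin k → ℝ := fun i j =>
    ab t (g (i, 0)) (g (i, 1)) (g (j, 0)) * ab t (g (i, 0)) (g (i, 1)) (g (j, 1)) with hK
  have hKii : ∀ i, K i i = 1 := by intro i; simp only [hK, ab_end1, ab_end2, mul_one]
  have hKprod : ∏ i, ∏ j, K i j = ∏ i, ∏ j, if i < j then K i j * K j i else 1 := by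
    have e1 : ∀ i j, K i j = (if i < j then K i j else 1) * (if j < i then K i j else 1) := by
      intro i j
      rcases lt_trichotomy i j with h | h | h
      · simp [h, not_lt.mpr h.le]
      · subst h; simp [hKii]
      · simp [h, not_lt.mpr h.le]
    calc ∏ i, ∏ j, K i j = (∏ i, ∏ j, if i < j then K i j else 1) *
          ∏ i, ∏ j, if j < i then K i j else 1 := by
          rw [← Finset.prod_mul_distrib]
          refine Finset.prod_congr rfl fun i _ => ?_
          rw [← Finset.prod_mul_distrib]
          exact Finset.prod_congr rfl fun j _ => e1 i j
      _ = (∏ i, ∏ j, if i < j then K i j else 1) * ∏ i, ∏ j, if i < j then K j i else 1 := by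
          congr 1
          rw [Finset.prod_comm]
      _ = _ := by
          rw [← Finset.prod_mul_distrib]
          refine Finset.prod_congr rfl fun i _ => ?_
          rw [← Finset.prod_mul_distrib]
          refine Finset.prod_congr rfl fun j _ => ?_
          split_ifs <;> simp
  rw [Finset.prod_mul_distrib]
  change _ * (_ * ∏ i, ∏ j, K i j) = 1
  rw [hKprod]
  have hne : ∀ u v, u ≠ v → (g u : Pt) ≠ g v := by
    intro u v h h'; exact h (g.injective (Subtype.ext h'))
  have hgx : ∀ u v, u ≠ v → gx t (g u : Pt) ≠ gx t (g v) := by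
    intro u v h h'; exact hne u v h (ht (g u).2 (g v).2 h')
  have hcr : ∀ u v w, u ≠ v → u ≠ w → v ≠ w → cr (g u : Pt) (g v) (g w) ≠ 0 :=
    fun u v w h1 h2 h3 => hS _ (g u).2 _ (g v).2 _ (g w).2 (hne _ _ h1) (hne _ _ h2) (hne _ _ h3)
  rw [mul_mul_mul_comm, ← Finset.prod_mul_distrib, ← Finset.prod_mul_distrib]
  rw [Finset.prod_eq_one (fun i _ => sg_sq t _ _), one_mul]
  refine Finset.prod_eq_one fun i _ => ?_
  rw [← Finset.prod_mul_distrib]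
  refine Finset.prod_eq_one fun j _ => ?_
  split_ifs with hij
  · have hij' := hij.ne
    have hij'' := hij.ne'
    exact kast4 t _ _ _ _ (hgx _ _ (by simp)) (hgx _ _ (by simp)) (hgx _ _ (by simp [hij']))
      (hgx _ _ (by simp)) (hgx _ _ (by simp)) (hgx _ _ (by simp [hij']))
      (hcr _ _ _ (by simp) (by simp [hij']) (by simp))
      (hcr _ _ _ (by simp) (by simp) (by simp [hij']))
      (hcr _ _ _ (by simp) (by simp [hij'']) (by simp))
      (hcr _ _ _ (by simp) (by simp) (by simp [hij'']))
      (hE.nc _ _ _ _ (hg i) (hg j))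
  · simp

lemma eps_anti {t : ℝ} {S : Finset Pt} {p q : Pt} (h : gx t p ≠ gx t q) :
    eps t S p q = - eps t S q p := by
  unfold eps
  rw [sg_anti t h.symm]
  simp only [ab_symm t q p]
  ring

lemma eps_sq (t : ℝ) (S : Finset Pt) (p q : Pt) : eps t S p q ^ 2 = 1 := by
  unfold eps
  rw [mul_pow, sq, sg_sq, ← Finset.prod_pow, Finset.prod_eq_one, one_mul]
  intro r _
  rw [sq, ab_sq]

lemma sum_sym {S : Finset Pt} {E : Finset (Sym2 Pt)} (hE : PlaneE S E) (f : Sym2 Pt → ℝ) :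
    ∑ p : {p // p ∈ S}, ∑ q : {p // p ∈ S}, (if s((p : Pt), (q : Pt)) ∈ E then f s((p : Pt), (q : Pt)) else 0) =
      2 * ∑ e ∈ E, f e := by
  have h1 : ∑ p : {p // p ∈ S}, ∑ q : {p // p ∈ S}, (if s((p : Pt), (q : Pt)) ∈ E then f s((p : Pt), (q : Pt)) else 0)
      = ∑ x ∈ (S ×ˢ S).filter (fun x => s(x.1, x.2) ∈ E), f s(x.1, x.2) := by
    rw [Finset.sum_filter, Finset.sum_product]
    rw [← Finset.sum_coe_sort S (fun p : Pt => ∑ q ∈ S, if s(p, q) ∈ E then f s(p, q) else 0)]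
    refine Finset.sum_congr rfl fun p _ => ?_
    exact Finset.sum_coe_sort S (fun q : Pt => if s((p : Pt), q) ∈ E then f s((p : Pt), q) else 0)
  rw [h1, Finset.mul_sum]
  rw [← Finset.sum_fiberwise_of_maps_to (s := (S ×ˢ S).filter (fun x => s(x.1, x.2) ∈ E)) (t := E)
    (g := fun x => s(x.1, x.2)) (fun x hx => (Finset.mem_filter.mp hx).2)]
  refine Finset.sum_congr rfl fun e he => ?_
  induction e with | h p q =>
  obtain ⟨hp, hq, hpq⟩ := hE.mem p q he
  have : ((S ×ˢ S).filter (fun x => s(x.1, x.2) ∈ E)).filter (fun x => s(x.1, x.2) = s(p, q)) =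
      {(p, q), (q, p)} := by
    ext ⟨a, b⟩
    simp only [Finset.mem_filter, Finset.mem_product, Finset.mem_insert, Finset.mem_singleton,
      Prod.mk.injEq, Sym2.eq_iff]
    constructor
    · rintro ⟨_, h⟩; exact h
    · rintro (⟨rfl, rfl⟩ | ⟨rfl, rfl⟩)
      · exact ⟨⟨⟨hp, hq⟩, he⟩, Or.inl ⟨rfl, rfl⟩⟩
      · exact ⟨⟨⟨hq, hp⟩, by rw [Sym2.eq_swap]; exact he⟩, Or.inr ⟨rfl, rfl⟩⟩
  rw [this, Finset.sum_pair (by simp [hpq])]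
  simp only
  rw [Sym2.eq_swap (a := q)]
  ring

/-- Kasteleyn bound on weighted perfect matchings. -/
theorem kasteleyn {S : Finset Pt} (hS : GP S) (hpos : 0 < S.card) (hev : Even S.card)
    {E : Finset (Sym2 Pt)} (hE : PlaneE S E) (w : Sym2 Pt → ℝ) (hw : ∀ e, 0 ≤ w e) :
    ∑ M ∈ pmSet S E, ∏ e ∈ M, w e ≤
      (2 / (S.card : ℝ) * ∑ e ∈ E, w e ^ 2) ^ ((S.card : ℝ) / 4) := by
  obtain ⟨k, hk⟩ := hev
  have hk2 : S.card = k * 2 := by omega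
  have hk0 : 0 < k := by omega
  obtain ⟨t, ht⟩ := exists_gx_inj S
  have e0 : Fin k × Fin 2 ≃ {p // p ∈ S} := Fintype.equivOfCardEq (by simp [hk2])
  have hne : ∀ u v, u ≠ v → gx t (e0 u : Pt) ≠ gx t (e0 v) := by
    intro u v h h'; exact h (e0.injective (Subtype.ext (ht (e0 u).2 (e0 v).2 h')))
  set f : Fin k × Fin 2 → Fin k × Fin 2 → ℝ := fun u v => if u = v then 0 else sg t (e0 u) (e0 v) with hf
  have hfa : ∀ u v, f u v = - f v u := by
    intro u v
    by_cases h : u = v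
    · simp [hf, h]
    · simp only [hf, h, Ne.symm h, if_false]
      exact sg_anti t (hne v u (Ne.symm h))
  have hfb : ∀ σ : Equiv.Perm (Fin k × Fin 2), blockProd (fun u v => f (σ u) (σ v)) =
      blockProd (fun u v => sg t (e0 (σ u)) (e0 (σ v))) := by
    intro σ
    unfold blockProd
    congr 1
    · refine Finset.prod_congr rfl fun i _ => ?_
      simp [hf]
    · refine Finset.prod_congr rfl fun i _ => Finset.prod_congr rfl fun j _ => ?_
      split_ifs with hij
      · simp [hf, hij.ne]
      · rfl
  set c := blockProd f with hc
  set A : Matrix (Fin k × Fin 2) (Fin k × Fin 2) ℝ := Matrix.of (fun u v =>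
    if s((e0 u : Pt), (e0 v : Pt)) ∈ E then eps t S (e0 u) (e0 v) * w s((e0 u : Pt), (e0 v : Pt)) else 0)
    with hA
  have hAa : ∀ u v, A u v = - A v u := by
    intro u v
    simp only [hA, Matrix.of_apply]
    rw [Sym2.eq_swap]
    split_ifs with h
    · have hx : gx t (e0 u : Pt) ≠ gx t (e0 v) := by
        intro h'; exact (hE.mem _ _ h).2.2 (ht (e0 v).2 (e0 u).2 h'.symm)
      rw [eps_anti hx]; ring
    · simp
  have hterm : ∀ σ : Equiv.Perm (Fin k × Fin 2),
      c * (((Equiv.Perm.sign σ : ℤ) : ℝ) * ∏ i : Fin k, A (σ (i, 0)) (σ (i, 1))) =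
      if (∀ i, s((e0 (σ (i, 0)) : Pt), (e0 (σ (i, 1)) : Pt)) ∈ E) then
        ∏ i, w s((e0 (σ (i, 0)) : Pt), (e0 (σ (i, 1)) : Pt)) else 0 := by
    intro σ
    split_ifs with h
    · have h1 := kast_sign hS ht hE (σ.trans e0) h
      have h2 := blockProd_perm f hfa σ
      rw [hfb] at h2
      simp only [Equiv.trans_apply] at h1
      rw [h2] at h1
      have h3 : ∏ i : Fin k, A (σ (i, 0)) (σ (i, 1)) =
          (∏ i, eps t S (e0 (σ (i, 0))) (e0 (σ (i, 1)))) *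
          ∏ i, w s((e0 (σ (i, 0)) : Pt), (e0 (σ (i, 1)) : Pt)) := by
        rw [← Finset.prod_mul_distrib]
        refine Finset.prod_congr rfl fun i _ => ?_
        simp only [hA, Matrix.of_apply]
        rw [if_pos (h i)]
      rw [h3]
      linear_combination (∏ i, w s((e0 (σ (i, 0)) : Pt), (e0 (σ (i, 1)) : Pt))) * h1
    · push Not at h
      obtain ⟨i, hi⟩ := h
      rw [Finset.prod_eq_zero (Finset.mem_univ i)]
      · simp
      · simp only [hA, Matrix.of_apply]; rw [if_neg hi]
  have hc1 : |c| = 1 := by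
    have habs : ∀ p q, |sg t p q| = 1 := by intro p q; unfold sg; split_ifs <;> simp
    have h1 := hfb 1
    simp only [Equiv.Perm.one_apply] at h1
    have : c = blockProd fun u v => sg t ↑(e0 u) ↑(e0 v) := h1
    rw [this, blockProd, abs_mul, Finset.abs_prod, Finset.abs_prod]
    simp only [habs, Finset.prod_const_one, one_mul]
    refine Finset.prod_eq_one fun i _ => ?_
    rw [Finset.abs_prod]
    refine Finset.prod_eq_one fun j _ => ?_
    split_ifs <;> simp [abs_mul, habs]
  -- lower bound
  have hlow : ((pfG k).card : ℝ) * ∑ M ∈ pmSet S E, ∏ e ∈ M, w e ≤ c * pfSum A := by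
    unfold pfSum
    rw [Finset.mul_sum, Finset.mul_sum]
    simp only [hterm]
    have hinj : ∀ σ : Equiv.Perm (Fin k × Fin 2),
        Function.Injective (fun u => (e0 (σ u) : Pt)) := by
      intro σ u v h
      exact σ.injective (e0.injective (Subtype.ext h))
    have hprod : ∀ σ : Equiv.Perm (Fin k × Fin 2),
        ∏ i, w s((e0 (σ (i, 0)) : Pt), (e0 (σ (i, 1)) : Pt)) =
        ∏ e ∈ edgesOf (fun u => (e0 (σ u) : Pt)), w e := by
      intro σ
      rw [edgesOf, Finset.prod_image]
      intro i _ j _ h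
      exact edge_inj (hinj σ) h
    have hall : ∀ σ : Equiv.Perm (Fin k × Fin 2),
        (∀ i, s((e0 (σ (i, 0)) : Pt), (e0 (σ (i, 1)) : Pt)) ∈ E) ↔
        edgesOf (fun u => (e0 (σ u) : Pt)) ⊆ E := by
      intro σ
      simp [edgesOf, Finset.image_subset_iff]
    simp only [hprod, hall]
    rw [← Finset.sum_filter]
    have hdis : ∀ M ∈ pmSet S E, ((pfG k).card : ℝ) * ∏ e ∈ M, w e ≤
        ∑ σ ∈ (Finset.univ.filter (fun σ : Equiv.Perm (Fin k × Fin 2) =>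
          edgesOf (fun u => (e0 (σ u) : Pt)) ⊆ E)).filter
            (fun σ => edgesOf (fun u => (e0 (σ u) : Pt)) = M),
          ∏ e ∈ edgesOf (fun u => (e0 (σ u) : Pt)), w e := by
      intro M hM
      have : ∀ σ ∈ (Finset.univ.filter (fun σ : Equiv.Perm (Fin k × Fin 2) =>
          edgesOf (fun u => (e0 (σ u) : Pt)) ⊆ E)).filter
            (fun σ => edgesOf (fun u => (e0 (σ u) : Pt)) = M),
          ∏ e ∈ edgesOf (fun u => (e0 (σ u) : Pt)), w e = ∏ e ∈ M, w e := by
        intro σ hσ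
        rw [(Finset.mem_filter.mp hσ).2]
      rw [Finset.sum_congr rfl this, Finset.sum_const, nsmul_eq_mul]
      refine mul_le_mul_of_nonneg_right ?_ (Finset.prod_nonneg fun e _ => hw e)
      obtain ⟨σ0, hσ0⟩ := pm_enum hk2 hE hM e0
      have hME : M ⊆ E := Finset.mem_powerset.mp (Finset.mem_filter.mp hM).1
      norm_cast
      refine Finset.card_le_card_of_injOn (fun ρ => σ0 * ρ) ?_ ?_
      · intro ρ hρ
        have h1 := edgesOf_G (fun u => (e0 (σ0 u) : Pt)) hρ
        simp only [Finset.coe_filter, Finset.mem_filter, Finset.mem_univ, true_and,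
          Set.mem_setOf_eq, Equiv.Perm.mul_apply]
        rw [h1, hσ0]
        exact ⟨hME, rfl⟩
      · intro a _ b _ h
        exact mul_left_cancel h
    refine (Finset.sum_le_sum hdis).trans ?_
    rw [← Finset.sum_biUnion]
    · refine Finset.sum_le_sum_of_subset_of_nonneg ?_ ?_
      · intro σ hσ
        simp only [Finset.mem_biUnion] at hσ
        obtain ⟨M, _, hσ⟩ := hσ
        exact (Finset.mem_filter.mp hσ).1
      · intro σ _ _
        exact Finset.prod_nonneg fun e _ => hw e
    · intro M _ M' _ hMM
      rw [Function.onFun, Finset.disjoint_left]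
      intro σ h1 h2
      exact hMM ((Finset.mem_filter.mp h1).2.symm.trans (Finset.mem_filter.mp h2).2)
  -- upper bound
  have hup : c * pfSum A ≤ (pfG k).card * ((∑ p, ∑ q, A p q ^ 2) / (2 * k)) ^ ((k : ℝ) / 2) := by
    refine (le_abs_self _).trans ?_
    rw [abs_mul, hc1, one_mul]
    exact pfSum_bound hk0 A hAa
  have hG0 : (0:ℝ) < (pfG k).card := by
    exact_mod_cast Finset.card_pos.mpr ⟨1, one_pfG k⟩
  have hfin := le_of_mul_le_mul_left (hlow.trans hup) hG0
  refine hfin.trans (le_of_eq ?_)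
  have hN : (S.card : ℝ) = 2 * k := by rw [hk2]; push_cast; ring
  have hsq : ∑ p, ∑ q, A p q ^ 2 = 2 * ∑ e ∈ E, w e ^ 2 := by
    rw [← sum_sym hE (fun e => w e ^ 2), ← e0.sum_comp]
    refine Finset.sum_congr rfl fun u _ => ?_
    rw [← e0.sum_comp]
    refine Finset.sum_congr rfl fun v _ => ?_
    simp only [hA, Matrix.of_apply]
    split_ifs
    · rw [mul_pow, eps_sq, one_mul]
    · simp
  rw [hsq, hN]
  have hk' : (0:ℝ) < k := by exact_mod_cast hk0
  congr 1
  · field_simp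
  · ring

end

section

/-- Pasch-type lemma: a segment `ab` crossing the side `pz` of a triangle `pXz`. -/
lemma trap (p X z a b : Pt) (hD : 0 < cr p X z) (ha : 0 < cr z p a) (hb : cr z p b < 0)
    (hY : cr a b p * cr a b z < 0) :
    (0 ≤ cr p X a ∧ 0 ≤ cr X z a) ∨ Cross a b p X ∨ Cross a b X z ∨
      (cr a b X = 0 ∧ cr p X a < 0 ∧ 0 < cr p X b ∧ cr X z a < 0 ∧ 0 < cr X z b) := by
  have i1 : cr a b p * cr p X z = cr z p a * cr p X b - cr p X a * cr z p b := by unfold cr; ring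
  have i2 : cr a b z * cr p X z = cr X z a * cr z p b - cr z p a * cr X z b := by unfold cr; ring
  have i3 : cr a b X * cr p X z = cr p X a * cr X z b - cr X z a * cr p X b := by unfold cr; ring
  have sa : cr X z a + cr z p a + cr p X a = cr p X z := by unfold cr; ring
  have sb : cr X z b + cr z p b + cr p X b = cr p X z := by unfold cr; ring
  unfold Cross
  generalize cr a b p = m1 at *
  generalize cr a b z = m2 at *
  generalize cr a b X = m3 at *
  generalize cr z p a = aX at *
  generalize cr z p b = bX at *
  generalize cr p X a = az at *
  generalize cr p X b = bz at *
  generalize cr X z a = ap at *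
  generalize cr X z b = bp at *
  generalize cr p X z = D at *
  have hsum : (m1 - m2) = aX - bX := by
    have : (m1 - m2) * D = (aX - bX) * D := by
      rw [sub_mul, i1, i2]
      have e1 : az = D - ap - aX := by linarith
      have e2 : bz = D - bp - bX := by linarith
      rw [e1, e2]; ring
    exact mul_right_cancel₀ hD.ne' this
  have hm1 : 0 < m1 := by
    by_contra h; push Not at h
    have : 0 < m2 := by
      by_contra h2; push Not at h2; nlinarith
    linarith
  have hm2 : m2 < 0 := by
    by_contra h; push Not at h; nlinarith
  have j1 : 0 < aX * bz - az * bX := by rw [← i1]; positivity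
  have j2 : ap * bX - aX * bp < 0 := by rw [← i2]; exact mul_neg_of_neg_of_pos hm2 hD
  -- consequences
  have hz : az < 0 → 0 < bz := by
    intro h
    by_contra h2; push Not at h2
    nlinarith [mul_pos (neg_pos.mpr h) (neg_pos.mpr hb), mul_nonneg ha.le (neg_nonneg.mpr h2)]
  have hp : ap < 0 → 0 < bp := by
    intro h
    by_contra h2; push Not at h2
    nlinarith [mul_pos (neg_pos.mpr h) (neg_pos.mpr hb), mul_nonneg ha.le (neg_nonneg.mpr h2)]
  rcases lt_trichotomy m3 0 with h3 | h3 | h3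
  · by_cases hz' : az < 0
    · right; left
      refine ⟨by nlinarith, ?_⟩
      have := hz hz'
      nlinarith
    · push Not at hz'
      by_cases hp' : ap < 0
      · -- contradiction
        exfalso
        have hbp := hp hp'
        have k : az * bp - ap * bz < 0 := by rw [← i3]; exact mul_neg_of_neg_of_pos h3 hD
        have hbz : bz < 0 := by
          by_contra h; push Not at h
          nlinarith [mul_nonneg hz' hbp.le, mul_nonneg (neg_nonneg.mpr hp'.le) h]
        -- az*bp < ap*bz ; aX*bz > az*bX ; ap*bX < aX*bp
        nlinarith [mul_pos (neg_pos.mpr hp') j1, mul_nonneg hz' (sub_nonneg.mpr j2.le), mul_pos ha (sub_pos.mpr k)]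
      · exact Or.inl ⟨hz', not_lt.mp hp'⟩
  · have k : az * bp - ap * bz = 0 := by rw [← i3, h3, zero_mul]
    by_cases hz' : az < 0
    · right; right; right
      have hbz := hz hz'
      have hap : ap < 0 := by
        by_contra h; push Not at h
        have hbp : bp ≤ 0 := by
          by_contra h'; push Not at h'
          nlinarith [mul_pos (neg_pos.mpr hz') h', mul_nonneg h hbz.le]
        have hap0 : 0 < ap := by
          rcases h.lt_or_eq with h' | h'
          · exact h'
          · rw [← h'] at j2; nlinarith
        nlinarith [mul_pos hap0 j1, mul_nonneg (neg_nonneg.mpr hz'.le) (sub_nonneg.mpr j2.le), mul_pos (neg_pos.mpr hz') (sub_pos.mpr j2)]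
      exact ⟨h3, hz', hbz, hap, hp hap⟩
    · push Not at hz'
      by_cases hp' : ap < 0
      · exfalso
        have hbp := hp hp'
        have hbz : bz ≤ 0 := by
          by_contra h; push Not at h
          nlinarith [mul_nonneg hz' hbp.le, mul_pos (neg_pos.mpr hp') h]
        nlinarith [mul_pos (neg_pos.mpr hp') j1, mul_nonneg hz' (sub_nonneg.mpr j2.le)]
      · exact Or.inl ⟨hz', not_lt.mp hp'⟩
  · by_cases hp' : ap < 0
    · right; right; left
      have := hp hp'
      exact ⟨by nlinarith, by nlinarith⟩
    · push Not at hp'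
      by_cases hz' : az < 0
      · exfalso
        have hbz := hz hz'
        have k : 0 < az * bp - ap * bz := by rw [← i3]; exact mul_pos h3 hD
        have hbp : bp < 0 := by
          by_contra h; push Not at h
          nlinarith [mul_nonneg (neg_nonneg.mpr hz'.le) h, mul_nonneg hp' hbz.le]
        nlinarith [mul_pos (neg_pos.mpr hz') (sub_pos.mpr j2), mul_nonneg hp' j1.le, mul_pos ha k]
      · exact Or.inl ⟨not_lt.mp hz', hp'⟩

end

section

/-- signed orientation determinant -/
def ce (e : ℝ) (p q r : Pt) : ℝ := e * cr p q r

lemma trapE (e : ℝ) (he : e = 1 ∨ e = -1) (p X z a b : Pt) (hD : 0 < e * cr p X z)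
    (ha : 0 < e * cr z p a) (hb : e * cr z p b < 0) (hY : cr a b p * cr a b z < 0) :
    (0 ≤ e * cr p X a ∧ 0 ≤ e * cr X z a) ∨ Cross a b p X ∨ Cross a b X z ∨
      (cr a b X = 0 ∧ e * cr p X a < 0 ∧ 0 < e * cr p X b ∧ e * cr X z a < 0 ∧
        0 < e * cr X z b) := by
  rcases he with rfl | rfl
  · simp only [one_mul] at *
    exact trap p X z a b hD ha hb hY
  · have := trap z X p a b (by rw [cr_swap' z p X]; have := cr_rot p X z; have := cr_rot X z p; linarith)
      (by rw [cr_swap z p a]; linarith) (by rw [cr_swap z p b]; linarith)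
      (by rw [mul_comm]; exact hY)
    rw [cr_swap X z a, cr_swap X z b, cr_swap p X a, cr_swap p X b] at this
    rcases this with ⟨h1, h2⟩ | h | h | ⟨h1, h2, h3, h4, h5⟩
    · left; constructor <;> linarith
    · right; right; left; exact h.swap.symm1.swap
    · right; left; exact h.swap.symm1.swap
    · right; right; right; refine ⟨h1, ?_, ?_, ?_, ?_⟩ <;> linarith

/-- point on the line through `p` and `z` -/
def lpt (p z : Pt) (t : ℝ) : Pt := (p.1 + t * (z.1 - p.1), p.2 + t * (z.2 - p.2))

lemma cr_lp (a b p z : Pt) (t : ℝ) : cr a b (lpt p z t) = (1 - t) * cr a b p + t * cr a b z := by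
  unfold cr lpt; ring

lemma cr_base_lp (p q a : Pt) (t : ℝ) : cr p (lpt p q t) a = t * cr p q a := by
  unfold cr lpt; ring

lemma cr_two_lp (r s a : Pt) (t t' : ℝ) : cr (lpt r s t) (lpt r s t') a = (t' - t) * cr r s a := by
  unfold cr lpt; ring

lemma lp_cross {p q r s : Pt} (h : cr r s p - cr r s q ≠ 0) :
    lpt p q (cr r s p / (cr r s p - cr r s q)) = lpt r s (cr p q r / (cr p q r - cr p q s)) := by
  have h2 : cr p q r - cr p q s = -(cr r s p - cr r s q) := by unfold cr; ring
  rw [h2]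
  have h3 : cr r s p - cr r s q = (r.1 - s.1) * (q.2 - p.2) - (r.2 - s.2) * (q.1 - p.1) := by
    unfold cr; ring
  rw [h3] at h ⊢
  unfold lpt
  ext
  · simp only; field_simp; unfold cr; ring
  · simp only; field_simp; unfold cr; ring

/-- a triangulation, as an edge set -/
structure IsTri (S : Finset Pt) (E : Finset (Sym2 Pt)) : Prop where
  pl : PlaneE S E
  mx : ∀ p ∈ S, ∀ q ∈ S, p ≠ q → (∀ r s, s(r, s) ∈ E → ¬ Cross p q r s) → s(p, q) ∈ E

def dt (u p z : Pt) : ℝ := u.1 * (z.1 - p.1) + u.2 * (z.2 - p.2)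

lemma dt_lp (u p a b : Pt) (t : ℝ) : dt u p (lpt a b t) = (1 - t) * dt u p a + t * dt u p b := by
  unfold dt lpt; ring

lemma dt_self (u p : Pt) : dt u p p = 0 := by unfold dt; ring

lemma dt_cr (u p a b c : Pt) : cr p a b * dt u p c = cr p c b * dt u p a + cr p a c * dt u p b := by
  unfold dt cr; ring

/-- angular minimum in an open half plane -/
lemma ang_min (e : ℝ) (p u : Pt) (Z : Finset Pt) (hZ : Z.Nonempty) (hu : ∀ z ∈ Z, 0 < dt u p z) :
    ∃ z0 ∈ Z, ∀ z ∈ Z, 0 ≤ e * cr p z0 z := by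
  obtain ⟨z0, h0, hm⟩ := Z.exists_min_image
    (fun z => (e * (u.1 * (z.2 - p.2) - u.2 * (z.1 - p.1))) / dt u p z) hZ
  refine ⟨z0, h0, fun z hz => ?_⟩
  have := hm z hz
  rw [div_le_div_iff₀ (hu _ h0) (hu _ hz)] at this
  have hu2 : 0 < u.1 ^ 2 + u.2 ^ 2 := by
    have := hu _ h0
    by_contra hn
    have h1 : u.1 = 0 := by nlinarith [sq_nonneg u.1, sq_nonneg u.2]
    have h2 : u.2 = 0 := by nlinarith [sq_nonneg u.1, sq_nonneg u.2]
    unfold dt at this; rw [h1, h2] at this; simp at this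
  have key : (u.1 ^ 2 + u.2 ^ 2) * (e * cr p z0 z) =
      e * (u.1 * (z.2 - p.2) - u.2 * (z.1 - p.1)) * dt u p z0 -
      e * (u.1 * (z0.2 - p.2) - u.2 * (z0.1 - p.1)) * dt u p z := by
    unfold cr dt; ring
  have : 0 ≤ (u.1 ^ 2 + u.2 ^ 2) * (e * cr p z0 z) := by rw [key]; linarith
  exact nonneg_of_mul_nonneg_right this hu2

set_option maxHeartbeats 1000000 in
/-- The geometric core of the visibility lemma. -/
lemma vis_core {S : Finset Pt} {T : Finset (Sym2 Pt)} (hS : GP S) (hT : IsTri S T)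
    (e : ℝ) (he : e = 1 ∨ e = -1) {p q r s : Pt} (hp : p ∈ S) (hq : q ∈ S) (hrs : s(r, s) ∈ T)
    (hr : 0 < e * cr p q r) (hs : e * cr p q s < 0) (h1 : 0 < e * cr s r p) (h2 : e * cr s r q < 0)
    (hmin : ∀ a b, s(a, b) ∈ T → cr a b p * cr a b (lpt p q (cr s r p / (cr s r p - cr s r q))) < 0 →
      ¬ Cross a b p q)
    (u : Pt) (huq : 0 < dt u p q) (hur : 0 < dt u p r) :
    ∃ z, s(p, z) ∈ T ∧ 0 < dt u p z := by
  have he2 : e * e = 1 := by rcases he with rfl | rfl <;> norm_num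
  have hgp : ∀ a b c d : Pt, (e * cr p a b) * (e * cr p c d) - (e * cr p a c) * (e * cr p b d) +
      (e * cr p a d) * (e * cr p b c) = 0 := by
    intro a b c d
    have := cr_gp p a b c d
    linear_combination e ^ 2 * this
  obtain ⟨hrS, hsS, hrs'⟩ := hT.pl.mem _ _ hrs
  set Z := S.filter (fun z => z ≠ p ∧ 0 ≤ e * cr p q z ∧ 0 ≤ e * cr p z r ∧ 0 ≤ e * cr s r z) with hZ
  have hrp : r ≠ p := by rintro rfl; simp [cr_self2] at hr
  have hqp : q ≠ p := by rintro rfl; simp [cr_self1] at hr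
  have hrZ : r ∈ Z := by
    simp only [hZ, Finset.mem_filter]
    exact ⟨hrS, hrp, hr.le, by simp [cr_self3], by simp [cr_self3]⟩
  have hZu : ∀ z ∈ Z, 0 < dt u p z ∧ 0 < e * cr p q z ∧ e * cr s r z < e * cr s r p := by
    intro z hz
    simp only [hZ, Finset.mem_filter] at hz
    obtain ⟨hzS, hzp, a1, a2, a3⟩ := hz
    have a1' : 0 < e * cr p q z := by
      rcases a1.lt_or_eq with h | h
      · exact h
      · exfalso
        by_cases hzq : z = q
        · rw [hzq] at a3; linarith
        · have := hS p hp q hq z hzS hqp.symm hzp.symm (Ne.symm hzq)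
          rcases he with rfl | rfl <;> apply this <;> linarith
    refine ⟨?_, a1', ?_⟩
    · have := dt_cr u p q r z
      have h3 : (e * cr p q r) * dt u p z = (e * cr p z r) * dt u p q + (e * cr p q z) * dt u p r := by
        linear_combination e * this
      have : 0 < (e * cr p q r) * dt u p z := by rw [h3]; positivity
      exact pos_of_mul_pos_right this hr.le
    · have h3 : (e * cr p q r) * (e * cr s r z - e * cr s r p) =
        (e * cr p z r) * (e * cr s r q - e * cr s r p) - (e * cr p q z) * (e * cr s r p) := by
        unfold cr; ring
      have : (e * cr p q r) * (e * cr s r z - e * cr s r p) < 0 := by rw [h3]; nlinarith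
      nlinarith
  obtain ⟨z, hz, hzmin⟩ := ang_min e p u Z ⟨r, hrZ⟩ (fun z hz => (hZu z hz).1)
  obtain ⟨hzu, hqz, hcP⟩ := hZu z hz
  have hz' := hz
  simp only [hZ, Finset.mem_filter] at hz
  obtain ⟨hzS, hzp, a1, a2, a3⟩ := hz
  refine ⟨z, ?_, hzu⟩
  apply hT.mx p hp z hzS (Ne.symm hzp)
  -- auxiliary: both endpoint orders
  have main : ∀ a b, s(a, b) ∈ T → Cross a b p z → e * cr p z a < 0 → False := by
    intro a b hab hc ha
    obtain ⟨haS, hbS, habne⟩ := hT.pl.mem _ _ hab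
    obtain ⟨c1, c2⟩ := hc
    have hb : 0 < e * cr p z b := by
      by_contra h; push Not at h
      have := mul_nonneg_of_nonpos_of_nonpos ha.le h
      nlinarith
    have hne1 : cr s r p - cr s r q ≠ 0 := by
      intro h
      have : e * cr s r p = e * cr s r q := by rw [sub_eq_zero.mp h]
      linarith
    have hne2 : cr s r p - cr s r z ≠ 0 := by
      intro h
      have : e * cr s r p = e * cr s r z := by rw [sub_eq_zero.mp h]
      linarith
    have hX := lp_cross hne1
    have hV := lp_cross hne2
    have hlam : cr s r p / (cr s r p - cr s r q) = (e * cr s r p) / (e * cr s r p - e * cr s r q) := by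
      rw [← mul_sub, mul_div_mul_left]; rintro rfl; simp at he2
    have hmu : cr s r p / (cr s r p - cr s r z) = (e * cr s r p) / (e * cr s r p - e * cr s r z) := by
      rw [← mul_sub, mul_div_mul_left]; rintro rfl; simp at he2
    have hmu1 : 1 ≤ cr s r p / (cr s r p - cr s r z) := by
      rw [hmu, le_div_iff₀ (by linarith)]; linarith
    have hlam0 : 0 < cr s r p / (cr s r p - cr s r q) := by
      rw [hlam]; apply div_pos <;> linarith
    have hlam1 : cr s r p / (cr s r p - cr s r q) < 1 := by
      rw [hlam, div_lt_one] <;> linarith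
    have hxi : cr p q s / (cr p q s - cr p q r) = (-(e * cr p q s)) / (e * cr p q r - e * cr p q s) := by
      have : -(e * cr p q s) = (-e) * cr p q s := by ring
      rw [this, show e * cr p q r - e * cr p q s = (-e) * (cr p q s - cr p q r) by ring, mul_div_mul_left]
      rintro h; have : e = 0 := by linarith
      rw [this] at he2; simp at he2
    have hxi0 : 0 < cr p q s / (cr p q s - cr p q r) := by
      rw [hxi]; apply div_pos <;> linarith
    have hxi1 : cr p q s / (cr p q s - cr p q r) < 1 := by
      rw [hxi, div_lt_one] <;> linarith
    have heta1 : cr p z s / (cr p z s - cr p z r) ≤ 1 := by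
      have e1 : cr p z s - cr p z r = -(cr s r p - cr s r z) := by unfold cr; ring
      have e2 : 1 - cr p z s / (cr p z s - cr p z r) = (e * cr p z r) / (e * cr s r p - e * cr s r z) := by
        rw [← mul_sub, mul_div_mul_left _ _ (by rintro rfl; simp at he2), one_sub_div (by rw [e1]; exact neg_ne_zero.mpr hne2), e1]
        rw [div_neg, ← neg_div]; congr 1; unfold cr; ring
      have : 0 ≤ (e * cr p z r) / (e * cr s r p - e * cr s r z) := div_nonneg a2 (by linarith)
      linarith
    set lam := cr s r p / (cr s r p - cr s r q)
    set mu := cr s r p / (cr s r p - cr s r z)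
    set xi := cr p q s / (cr p q s - cr p q r)
    set eta := cr p z s / (cr p z s - cr p z r)
    have hmu0 : 0 < mu := by linarith
    have hxe : xi < eta := by
      have e1 : e * cr p q (lpt p z mu) = mu * (e * cr p q z) := by rw [cr_lp, cr_self2]; ring
      have e2 : e * cr p q (lpt p q lam) = 0 := by rw [cr_lp, cr_self2, cr_self3]; ring
      rw [hV, cr_lp] at e1
      rw [hX, cr_lp] at e2
      have : (eta - xi) * (e * cr p q r - e * cr p q s) = mu * (e * cr p q z) := by linarith
      have h5 : 0 < (eta - xi) * (e * cr p q r - e * cr p q s) := by rw [this]; positivity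
      have := pos_of_mul_pos_left h5 (by linarith)
      linarith
    have hm := hmin a b hab
    have eX : ∀ c, cr p (lpt p q lam) c = lam * cr p q c := fun c => cr_base_lp _ _ _ _
    have eXV : ∀ c, cr (lpt p q lam) (lpt p z mu) c = (eta - xi) * cr s r c := by
      intro c; rw [hX, hV, cr_two_lp]
    have t := trapE e he p (lpt p q lam) (lpt p z mu) a b
      (by rw [eX, cr_lp, cr_self2]; nlinarith [mul_pos (mul_pos hlam0 hmu0) hqz])
      (by rw [show cr (lpt p z mu) p a = - cr p (lpt p z mu) a from cr_swap _ _ _, cr_base_lp]; nlinarith)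
      (by rw [show cr (lpt p z mu) p b = - cr p (lpt p z mu) b from cr_swap _ _ _, cr_base_lp]; nlinarith)
      (by rw [cr_lp]; nlinarith [mul_self_nonneg (cr a b p)])
    rcases t with ⟨t1, t2⟩ | t | t | ⟨t0, t1, t2, t3, t4⟩
    · rw [eX] at t1; rw [eXV] at t2
      have haZ : a ∈ Z := by
        simp only [hZ, Finset.mem_filter]
        have b1 : 0 ≤ e * cr p q a := by
          have : 0 ≤ lam * (e * cr p q a) := by linarith
          exact nonneg_of_mul_nonneg_right this hlam0
        refine ⟨haS, ?_, b1, ?_, ?_⟩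
        · rintro rfl; simp [cr_self2] at ha
        · have := hgp q a z r
          have b2 : 0 < e * cr p a z := by rw [cr_swap' p z a]; linarith
          have : 0 < (e * cr p q z) * (e * cr p a r) := by nlinarith [mul_nonneg b1 a2, mul_pos hr b2]
          exact (pos_of_mul_pos_right this hqz.le).le
        · have : 0 ≤ (eta - xi) * (e * cr s r a) := by linarith
          exact nonneg_of_mul_nonneg_right this (by linarith)
      have := hzmin a haZ
      linarith
    · refine hm t.1 ⟨?_, ?_⟩
      · have := t.1
        rw [cr_lp] at this
        have h6 : 0 ≤ (1 - lam) * (cr a b p * cr a b p) :=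
          mul_nonneg (by linarith) (mul_self_nonneg _)
        have h7 : lam * (cr a b p * cr a b q) < 0 := by nlinarith
        by_contra h8; push Not at h8
        nlinarith [mul_nonneg hlam0.le h8]
      · have := t.2
        rw [eX, eX] at this
        by_contra h8; push Not at h8
        nlinarith [mul_nonneg (mul_pos hlam0 hlam0).le h8]
    · refine hT.pl.nc a b s r hab (by rw [Sym2.eq_swap]; exact hrs) ⟨?_, ?_⟩
      · have := t.1
        rw [hX, hV, cr_lp, cr_lp] at this
        by_contra h8; push Not at h8
        nlinarith [mul_nonneg (mul_nonneg (sub_nonneg.mpr hxi1.le) (sub_nonneg.mpr heta1)) (mul_self_nonneg (cr a b s)),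
          mul_nonneg (mul_nonneg hxi0.le (hxi0.trans hxe).le) (mul_self_nonneg (cr a b r)),
          mul_nonneg (mul_nonneg (sub_nonneg.mpr hxi1.le) (hxi0.trans hxe).le) h8,
          mul_nonneg (mul_nonneg (sub_nonneg.mpr heta1) hxi0.le) h8]
      · have := t.2
        rw [eXV, eXV] at this
        by_contra h8; push Not at h8
        nlinarith [mul_nonneg (mul_self_nonneg (eta - xi)) h8]
    · rw [eXV] at t3 t4
      have k1 : 0 < eta - xi := by linarith
      have g1 : e * cr s r a < 0 := by
        by_contra h; push Not at h; nlinarith [mul_nonneg k1.le h]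
      have g2 : 0 < e * cr s r b := by
        by_contra h; push Not at h; nlinarith [mul_nonneg k1.le (neg_nonneg.mpr h)]
      refine hT.pl.nc a b s r hab (by rw [Sym2.eq_swap]; exact hrs) ⟨?_, ?_⟩
      · rw [hX, cr_lp] at t0
        have hs0 : cr a b s ≠ 0 := by
          apply hS a haS b hbS s hsS habne
          · rintro rfl; simp [cr_self2] at g1
          · rintro rfl; simp [cr_self2] at g2
        have h9 : xi * (cr a b s * cr a b r) = -(1 - xi) * (cr a b s * cr a b s) := by
          linear_combination cr a b s * t0
        have h10 : 0 < cr a b s * cr a b s := mul_self_pos.mpr hs0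
        by_contra h8; push Not at h8
        nlinarith [mul_nonneg hxi0.le h8, mul_pos (sub_pos.mpr hxi1) h10]
      · have := mul_neg_of_neg_of_pos g1 g2
        nlinarith
  intro a b hab hc
  have hc' := hc.swap
  have h0 : e * cr p z a * (e * cr p z b) < 0 := by
    have := hc.1
    nlinarith
  rcases lt_or_ge (e * cr p z a) 0 with h | h
  · exact main a b hab hc' h
  · refine main b a (by rw [Sym2.eq_swap]; exact hab) hc'.symm1 ?_
    by_contra h'; push Not at h'
    nlinarith [mul_nonneg h h']

lemma cross_sides {p q r s : Pt} (hc : Cross p q r s) (e : ℝ) (hr : 0 < e * cr p q r) :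
    e * cr p q s < 0 ∧ 0 < e * cr s r p ∧ e * cr s r q < 0 := by
  obtain ⟨h1, h2⟩ := hc
  have hs : e * cr p q s < 0 := by
    by_contra h; push Not at h
    nlinarith [mul_nonneg hr.le h, mul_nonneg (sq_nonneg e) (neg_nonneg.mpr h1.le), sq_nonneg e, mul_self_nonneg e, (pow_pos (show 0 < e ^ 2 by
      have : e ≠ 0 := by rintro rfl; simp at hr
      positivity) 1)]
  have hid : e * cr s r p - e * cr s r q = e * cr p q r - e * cr p q s := by unfold cr; ring
  have e2 : 0 < e ^ 2 := by
    have : e ≠ 0 := by rintro rfl; simp at hr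
    positivity
  have hprod : (e * cr s r p) * (e * cr s r q) < 0 := by
    have : (e * cr s r p) * (e * cr s r q) = e ^ 2 * (cr r s p * cr r s q) := by
      rw [cr_swap r s p, cr_swap r s q]; ring
    rw [this]; exact mul_neg_of_pos_of_neg e2 h2
  refine ⟨hs, ?_, ?_⟩
  · by_contra h; push Not at h
    nlinarith
  · by_contra h; push Not at h
    nlinarith

/-- Visibility: a triangulation has an edge at `p` into any open half plane containing a point. -/
lemma exists_nbr {S : Finset Pt} {T : Finset (Sym2 Pt)} (hS : GP S) (hT : IsTri S T)
    {p q : Pt} (hp : p ∈ S) (hq : q ∈ S) (u : Pt) (huq : 0 < dt u p q) :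
    ∃ z, s(p, z) ∈ T ∧ 0 < dt u p z := by
  by_cases hb : s(p, q) ∈ T
  · exact ⟨q, hb, huq⟩
  set Bl := (S ×ˢ S).filter (fun rs : Pt × Pt => s(rs.1, rs.2) ∈ T ∧ Cross p q rs.1 rs.2) with hBl
  have hne : Bl.Nonempty := by
    by_contra h
    apply hb
    refine hT.mx p hp q hq ?_ ?_
    · rintro rfl; simp [dt_self] at huq
    · intro r s hrs hc
      apply h
      obtain ⟨h1, h2, -⟩ := hT.pl.mem _ _ hrs
      exact ⟨(r, s), by simp [hBl, h1, h2, hrs, hc]⟩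
  obtain ⟨⟨r, s⟩, hrs, hm⟩ := Bl.exists_min_image
    (fun rs => cr rs.1 rs.2 p / (cr rs.1 rs.2 p - cr rs.1 rs.2 q)) hne
  simp only [hBl, Finset.mem_filter, Finset.mem_product] at hrs hm
  obtain ⟨⟨hr, hs⟩, hrsT, hc⟩ := hrs
  -- symmetric helper
  have main : ∀ r s, s(r, s) ∈ T → Cross p q r s → 0 < dt u p r →
      (∀ x : Pt × Pt, (x.1 ∈ S ∧ x.2 ∈ S) ∧ s(x.1, x.2) ∈ T ∧ Cross p q x.1 x.2 →
        cr s r p / (cr s r p - cr s r q) ≤ cr x.1 x.2 p / (cr x.1 x.2 p - cr x.1 x.2 q)) →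
      ∃ z, s(p, z) ∈ T ∧ 0 < dt u p z := by
    intro r s hrsT hc hur hm
    have hne0 : cr p q r ≠ 0 := by
      intro h; have := hc.1; rw [h] at this; simp at this
    obtain ⟨e, he, hr⟩ : ∃ e : ℝ, (e = 1 ∨ e = -1) ∧ 0 < e * cr p q r := by
      rcases lt_or_gt_of_ne hne0 with h | h
      · exact ⟨-1, Or.inr rfl, by linarith⟩
      · exact ⟨1, Or.inl rfl, by linarith⟩
    obtain ⟨h1, h2, h3⟩ := cross_sides hc e hr
    refine vis_core hS hT e he hp hq hrsT hr h1 h2 h3 ?_ u huq hur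
    intro a b hab hlt hcr
    obtain ⟨ha, hb, -⟩ := hT.pl.mem _ _ hab
    have := hm (a, b) ⟨⟨ha, hb⟩, hab, hcr.swap⟩
    simp only at this
    set lam := cr s r p / (cr s r p - cr s r q)
    rw [cr_lp] at hlt
    have h4 := hcr.1
    -- lam ≤ P/(P-Q), P*((1-lam)P+lam Q)<0
    set P := cr a b p
    set Q := cr a b q
    have hP : 0 < P * (P - Q) := by nlinarith [mul_self_nonneg P]
    have h5 : lam * (P * (P - Q)) ≤ P * P := by
      have h6 : P / (P - Q) * (P * (P - Q)) = P * P := by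
        have : P - Q ≠ 0 := by intro h; rw [h] at hP; simp at hP
        field_simp
      rw [← h6]
      exact mul_le_mul_of_nonneg_right this hP.le
    nlinarith
  have hcs := hc.swap
  have hne1 : cr r s p - cr r s q ≠ 0 := by
    intro h
    have : cr r s p = cr r s q := by linarith
    have h2 := hc.2
    rw [this] at h2; nlinarith [mul_self_nonneg (cr r s q)]
  have hX := lp_cross hne1
  have hsw : cr s r p / (cr s r p - cr s r q) = cr r s p / (cr r s p - cr r s q) := by
    rw [cr_swap r s p, cr_swap r s q, ← neg_sub_neg]
    rw [show - - cr r s q - - - cr r s p = -(cr r s p - cr r s q) by ring, neg_div_neg_eq]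
  have l0 : 0 < cr r s p / (cr r s p - cr r s q) := by
    have h2 := hc.2
    rw [← mul_div_mul_left _ _ (show cr r s p ≠ 0 by intro h; rw [h] at h2; simp at h2)]
    have hn : cr r s p ≠ 0 := by intro h; rw [h] at h2; simp at h2
    apply div_pos
    · exact mul_self_pos.mpr hn
    · nlinarith [mul_self_nonneg (cr r s p)]
  have x0 : 0 ≤ cr p q r / (cr p q r - cr p q s) ∧ cr p q r / (cr p q r - cr p q s) ≤ 1 := by
    have h2 := hc.1
    have hn : cr p q r ≠ 0 := by intro h; rw [h] at h2; simp at h2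
    have hd : 0 < cr p q r * (cr p q r - cr p q s) := by nlinarith [mul_self_nonneg (cr p q r)]
    rw [← mul_div_mul_left _ _ hn]
    constructor
    · apply div_nonneg _ hd.le
      exact mul_self_nonneg _
    · rw [div_le_one hd]; nlinarith
  have hd : 0 < dt u p (lpt p q (cr r s p / (cr r s p - cr r s q))) := by
    rw [dt_lp, dt_self]; nlinarith [mul_pos l0 huq]
  rw [hX, dt_lp] at hd
  by_cases hur : 0 < dt u p r
  · exact main r s hrsT hc hur (by rw [hsw]; exact hm)
  · refine main s r (by rw [Sym2.eq_swap]; exact hrsT) hc.symm2 ?_ hm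
    by_contra hus
    push Not at hur hus
    nlinarith [mul_nonneg (sub_nonneg.mpr x0.2) (neg_nonneg.mpr hur), mul_nonneg x0.1 (neg_nonneg.mpr hus)]

/-- local convexity of an edge set -/
def Conv (S : Finset Pt) (D : Finset (Sym2 Pt)) : Prop :=
  ∀ p ∈ S, ∀ u : Pt, (∃ q ∈ S, 0 < dt u p q) → ∃ q, s(p, q) ∈ D ∧ 0 < dt u p q

lemma Conv.mono {S : Finset Pt} {D D' : Finset (Sym2 Pt)} (h : Conv S D) (hs : D ⊆ D') : Conv S D' := by
  intro p hp u hu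
  obtain ⟨q, h1, h2⟩ := h p hp u hu
  exact ⟨q, hs h1, h2⟩

lemma IsTri.conv {S : Finset Pt} {T : Finset (Sym2 Pt)} (hS : GP S) (hT : IsTri S T) : Conv S T := by
  rintro p hp u ⟨q, hq, h⟩
  exact exists_nbr hS hT hp hq u h

end

section

lemma trapA (e : ℝ) (he : e = 1 ∨ e = -1) (p X z a b : Pt) (hD : 0 < e * cr p X z)
    (ha : 0 < e * cr z p a) (hb : e * cr z p b < 0) (hY : cr a b p * cr a b z < 0)
    (hin : 0 < e * cr X z a) :
    0 ≤ e * cr p X a ∨ Cross a b p X := by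
  rcases trapE e he p X z a b hD ha hb hY with ⟨h, -⟩ | h | h | ⟨-, -, -, h, -⟩
  · exact Or.inl h
  · exact Or.inr h
  · exfalso
    have he2 : e * e = 1 := by rcases he with rfl | rfl <;> norm_num
    have i1 : cr a b p * (e * cr p X z) = e * ((e * cr z p a) * (e * cr p X b) - (e * cr p X a) * (e * cr z p b)) := by
      have : cr a b p * cr p X z = cr z p a * cr p X b - cr p X a * cr z p b := by unfold cr; ring
      linear_combination e * this - e * (cr z p a * cr p X b - cr p X a * cr z p b) * he2
    have i2 : cr a b z * (e * cr p X z) = e * ((e * cr X z a) * (e * cr z p b) - (e * cr z p a) * (e * cr X z b)) := by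
      have : cr a b z * cr p X z = cr X z a * cr z p b - cr z p a * cr X z b := by unfold cr; ring
      linear_combination e * this - e * (cr X z a * cr z p b - cr z p a * cr X z b) * he2
    have i3 : cr a b X * (e * cr p X z) = e * ((e * cr p X a) * (e * cr X z b) - (e * cr X z a) * (e * cr p X b)) := by
      have : cr a b X * cr p X z = cr p X a * cr X z b - cr X z a * cr p X b := by unfold cr; ring
      linear_combination e * this - e * (cr p X a * cr X z b - cr X z a * cr p X b) * he2
    have sa : e * cr X z a + e * cr z p a + e * cr p X a = e * cr p X z := by unfold cr; ring
    have sb : e * cr X z b + e * cr z p b + e * cr p X b = e * cr p X z := by unfold cr; ring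
    obtain ⟨h1, h2⟩ := h
    have hbp : e * cr X z b < 0 := by
      by_contra hh; push Not at hh
      have h3 : cr X z a * cr X z b = (e * cr X z a) * (e * cr X z b) := by
        linear_combination -(cr X z a * cr X z b) * he2
      rw [h3] at h2
      nlinarith [mul_nonneg hin.le hh]
    have k12 : 0 < (e * cr a b p) * (-(e * cr a b z)) := by nlinarith
    have k23 : 0 < (e * cr a b X) * (-(e * cr a b z)) := by nlinarith
    have j1 : (e * cr a b p) * (e * cr p X z) = (e * cr z p a) * (e * cr p X b) - (e * cr p X a) * (e * cr z p b) := by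
      linear_combination e * i1 + ((e * cr z p a) * (e * cr p X b) - (e * cr p X a) * (e * cr z p b)) * he2
    have j2 : (e * cr a b z) * (e * cr p X z) = (e * cr X z a) * (e * cr z p b) - (e * cr z p a) * (e * cr X z b) := by
      linear_combination e * i2 + ((e * cr X z a) * (e * cr z p b) - (e * cr z p a) * (e * cr X z b)) * he2
    have j3 : (e * cr a b X) * (e * cr p X z) = (e * cr p X a) * (e * cr X z b) - (e * cr X z a) * (e * cr p X b) := by
      linear_combination e * i3 + ((e * cr p X a) * (e * cr X z b) - (e * cr X z a) * (e * cr p X b)) * he2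
    have hsum : e * cr a b p - e * cr a b z = e * cr z p a - e * cr z p b := by unfold cr; ring
    clear i1 i2 i3 h1 h2 hY
    generalize e * cr a b p = m1 at *
    generalize e * cr a b z = m2 at *
    generalize e * cr a b X = m3 at *
    generalize e * cr z p a = aX at *
    generalize e * cr z p b = bX at *
    generalize e * cr p X a = az at *
    generalize e * cr p X b = bz at *
    generalize e * cr X z a = ap at *
    generalize e * cr X z b = bp at *
    generalize e * cr p X z = D at *
    have hm2 : m2 < 0 := by
      by_contra hh; push Not at hh
      have : m1 ≤ 0 := by by_contra h3; push Not at h3; nlinarith [mul_nonneg h3.le hh]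
      linarith
    have hm1 : 0 < m1 := by
      by_contra hh; push Not at hh; nlinarith [mul_nonneg (neg_nonneg.mpr hh) (neg_nonneg.mpr hm2.le)]
    have hm3 : 0 < m3 := by
      by_contra hh; push Not at hh; nlinarith [mul_nonneg (neg_nonneg.mpr hh) (neg_nonneg.mpr hm2.le)]
    have q1 := mul_pos hm1 hD
    have q2 := mul_pos (neg_pos.mpr hm2) hD
    have q3 := mul_pos hm3 hD
    have hbz : 0 < bz := by linarith
    nlinarith [mul_pos ha q3, mul_pos hin q1, mul_pos ha hbz, mul_pos hin hbz, mul_pos (neg_pos.mpr hb) hbz]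
  · linarith

/-- Oriented (counterclockwise) triangular face. -/
structure Face (S : Finset Pt) (T : Finset (Sym2 Pt)) (p q r : Pt) : Prop where
  e1 : s(p, q) ∈ T
  e2 : s(q, r) ∈ T
  e3 : s(r, p) ∈ T
  pos : 0 < cr p q r
  emp : ∀ z ∈ S, ¬ (0 < cr p q z ∧ 0 < cr q r z ∧ 0 < cr r p z)

lemma Face.rot {S : Finset Pt} {T : Finset (Sym2 Pt)} {p q r : Pt} (h : Face S T p q r) :
    Face S T q r p :=
  ⟨h.e2, h.e3, h.e1, by rw [cr_rot]; exact h.pos, fun z hz ⟨a, b, c⟩ => h.emp z hz ⟨c, a, b⟩⟩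

lemma IsTri.sw {T : Finset (Sym2 Pt)} {p q : Pt} (h : s(p, q) ∈ T) : s(q, p) ∈ T := by
  rw [Sym2.eq_swap]; exact h

lemma cr_ne {p q r : Pt} (h : cr p q r ≠ 0) : p ≠ q ∧ q ≠ r ∧ p ≠ r := by
  refine ⟨?_, ?_, ?_⟩ <;> rintro rfl <;> simp [cr_self1, cr_self2, cr_self3] at h

lemma GP.eq_of {S : Finset Pt} (hS : GP S) {p q a : Pt} (hp : p ∈ S) (hq : q ∈ S) (ha : a ∈ S)
    (hpq : p ≠ q) (h : cr p q a = 0) : a = p ∨ a = q := by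
  by_contra hn; push Not at hn
  exact hS p hp q hq a ha hpq hn.1.symm hn.2.symm h

lemma closed_tri {S : Finset Pt} (hS : GP S) {p q r a : Pt} (hp : p ∈ S) (hq : q ∈ S) (hr : r ∈ S)
    (ha : a ∈ S) (hpos : 0 < cr p q r) (h1 : 0 ≤ cr p q a) (h2 : 0 ≤ cr q r a) (h3 : 0 ≤ cr r p a) :
    a = p ∨ a = q ∨ a = r ∨ (0 < cr p q a ∧ 0 < cr q r a ∧ 0 < cr r p a) := by
  obtain ⟨n1, n2, n3⟩ := cr_ne hpos.ne'
  rcases h1.lt_or_eq with h1 | h1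
  · rcases h2.lt_or_eq with h2 | h2
    · rcases h3.lt_or_eq with h3 | h3
      · exact Or.inr (Or.inr (Or.inr ⟨h1, h2, h3⟩))
      · rcases hS.eq_of hr hp ha n3.symm h3.symm with h | h <;> simp [h]
    · rcases hS.eq_of hq hr ha n2 h2.symm with h | h <;> simp [h]
  · rcases hS.eq_of hp hq ha n1 h1.symm with h | h <;> simp [h]

lemma tri_cross {S : Finset Pt} (hS : GP S) {p q r a b : Pt} (hr : r ∈ S)
    (ha : a ∈ S) (hb : b ∈ S) (hpos : 0 < cr p q r) (hc : Cross a b p q) (hpa : 0 < cr p q a) :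
    (0 ≤ cr q r a ∧ 0 ≤ cr r p a) ∨ Cross a b q r ∨ Cross a b r p := by
  have hpb : cr p q b < 0 := by
    by_contra h; push Not at h
    nlinarith [hc.2, mul_nonneg hpa.le h]
  rcases trap q r p a b (by rw [cr_rot]; exact hpos) hpa hpb (by rw [mul_comm]; exact hc.1) with h | h | h | ⟨h, h1, h2, -, -⟩
  · exact Or.inl h
  · exact Or.inr (Or.inl h)
  · exact Or.inr (Or.inr h)
  · exfalso
    rcases hS.eq_of ha hb hr hc.ne.1 h with h | h
    · rw [h] at h1; simp [cr_self3] at h1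
    · rw [h] at h2; simp [cr_self3] at h2

set_option maxHeartbeats 1000000 in
lemma empt_core {S : Finset Pt} {T : Finset (Sym2 Pt)} (hS : GP S) (hT : IsTri S T)
    (e : ℝ) (he : e = 1 ∨ e = -1) {p q r z a b : Pt} (hpq : s(p, q) ∈ T)
    (h0 : 0 < e * cr p q r)
    (z1 : 0 < e * cr p q z) (z2 : 0 < e * cr q r z) (z3 : 0 < e * cr r p z)
    (hab : s(a, b) ∈ T) (hc : Cross a b p z) (ha : e * cr p z a < 0)
    (hl : e * cr q r z < e * cr q r a) :
    0 < e * cr p q a ∧ 0 < e * cr q r a ∧ 0 < e * cr r p a := by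
  obtain ⟨hp, hq, hpq'⟩ := hT.pl.mem _ _ hpq
  obtain ⟨haS, hbS, habne⟩ := hT.pl.mem _ _ hab
  have he2 : e * e = 1 := by rcases he with rfl | rfl <;> norm_num
  have hb : 0 < e * cr p z b := by
    by_contra h; push Not at h
    have := mul_nonneg_of_nonpos_of_nonpos ha.le h
    nlinarith [hc.2]
  have hs : e * cr p q z + e * cr q r z + e * cr r p z = e * cr p q r := by unfold cr; ring
  obtain ⟨t, ht⟩ : ∃ t, t * (e * cr p q r) = e * cr p q r - e * cr q r z := by
    refine ⟨(e * cr p q r - e * cr q r z) / (e * cr p q r), ?_⟩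
    exact div_mul_cancel₀ _ h0.ne'
  have ht0 : 0 < t := by
    have : 0 < t * (e * cr p q r) := by rw [ht]; linarith
    exact pos_of_mul_pos_left this h0.le
  have ht1 : t < 1 := by
    by_contra h; push Not at h; nlinarith
  have key : ∀ c, (e * cr (lpt p q t) z c) * (e * cr p q r) =
      (e * cr p q z) * (e * cr q r c - e * cr q r z) := by
    intro c
    have : cr (lpt p q t) z c = cr p z c + t * (cr p q z - cr p q c) := by unfold cr lpt; ring
    rw [this]
    have k : cr p z c * cr p q r + cr p q r * (cr p q z - cr p q c) - cr q r z * (cr p q z - cr p q c) =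
      cr p q z * (cr q r c - cr q r z) := by unfold cr; ring
    linear_combination e ^ 2 * k + e * (cr p q z - cr p q c) * ht
  have b0 : 0 ≤ e * cr p q a := by
    rcases trapA e he p (lpt p q t) z a b (by rw [cr_base_lp]; nlinarith [mul_pos ht0 z1])
      (by rw [cr_swap p z a]; linarith) (by rw [cr_swap p z b]; linarith) hc.1
      (by
        have : 0 < (e * cr (lpt p q t) z a) * (e * cr p q r) := by
          rw [key]; exact mul_pos z1 (by linarith)
        exact pos_of_mul_pos_left this h0.le) with h | h
    · rw [cr_base_lp] at h
      have : 0 ≤ t * (e * cr p q a) := by linarith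
      exact nonneg_of_mul_nonneg_right this ht0
    · exfalso
      refine hT.pl.nc a b p q hab hpq ⟨?_, ?_⟩
      · have := h.1
        rw [cr_lp] at this
        have h6 : 0 ≤ (1 - t) * (cr a b p * cr a b p) :=
          mul_nonneg (by linarith) (mul_self_nonneg _)
        by_contra h8; push Not at h8
        nlinarith [mul_nonneg ht0.le h8]
      · have := h.2
        rw [cr_base_lp, cr_base_lp] at this
        by_contra h8; push Not at h8
        nlinarith [mul_nonneg (mul_pos ht0 ht0).le h8]
  have b1 : 0 < e * cr p q a := by
    rcases b0.lt_or_eq with h | h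
    · exact h
    · exfalso
      have h' : cr p q a = 0 := by rcases he with rfl | rfl <;> linarith
      rcases hS.eq_of hp hq haS hpq' h' with h | h
      · rw [h] at ha; simp [cr_self2] at ha
      · rw [h] at hl; simp [cr_self2] at hl; linarith
  refine ⟨b1, by linarith, ?_⟩
  have hgp := cr_gp p q a z r
  have h3 : e * cr p z r = e * cr r p z := by rw [cr_rot r p z]
  have h4 : e * cr r p a = e * cr p a r := by rw [cr_rot r p a]
  have h5 : 0 < e * cr p a z := by rw [cr_swap' p z a]; linarith
  have h6 : (e * cr p q z) * (e * cr p a r) = (e * cr p q a) * (e * cr p z r) + (e * cr p q r) * (e * cr p a z) := by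
    linear_combination (-e ^ 2) * hgp
  rw [h4]
  have : 0 < (e * cr p q z) * (e * cr p a r) := by rw [h6, h3]; positivity
  exact pos_of_mul_pos_right this z1.le

lemma cross_signs {p q a b : Pt} (hc : cr p q a * cr p q b < 0) :
    (0 < cr p q a ∧ cr p q b < 0) ∨ (cr p q a < 0 ∧ 0 < cr p q b) := by
  rcases mul_neg_iff.mp hc with h | h
  · exact Or.inl h
  · exact Or.inr h

/-- consecutive edges bound a face -/
lemma face_of_consec {S : Finset Pt} {T : Finset (Sym2 Pt)} (hS : GP S) (hT : IsTri S T)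
    {p q r : Pt} (hpq : s(p, q) ∈ T) (hpr : s(p, r) ∈ T) (hpos : 0 < cr p q r)
    (hno : ∀ z, s(p, z) ∈ T → ¬ (0 < cr p q z ∧ 0 < cr p z r)) : Face S T p q r := by
  obtain ⟨hp, hq, hpq'⟩ := hT.pl.mem _ _ hpq
  obtain ⟨-, hr, hpr'⟩ := hT.pl.mem _ _ hpr
  have hemp : ∀ z ∈ S, ¬ (0 < cr p q z ∧ 0 < cr q r z ∧ 0 < cr r p z) := by
    intro z0 hz0 hz0'
    set Z := S.filter (fun z => 0 < cr p q z ∧ 0 < cr q r z ∧ 0 < cr r p z) with hZ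
    obtain ⟨z, hz, hmax⟩ := Z.exists_max_image (fun z => cr q r z) ⟨z0, by simp [hZ, hz0, hz0']⟩
    simp only [hZ, Finset.mem_filter] at hz hmax
    obtain ⟨hzS, z1, z2, z3⟩ := hz
    have hpz : p ≠ z := by rintro rfl; simp [cr_self2] at z1
    refine hno z (hT.mx p hp z hzS hpz ?_) ⟨z1, by rw [cr_rot r p z]; exact z3⟩
    intro a b hab hc
    have main : ∀ a b, s(a, b) ∈ T → Cross a b p z → cr q r z < cr q r a → False := by
      intro a b hab hc hl
      obtain ⟨haS, hbS, habne⟩ := hT.pl.mem _ _ hab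
      rcases cross_signs hc.2 with ⟨ha, hb⟩ | ⟨ha, hb⟩
      · have := empt_core hS hT (-1) (Or.inr rfl) (p := p) (q := r) (r := q) (z := z) hpr (by rw [cr_swap' p q r]; linarith)
          (by rw [cr_swap r p z]; linarith) (by rw [cr_swap q r z]; linarith)
          (by rw [cr_swap p q z]; linarith) hab hc (by linarith)
          (by rw [cr_swap q r z, cr_swap q r a]; linarith)
        rw [cr_swap r p a, cr_swap q r a, cr_swap p q a] at this
        have := hmax a ⟨haS, by linarith, by linarith, by linarith⟩
        linarith
      · have := empt_core hS hT 1 (Or.inl rfl) (p := p) (q := q) (r := r) (z := z) hpq (by linarith)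
          (by linarith) (by linarith) (by linarith) hab hc (by linarith) (by linarith)
        have := hmax a ⟨haS, by linarith, by linarith, by linarith⟩
        linarith
    by_cases h : cr q r z < cr q r a
    · exact main a b hab hc.swap h
    · refine main b a (IsTri.sw hab) hc.swap.symm1 ?_
      push Not at h
      by_contra h'; push Not at h'
      -- both a and b not above level z, but crossing point is
      have hs : cr p q z + cr q r z + cr r p z = cr p q r := cr_sum p q r z
      have hLp : cr q r z < cr q r p := by rw [cr_rot p q r]; linarith
      have id : (cr a b p) * (cr q r z) - (cr a b z) * (cr q r p) =
          (cr p z b) * cr q r a - (cr p z a) * cr q r b := by unfold cr; ring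
      have id2 : cr a b p - cr a b z = cr p z b - cr p z a := by unfold cr; ring
      obtain ⟨c1, c2⟩ := hc
      rcases cross_signs c1 with ⟨x1, x2⟩ | ⟨x1, x2⟩ <;> rcases cross_signs c2 with ⟨y1, y2⟩ | ⟨y1, y2⟩ <;> nlinarith
  refine ⟨hpq, ?_, IsTri.sw hpr, hpos, hemp⟩
  have hqr' := (cr_ne hpos.ne').2.1
  refine hT.mx q hq r hr hqr' ?_
  have main : ∀ a b, s(a, b) ∈ T → Cross a b q r → 0 < cr q r a → False := by
    intro a b hab hc ha
    obtain ⟨haS, hbS, habne⟩ := hT.pl.mem _ _ hab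
    rcases tri_cross hS hp haS hbS (by rw [cr_rot]; exact hpos) hc ha with ⟨h1, h2⟩ | h | h
    · rcases closed_tri hS hp hq hr haS hpos h2 ha.le h1 with h | h | h | h
      · subst h
        apply hno b hab
        obtain ⟨h3, h4⟩ := hc
        have hbb : cr q r b < 0 := by
          by_contra h; push Not at h; nlinarith [mul_nonneg ha.le h]
        have id : cr a q b + cr q r b - cr a r b = cr a q r := by unfold cr; ring
        have id2 := cr_swap' a q b
        have id3 := cr_swap' a r b
        rcases cross_signs h3 with ⟨x1, x2⟩ | ⟨x1, x2⟩
        · exfalso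
          linarith
        · constructor <;> linarith
      · rw [h] at ha; simp [cr_self2] at ha
      · rw [h] at ha; simp [cr_self3] at ha
      · exact hemp a haS h
    · exact hT.pl.nc _ _ _ _ hab (IsTri.sw hpr) h
    · exact hT.pl.nc _ _ _ _ hab hpq h
  intro a b hab hc
  rcases cross_signs hc.1 with ⟨h, -⟩ | ⟨-, h⟩
  · exact main a b hab hc.swap h
  · exact main b a (IsTri.sw hab) hc.swap.symm1 h

end

section

variable {S : Finset Pt} {T D : Finset (Sym2 Pt)}

lemma Face.mem {p q r : Pt} (h : Face S T p q r) (hT : IsTri S T) : p ∈ S ∧ q ∈ S ∧ r ∈ S :=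
  ⟨(hT.pl.mem _ _ h.e1).1, (hT.pl.mem _ _ h.e1).2.1, (hT.pl.mem _ _ h.e2).2.1⟩

lemma Face.closed (hS : GP S) (hT : IsTri S T) {p q r a : Pt} (h : Face S T p q r) (ha : a ∈ S)
    (h1 : 0 ≤ cr p q a) (h2 : 0 ≤ cr q r a) (h3 : 0 ≤ cr r p a) : a = p ∨ a = q ∨ a = r := by
  obtain ⟨hp, hq, hr⟩ := h.mem hT
  rcases closed_tri hS hp hq hr ha h.pos h1 h2 h3 with h' | h' | h' | h'
  · exact Or.inl h'
  · exact Or.inr (Or.inl h')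
  · exact Or.inr (Or.inr h')
  · exact absurd h' (h.emp a ha)

/-- direction of the left normal -/
def nrm (p q : Pt) : Pt := (-(q.2 - p.2), q.1 - p.1)

lemma dt_nrm (p q z : Pt) : dt (nrm p q) p z = cr p q z := by unfold dt nrm cr; simp; ring

lemma left_face (hS : GP S) (hT : IsTri S T) {p q z : Pt} (hpq : s(p, q) ∈ T) (hz : z ∈ S)
    (h : 0 < cr p q z) : ∃ r, Face S T p q r := by
  obtain ⟨hp, hq, hne⟩ := hT.pl.mem _ _ hpq
  obtain ⟨r0, hr0, hr0'⟩ := exists_nbr hS hT hp hz (nrm p q) (by rw [dt_nrm]; exact h)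
  rw [dt_nrm] at hr0'
  set Z := S.filter (fun z => s(p, z) ∈ T ∧ 0 < cr p q z) with hZ
  obtain ⟨r, hr, hm⟩ := ang_min 1 p (nrm p q) Z ⟨r0, by simp [hZ, hr0, hr0', (hT.pl.mem _ _ hr0).2.1]⟩
    (by intro z hz; rw [dt_nrm]; simp [hZ] at hz; exact hz.2.2)
  simp only [hZ, Finset.mem_filter] at hr hm
  refine ⟨r, face_of_consec hS hT hpq hr.2.1 hr.2.2 ?_⟩
  rintro z hz ⟨h1, h2⟩
  have := hm z ⟨(hT.pl.mem _ _ hz).2.1, hz, h1⟩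
  rw [cr_swap' p z r] at this
  linarith

lemma corner (hS : GP S) (hT : IsTri S T) {p q r z : Pt} (hf : Face S T p q r) (hz : s(p, z) ∈ T)
    (h1 : 0 < cr p q z) (h2 : 0 < cr p z r) : False := by
  obtain ⟨hp, hq, hr⟩ := hf.mem hT
  have hzS := (hT.pl.mem _ _ hz).2.1
  have h3 : ¬ 0 ≤ cr q r z := by
    intro h
    rcases hf.closed hS hT hzS h1.le h (by rw [← cr_rot r p z]; exact h2.le) with h | h | h <;>
      rw [h] at h1 h2 <;> simp [cr_self2, cr_self3] at h1 h2
  push Not at h3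
  refine hT.pl.nc p z q r hz hf.e2 ⟨?_, ?_⟩
  · rw [cr_swap' p q z]; nlinarith
  · rw [cr_rot p q r]; nlinarith [hf.pos]

lemma face_unique (hS : GP S) (hT : IsTri S T) {p q r r' : Pt} (hf : Face S T p q r)
    (hf' : Face S T p q r') : r = r' := by
  by_contra hne
  obtain ⟨hp, hq, hr⟩ := hf.mem hT
  obtain ⟨-, -, hr'⟩ := hf'.mem hT
  have h0 := hS p hp r hr r' hr' (cr_ne hf.pos.ne').2.2 (cr_ne hf'.pos.ne').2.2 hne
  rcases lt_or_gt_of_ne h0 with h | h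
  · exact corner hS hT hf (IsTri.sw hf'.e3) hf'.pos (by rw [cr_swap' p r r']; linarith)
  · exact corner hS hT hf' (IsTri.sw hf.e3) hf.pos h

/-- flip data -/
structure Fl (S : Finset Pt) (T : Finset (Sym2 Pt)) (p q r s : Pt) : Prop where
  f1 : Face S T p q r
  f2 : Face S T q p s
  cx : Cross p q r s

lemma Fl.symm {p q r s : Pt} (h : Fl S T p q r s) : Fl S T q p s r := ⟨h.f2, h.f1, h.cx.symm1.symm2⟩

def fl (T : Finset (Sym2 Pt)) (p q r s : Pt) : Finset (Sym2 Pt) := insert s(r, s) (T.erase s(p, q))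

lemma fl_symm (T : Finset (Sym2 Pt)) (p q r s : Pt) : fl T q p s r = fl T p q r s := by
  unfold fl; rw [Sym2.eq_swap (a := s) (b := r), Sym2.eq_swap (a := q) (b := p)]

lemma Fl.sg {p q r s : Pt} (h : Fl S T p q r s) : 0 < cr p s r ∧ 0 < cr q r s := by
  have := cross_sides h.cx 1 (by linarith [h.f1.pos])
  have h1 := cr_rot p s r
  have h2 := cr_rot q r s
  have h3 := cr_swap r s q
  constructor <;> linarith

lemma Fl.mem {p q r s : Pt} (h : Fl S T p q r s) (hT : IsTri S T) : p ∈ S ∧ q ∈ S ∧ r ∈ S ∧ s ∈ S :=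
  ⟨(h.f1.mem hT).1, (h.f1.mem hT).2.1, (h.f1.mem hT).2.2, (h.f2.mem hT).2.2⟩

lemma quad_empty (hS : GP S) (hT : IsTri S T) {p q r s z : Pt} (h : Fl S T p q r s) (hz : z ∈ S)
    (h1 : 0 ≤ cr p s z) (h2 : 0 ≤ cr s r z) (h3 : 0 ≤ cr r p z) : z = p ∨ z = s ∨ z = r := by
  obtain ⟨g1, g2⟩ := h.sg
  have hzq : z ≠ q := by
    rintro rfl
    have := cr_swap r s z
    have := cr_rot z r s
    linarith
  have p1 := h.f1.pos
  have p2 := h.f2.pos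
  rcases le_total 0 (cr p q z) with h4 | h4
  · have id : cr p s r * cr q r z = cr r p z * cr q r s + cr s r z * cr p q r := by unfold cr; ring
    have : 0 ≤ cr q r z := by
      have : 0 ≤ cr p s r * cr q r z := by rw [id]; positivity
      exact nonneg_of_mul_nonneg_right this g1
    rcases h.f1.closed hS hT hz h4 this h3 with h | h | h
    · exact Or.inl h
    · exact absurd h hzq
    · exact Or.inr (Or.inr h)
  · have id : cr p s r * cr s q z = cr p s z * cr q r s + cr s r z * cr q p s := by unfold cr; ring
    have : 0 ≤ cr s q z := by
      have : 0 ≤ cr p s r * cr s q z := by rw [id]; positivity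
      exact nonneg_of_mul_nonneg_right this g1
    rcases h.f2.closed hS hT hz (by rw [cr_swap p q z]; linarith) h1 this with h | h | h
    · exact absurd h hzq
    · exact Or.inl h
    · exact Or.inr (Or.inl h)

lemma only_cross (hS : GP S) (hT : IsTri S T) {p q r s a b : Pt} (h : Fl S T p q r s)
    (hab : s(a, b) ∈ T) (hc : Cross a b r s) : s(a, b) = s(p, q) := by
  have main : ∀ p q r s a b, Fl S T p q r s → s(a, b) ∈ T → Cross a b r s → 0 < cr s r a → a = p := by
    intro p q r s a b h hab hc ha
    obtain ⟨hp, hq, hr, hs⟩ := h.mem hT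
    obtain ⟨haS, hbS, -⟩ := hT.pl.mem _ _ hab
    have g1 := h.sg.1
    rcases tri_cross hS hp haS hbS (p := s) (q := r) (by rw [cr_rot p s r]; exact g1) hc.swap.symm1.swap ha with ⟨x1, x2⟩ | x | x
    · rcases quad_empty hS hT h haS x2 ha.le x1 with h | h | h
      · exact h
      · rw [h] at ha; simp [cr_self2] at ha
      · rw [h] at ha; simp [cr_self3] at ha
    · exact absurd x (hT.pl.nc _ _ _ _ hab h.f1.e3)
    · exact absurd x (hT.pl.nc _ _ _ _ hab h.f2.e2)
  rcases cross_signs hc.2 with ⟨x, y⟩ | ⟨x, y⟩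
  · rw [main p q r s b a h (IsTri.sw hab) hc.symm1 (by rw [cr_swap]; linarith),
      main q p s r a b h.symm hab hc.symm2 x, Sym2.eq_swap]
  · rw [main p q r s a b h hab hc (by rw [cr_swap]; linarith),
      main q p s r b a h.symm (IsTri.sw hab) hc.symm2.symm1 y]

lemma fl_isTri (hS : GP S) (hT : IsTri S T) {p q r s : Pt} (h : Fl S T p q r s) :
    IsTri S (fl T p q r s) := by
  obtain ⟨hp, hq, hr, hs⟩ := h.mem hT
  have hne := h.cx.ne
  refine ⟨⟨?_, ?_⟩, ?_⟩
  · intro a b hab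
    rcases Finset.mem_insert.mp hab with hab | hab
    · rcases Sym2.eq_iff.mp hab with ⟨rfl, rfl⟩ | ⟨rfl, rfl⟩
      · exact ⟨hr, hs, hne.2.1⟩
      · exact ⟨hs, hr, hne.2.1.symm⟩
    · exact hT.pl.mem _ _ (Finset.mem_of_mem_erase hab)
  · have key : ∀ a b, s(a, b) ∈ T.erase s(p, q) → ¬ Cross a b r s := by
      intro a b hab hc
      exact (Finset.mem_erase.mp hab).1 (only_cross hS hT h (Finset.mem_of_mem_erase hab) hc)
    intro a b c d hab hcd hc
    rcases Finset.mem_insert.mp hab with hab' | hab' <;> rcases Finset.mem_insert.mp hcd with hcd' | hcd'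
    · have := hab'.trans hcd'.symm
      rcases Sym2.eq_iff.mp this with ⟨h1, h2⟩ | ⟨h1, h2⟩
      · exact hc.ne.2.2.1 h1
      · exact hc.ne.2.2.2.1 h1
    · rcases Sym2.eq_iff.mp hab' with ⟨rfl, rfl⟩ | ⟨rfl, rfl⟩
      · exact key _ _ hcd' hc.swap
      · exact key _ _ hcd' hc.symm1.swap
    · rcases Sym2.eq_iff.mp hcd' with ⟨rfl, rfl⟩ | ⟨rfl, rfl⟩
      · exact key _ _ hab' hc
      · exact key _ _ hab' hc.symm2
    · exact hT.pl.nc _ _ _ _ (Finset.mem_of_mem_erase hab') (Finset.mem_of_mem_erase hcd') hc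
  · intro a ha b hb hab hno
    have hrs : s(r, s) ∈ fl T p q r s := Finset.mem_insert_self _ _
    by_cases hb' : s(a, b) ∈ T
    · refine Finset.mem_insert_of_mem (Finset.mem_erase.mpr ⟨?_, hb'⟩)
      intro h'
      rcases Sym2.eq_iff.mp h' with ⟨rfl, rfl⟩ | ⟨rfl, rfl⟩
      · exact hno _ _ hrs h.cx
      · exact hno _ _ hrs h.cx.symm1
    · have hcr : Cross a b p q := by
        by_contra hn
        apply hb'
        apply hT.mx a ha b hb hab
        intro c d hcd hc
        by_cases he : s(c, d) = s(p, q)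
        · rcases Sym2.eq_iff.mp he with ⟨rfl, rfl⟩ | ⟨rfl, rfl⟩
          · exact hn hc
          · exact hn hc.symm2
        · exact hno c d (Finset.mem_insert_of_mem (Finset.mem_erase.mpr ⟨he, hcd⟩)) hc
      have main : ∀ p q r s a b, Fl S T p q r s → a ∈ S → b ∈ S →
          (∀ c d, s(c, d) ∈ fl T p q r s → ¬ Cross a b c d) →
          Cross a b p q → 0 < cr p q a → a = r := by
        intro p q r s a b h ha hb hno hc hpa
        obtain ⟨hp, hq, hr, hs⟩ := h.mem hT
        have hm : ∀ c d, s(c, d) ∈ T → s(c, d) ≠ s(p, q) → ¬ Cross a b c d := fun c d h1 h2 =>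
          hno c d (Finset.mem_insert_of_mem (Finset.mem_erase.mpr ⟨h2, h1⟩))
        obtain ⟨n1, n2, n3⟩ := cr_ne h.f1.pos.ne'
        rcases tri_cross hS hr ha hb h.f1.pos hc hpa with ⟨x1, x2⟩ | x | x
        · rcases h.f1.closed hS hT ha hpa.le x1 x2 with h | h | h
          · rw [h] at hpa; simp [cr_self2] at hpa
          · rw [h] at hpa; simp [cr_self3] at hpa
          · exact h
        · refine absurd x (hm _ _ h.f1.e2 ?_)
          intro h; rcases Sym2.eq_iff.mp h with ⟨h1, h2⟩ | ⟨h1, h2⟩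
          · exact n1 h1.symm
          · exact n3 h2.symm
        · refine absurd x (hm _ _ h.f1.e3 ?_)
          intro h; rcases Sym2.eq_iff.mp h with ⟨h1, h2⟩ | ⟨h1, h2⟩
          · exact n3 h1.symm
          · exact n2 h1.symm
      have hno' : ∀ c d, s(c, d) ∈ fl T q p s r → ¬ Cross a b c d := by rw [fl_symm]; exact hno
      have sw : ∀ {X : Finset (Sym2 Pt)}, (∀ c d, s(c, d) ∈ X → ¬ Cross a b c d) →
          (∀ c d, s(c, d) ∈ X → ¬ Cross b a c d) := fun h c d h1 h2 => h c d h1 h2.symm1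
      rcases cross_signs hcr.2 with ⟨x, y⟩ | ⟨x, y⟩
      · rw [main p q r s a b h ha hb hno hcr x, main q p s r b a h.symm hb ha (sw hno') hcr.symm1.symm2 (by rw [cr_swap]; linarith)]
        exact hrs
      · rw [main p q r s b a h hb ha (sw hno) hcr.symm1 y, main q p s r a b h.symm ha hb hno' hcr.symm2 (by rw [cr_swap]; linarith), Sym2.eq_swap]
        exact hrs

lemma Face.ne12 {p q r : Pt} (h : Face S T p q r) : p ≠ q ∧ q ≠ r ∧ p ≠ r := cr_ne h.pos.ne'

lemma fl_face1 (hS : GP S) (hT : IsTri S T) {p q r s : Pt} (h : Fl S T p q r s) :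
    Face S (fl T p q r s) p s r := by
  have hn := h.cx.ne
  have hm : ∀ c d, s(c, d) ∈ T → s(c, d) ≠ s(p, q) → s(c, d) ∈ fl T p q r s := fun c d h1 h2 =>
    (Finset.mem_insert_of_mem (Finset.mem_erase.mpr ⟨h2, h1⟩))
  refine ⟨?_, ?_, ?_, h.sg.1, ?_⟩
  · apply hm _ _ h.f2.e2
    intro h'; rcases Sym2.eq_iff.mp h' with ⟨h1, h2⟩ | ⟨h1, h2⟩
    · exact hn.2.2.2.2.2 h2.symm
    · exact hn.1 h1
  · rw [Sym2.eq_swap]; exact Finset.mem_insert_self _ _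
  · apply hm _ _ h.f1.e3
    intro h'; rcases Sym2.eq_iff.mp h' with ⟨h1, h2⟩ | ⟨h1, h2⟩
    · exact hn.2.2.1 h1.symm
    · exact hn.2.2.2.2.1 h1.symm
  · rintro z hz ⟨h1, h2, h3⟩
    rcases quad_empty hS hT h hz h1.le h2.le h3.le with h | h | h <;> rw [h] at h1 h2 <;>
      simp [cr_self2, cr_self3] at h1 h2

lemma fl_face2 (hS : GP S) (hT : IsTri S T) {p q r s : Pt} (h : Fl S T p q r s) :
    Face S (fl T p q r s) q r s := by
  rw [← fl_symm]; exact fl_face1 hS hT h.symm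

lemma fl_face {p q r s a b c : Pt} (h : Face S T a b c) (h1 : s(a, b) ≠ s(p, q))
    (h2 : s(b, c) ≠ s(p, q)) (h3 : s(c, a) ≠ s(p, q)) : Face S (fl T p q r s) a b c :=
  ⟨Finset.mem_insert_of_mem (Finset.mem_erase.mpr ⟨h1, h.e1⟩),
    Finset.mem_insert_of_mem (Finset.mem_erase.mpr ⟨h2, h.e2⟩),
    Finset.mem_insert_of_mem (Finset.mem_erase.mpr ⟨h3, h.e3⟩), h.pos, h.emp⟩

lemma left_exists (hS : GP S) (hT : IsTri S T) (hD : Conv S D) (hDT : D ⊆ T) {p q : Pt}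
    (hpq : s(p, q) ∈ T) (hn : s(p, q) ∉ D) : ∃ z ∈ S, 0 < cr p q z := by
  obtain ⟨hp, hq, hne⟩ := hT.pl.mem _ _ hpq
  by_contra hno
  push Not at hno
  set dq : Pt := (q.1 - p.1, q.2 - p.2) with hdq
  set M : ℝ := ∑ z ∈ S, |dt dq p z| / |cr p q z| with hM
  set u : Pt := (dq.1 + M * (nrm p q).1, dq.2 + M * (nrm p q).2) with hu
  have hdt : ∀ z, dt u p z = dt dq p z + M * cr p q z := by
    intro z; rw [← dt_nrm]; simp only [hu, dt]; ring
  obtain ⟨z, hz, hz'⟩ := hD p hp u ⟨q, hq, by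
    rw [hdt, cr_self3]
    simp only [dt, hdq]
    have : 0 < (q.1 - p.1) ^ 2 + (q.2 - p.2) ^ 2 := by
      by_contra h
      apply hne
      have h1 : q.1 - p.1 = 0 := by nlinarith [sq_nonneg (q.1 - p.1), sq_nonneg (q.2 - p.2)]
      have h2 : q.2 - p.2 = 0 := by nlinarith [sq_nonneg (q.1 - p.1), sq_nonneg (q.2 - p.2)]
      ext <;> linarith
    nlinarith⟩
  obtain ⟨-, hzS, hzp⟩ := hT.pl.mem _ _ (hDT hz)
  have hzq : z ≠ q := by rintro rfl; exact hn hz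
  have h0 := hS p hp q hq z hzS hne hzp hzq.symm
  have h1 := hno z hzS
  have h2 : cr p q z < 0 := lt_of_le_of_ne h1 h0
  have h3 : |dt dq p z| / |cr p q z| ≤ M :=
    Finset.single_le_sum (f := fun z => |dt dq p z| / |cr p q z|) (fun i _ => by positivity) hzS
  rw [div_le_iff₀ (abs_pos.mpr h0), abs_of_neg h2] at h3
  rw [hdt] at hz'
  have := le_abs_self (dt dq p z)
  nlinarith

lemma convex_at (hS : GP S) (hT : IsTri S T) (hD : Conv S D) (hDT : D ⊆ T) {p q r s : Pt}
    (hn : s(p, q) ∉ D) (f1 : Face S T p q r) (f2 : Face S T q p s) : 0 < cr p s r := by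
  obtain ⟨hp, hq, hr⟩ := f1.mem hT
  obtain ⟨-, -, hs⟩ := f2.mem hT
  have p1 := f1.pos
  have p2 : 0 < cr p s q := by rw [cr_rot q p s]; exact f2.pos
  have hrs : s ≠ r := by
    rintro rfl
    rw [cr_swap'] at p2; linarith
  have h0 := hS p hp s hs r hr (cr_ne p2.ne').1 (f1.ne12.2.2) hrs
  by_contra hneg
  have hneg' : cr p s r < 0 := lt_of_le_of_ne (not_lt.mp hneg) h0
  have hdt : ∀ z, dt (r.2 - p.2, -(r.1 - p.1)) p z = cr p z r := by
    intro z; simp only [dt, cr]; ring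
  obtain ⟨z, hz, hz'⟩ := hD p hp (r.2 - p.2, -(r.1 - p.1)) ⟨q, hq, by rw [hdt]; exact p1⟩
  rw [hdt] at hz'
  have hzT := hDT hz
  obtain ⟨-, hzS, hzp⟩ := hT.pl.mem _ _ hzT
  have hzq : z ≠ q := by rintro rfl; exact hn hz
  have hzs : z ≠ s := by rintro rfl; linarith
  have h1 : cr p q z < 0 := by
    refine lt_of_le_of_ne ?_ (hS p hp q hq z hzS f1.ne12.1 hzp hzq.symm)
    by_contra h; push Not at h
    exact corner hS hT f1 hzT h hz'
  have h2 : cr p s z < 0 := by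
    refine lt_of_le_of_ne ?_ (hS p hp s hs z hzS (cr_ne p2.ne').1 hzp hzs.symm)
    by_contra h; push Not at h
    exact corner hS hT f2.rot hzT h (by rw [cr_swap']; linarith)
  have gp := cr_gp p z q r s
  have i1 := cr_swap' p q z
  have i2 := cr_swap' p s z
  have i3 := cr_swap' p s r
  have i4 := cr_swap' p s q
  rw [i1, i2, i3, i4] at gp
  nlinarith [mul_pos (neg_pos.mpr h1) (neg_pos.mpr hneg'), mul_pos hz' p2, mul_pos (neg_pos.mpr h2) p1]

/-- Edges outside a locally convex subgraph are flippable. -/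
lemma flippable_of_conv (hS : GP S) (hT : IsTri S T) (hD : Conv S D) (hDT : D ⊆ T) {p q : Pt}
    (hpq : s(p, q) ∈ T) (hn : s(p, q) ∉ D) : ∃ r s, Fl S T p q r s := by
  obtain ⟨z, hz, hz'⟩ := left_exists hS hT hD hDT hpq hn
  obtain ⟨r, f1⟩ := left_face hS hT hpq hz hz'
  have hn' : s(q, p) ∉ D := fun h => hn (IsTri.sw h)
  obtain ⟨z, hz, hz'⟩ := left_exists hS hT hD hDT (IsTri.sw hpq) hn'
  obtain ⟨s, f2⟩ := left_face hS hT (IsTri.sw hpq) hz hz'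
  refine ⟨r, s, f1, f2, ?_⟩
  have c1 := convex_at hS hT hD hDT hn f1 f2
  have c2 := convex_at hS hT hD hDT hn' f2 f1
  have p1 := f1.pos
  have p2 := f2.pos
  rw [cr_swap p q s] at p2
  have i1 := cr_swap' p s r
  have i2 := cr_rot p r s
  have i3 := cr_rot q r s
  refine ⟨by nlinarith, ?_⟩
  have j1 : cr r s p < 0 := by linarith
  have j2 : 0 < cr r s q := by linarith
  exact mul_neg_of_neg_of_pos j1 j2

end

section

variable {S : Finset Pt} {T D : Finset (Sym2 Pt)}

/-- triangulations (as edge sets) containing `D` -/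
def trs (S : Finset Pt) (D : Finset (Sym2 Pt)) : Finset (Finset (Sym2 Pt)) :=
  S.sym2.powerset.filter (fun E => IsTri S E ∧ D ⊆ E)

lemma PlaneE.sub {E : Finset (Sym2 Pt)} (h : PlaneE S E) : E ⊆ S.sym2 := by
  intro e he
  induction e with | _ p q =>
  have := h.mem p q he
  rw [Finset.mk_mem_sym2_iff]
  exact ⟨this.1, this.2.1⟩

lemma mem_trs {E : Finset (Sym2 Pt)} : E ∈ trs S D ↔ IsTri S E ∧ D ⊆ E := by
  unfold trs
  rw [Finset.mem_filter, Finset.mem_powerset]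
  exact ⟨fun h => h.2, fun h => ⟨h.1.pl.sub, h⟩⟩

lemma trs_anti {D' : Finset (Sym2 Pt)} (h : D ⊆ D') : trs S D' ⊆ trs S D := by
  intro E hE
  rw [mem_trs] at hE ⊢
  exact ⟨hE.1, h.trans hE.2⟩

/-- edges of `E` crossing `pq` -/
def crs (p q : Pt) (E : Finset (Sym2 Pt)) : Finset (Sym2 Pt) :=
  E.filter (fun e => ∃ a b, e = s(a, b) ∧ Cross p q a b)

lemma mem_crs {p q a b : Pt} {E : Finset (Sym2 Pt)} : s(a, b) ∈ crs p q E ↔ s(a, b) ∈ E ∧ Cross p q a b := by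
  unfold crs
  rw [Finset.mem_filter]
  constructor
  · rintro ⟨h, c, d, h1, h2⟩
    rcases Sym2.eq_iff.mp h1 with ⟨rfl, rfl⟩ | ⟨rfl, rfl⟩
    · exact ⟨h, h2⟩
    · exact ⟨h, h2.symm2⟩
  · rintro ⟨h, h2⟩
    exact ⟨h, a, b, rfl, h2⟩

lemma crs_empty (hT : IsTri S T) {p q : Pt} (h : s(p, q) ∈ T) : crs p q T = ∅ := by
  rw [Finset.eq_empty_iff_forall_notMem]
  intro e he
  induction e with | _ a b =>
  rw [mem_crs] at he
  exact hT.pl.nc _ _ _ _ h he.1 he.2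

lemma crs_symm (p q : Pt) (E : Finset (Sym2 Pt)) : crs q p E = crs p q E := by
  ext e
  induction e with | _ a b =>
  rw [mem_crs, mem_crs]
  exact ⟨fun h => ⟨h.1, h.2.symm1⟩, fun h => ⟨h.1, h.2.symm1⟩⟩

lemma cross_ext {u w z v y : Pt} (h1 : Cross u w z v) (h2 : Cross z u v y) : Cross u w v y := by
  have e1 : cr z u v * cr u w y = cr v y u * cr u w z + cr z u y * cr u w v := by unfold cr; ring
  have e3 : cr z v u * cr v y w = cr z v w * cr v y u + cr u w v * cr v y z := by unfold cr; ring
  obtain ⟨a1, a2⟩ := h1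
  obtain ⟨b1, b2⟩ := h2
  have s1 := cr_swap' z u v
  have s3 : cr v y z - cr v y u = - (cr z u v - cr z u y) := by unfold cr; ring
  have s4 : cr u w z - cr u w v = -(cr z v u - cr z v w) := by unfold cr; ring
  unfold Cross
  generalize cr u w z = A at *
  generalize cr u w v = B at *
  generalize cr z v u = C at *
  generalize cr z v w = E at *
  generalize cr z u v = c at *
  generalize cr z u y = d at *
  generalize cr v y z = F at *
  generalize cr v y u = G at *
  generalize cr u w y = Y at *
  generalize cr v y w = W at *
  rcases mul_neg_iff.mp b1 with ⟨h1, h2⟩ | ⟨h1, h2⟩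
  · have g1 : F < 0 ∧ 0 < G := by
      rcases mul_neg_iff.mp b2 with ⟨h3, h4⟩ | ⟨h3, h4⟩
      · linarith
      · exact ⟨h3, h4⟩
    have g2 : C < 0 ∧ 0 < E := by
      rcases mul_neg_iff.mp a2 with ⟨h3, h4⟩ | ⟨h3, h4⟩
      · linarith
      · exact ⟨h3, h4⟩
    have g3 : B < 0 ∧ 0 < A := by
      rcases mul_neg_iff.mp a1 with ⟨h3, h4⟩ | ⟨h3, h4⟩
      · exact ⟨h4, h3⟩
      · linarith
    have y1 : 0 < Y := by
      by_contra h; nlinarith [mul_pos g1.2 g3.2, mul_pos_of_neg_of_neg h2 g3.1]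
    have y2 : W < 0 := by
      by_contra h; nlinarith [mul_pos g1.2 g2.2, mul_pos_of_neg_of_neg g1.1 g3.1]
    exact ⟨by nlinarith, by nlinarith⟩
  · have g1 : 0 < F ∧ G < 0 := by
      rcases mul_neg_iff.mp b2 with ⟨h3, h4⟩ | ⟨h3, h4⟩
      · exact ⟨h3, h4⟩
      · linarith
    have g2 : 0 < C ∧ E < 0 := by
      rcases mul_neg_iff.mp a2 with ⟨h3, h4⟩ | ⟨h3, h4⟩
      · exact ⟨h3, h4⟩
      · linarith
    have g3 : 0 < B ∧ A < 0 := by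
      rcases mul_neg_iff.mp a1 with ⟨h3, h4⟩ | ⟨h3, h4⟩
      · linarith
      · exact ⟨h4, h3⟩
    have y1 : Y < 0 := by
      by_contra h; nlinarith [mul_pos_of_neg_of_neg g1.2 g3.2, mul_pos h2 g3.1]
    have y2 : 0 > -W := by
      by_contra h; nlinarith [mul_pos_of_neg_of_neg g1.2 g2.2, mul_pos g1.1 g3.1]
    exact ⟨by nlinarith, by nlinarith⟩

/-- family 1: flip of `pq` -/
lemma fam1 (hS : GP S) (hD : Conv S D) {p q : Pt} (hn : s(p, q) ∉ D) :
    (trs S (insert s(p, q) D)).card ≤ ((trs S D).filter (fun E => (crs p q E).card = 1)).card := by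
  refine le_trans (Finset.card_le_card ?_)
    (Finset.card_image_le (f := fun E => insert s(p, q) (E \ crs p q E)))
  intro T hT
  rw [mem_trs] at hT
  obtain ⟨hT, hDT⟩ := hT
  have hpq : s(p, q) ∈ T := hDT (Finset.mem_insert_self _ _)
  have hDT' : D ⊆ T := (Finset.subset_insert _ _).trans hDT
  obtain ⟨r, s, hf⟩ := flippable_of_conv hS hT hD hDT' hpq hn
  have hc : crs p q (fl T p q r s) = {s(r, s)} := by
    ext e
    induction e with | _ a b =>
    rw [mem_crs, Finset.mem_singleton]
    constructor
    · rintro ⟨h1, h2⟩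
      rcases Finset.mem_insert.mp h1 with h | h
      · exact h
      · exact absurd h2 (hT.pl.nc _ _ _ _ hpq (Finset.mem_of_mem_erase h))
    · intro h
      refine ⟨h ▸ Finset.mem_insert_self _ _, ?_⟩
      rcases Sym2.eq_iff.mp h with ⟨rfl, rfl⟩ | ⟨rfl, rfl⟩
      · exact hf.cx
      · exact hf.cx.symm2
  have hrs : s(r, s) ∉ T := fun h => hT.pl.nc _ _ _ _ hpq h hf.cx
  rw [Finset.mem_image]
  refine ⟨fl T p q r s, ?_, ?_⟩
  · rw [Finset.mem_filter, mem_trs, hc]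
    refine ⟨⟨fl_isTri hS hT hf, ?_⟩, by simp⟩
    intro e he
    refine Finset.mem_insert_of_mem (Finset.mem_erase.mpr ⟨?_, hDT' he⟩)
    rintro rfl; exact hn he
  · simp only [hc]
    unfold fl
    ext e
    simp only [Finset.mem_insert, Finset.mem_sdiff, Finset.mem_erase, Finset.mem_singleton]
    constructor
    · rintro (rfl | ⟨h1 | h1, h2⟩)
      · exact hpq
      · exact absurd h1 h2
      · exact h1.2
    · intro h
      by_cases h1 : e = s(p, q)
      · exact Or.inl h1
      · refine Or.inr ⟨Or.inr ⟨h1, h⟩, ?_⟩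
        rintro rfl; exact hrs h

/-- core of family 2 -/
lemma fam2_core (hT : IsTri S T) {u w z v y : Pt} (huw : s(u, w) ∈ T) (hzu : s(z, u) ∈ T)
    (hc1 : Cross u w z v) (hc2 : Cross z u v y) {T2 : Finset (Sym2 Pt)}
    (hT2 : T2 = insert s(v, y) ((insert s(z, v) (T.erase s(u, w))).erase s(z, u))) :
    crs u w T2 = {s(z, v), s(v, y)} ∧ s(z, v) ≠ s(v, y) ∧
      insert s(u, w) (insert s(z, u) (T2 \ crs u w T2)) = T := by
  have hc3 := cross_ext hc1 hc2
  have hzv : s(z, v) ∉ T := fun h => hT.pl.nc _ _ _ _ huw h hc1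
  have hvy : s(v, y) ∉ T := fun h => hT.pl.nc _ _ _ _ huw h hc3
  have hzvu : s(z, v) ≠ s(z, u) := fun h => hzv (h ▸ hzu)
  have hzy : z ≠ y := fun h => hc2.ne.2.2.2.1 h
  have hcrs : crs u w T2 = {s(z, v), s(v, y)} := by
    ext e
    induction e with | _ a b =>
    rw [mem_crs, Finset.mem_insert, Finset.mem_singleton]
    constructor
    · rintro ⟨h1, h2⟩
      rw [hT2, Finset.mem_insert, Finset.mem_erase, Finset.mem_insert, Finset.mem_erase] at h1
      rcases h1 with h | ⟨-, h | ⟨-, h⟩⟩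
      · exact Or.inr h
      · exact Or.inl h
      · exact absurd h2 (hT.pl.nc _ _ _ _ huw h)
    · rintro (h | h)
      · refine ⟨?_, ?_⟩
        · rw [h, hT2]
          exact Finset.mem_insert_of_mem (Finset.mem_erase.mpr ⟨hzvu, Finset.mem_insert_self _ _⟩)
        · rcases Sym2.eq_iff.mp h with ⟨rfl, rfl⟩ | ⟨rfl, rfl⟩
          · exact hc1
          · exact hc1.symm2
      · refine ⟨?_, ?_⟩
        · rw [h, hT2]
          exact Finset.mem_insert_self _ _
        · rcases Sym2.eq_iff.mp h with ⟨rfl, rfl⟩ | ⟨rfl, rfl⟩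
          · exact hc3
          · exact hc3.symm2
  refine ⟨hcrs, ?_, ?_⟩
  · intro h
    rcases Sym2.eq_iff.mp h with ⟨h1, h2⟩ | ⟨h1, h2⟩
    · exact hc1.ne.2.1 h1
    · exact hzy h1
  · rw [hcrs, hT2]
    ext e
    simp only [Finset.mem_insert, Finset.mem_sdiff, Finset.mem_erase, Finset.mem_singleton]
    constructor
    · rintro (rfl | rfl | ⟨h1 | ⟨h1, h2 | h2⟩, h3⟩)
      · exact huw
      · exact hzu
      · exact absurd (Or.inr h1) h3
      · exact absurd (Or.inl h2) h3
      · exact h2.2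
    · intro h
      by_cases h1 : e = s(u, w)
      · exact Or.inl h1
      by_cases h2 : e = s(z, u)
      · exact Or.inr (Or.inl h2)
      refine Or.inr (Or.inr ⟨Or.inr ⟨h2, Or.inr ⟨h1, h⟩⟩, ?_⟩)
      rintro (rfl | rfl)
      · exact hzv h
      · exact hvy h

/-- two crossing edges sharing a vertex on the right of `uw` -/
def sh (u w : Pt) (E : Finset (Sym2 Pt)) : Prop :=
  (crs u w E).card = 2 ∧ ∃ v, cr u w v < 0 ∧ ∀ e ∈ crs u w E, v ∈ e

lemma fam2a (hS : GP S) (hD : Conv S D) {u w z : Pt} (hn : s(u, w) ∉ D) (hn2 : s(z, u) ∉ D)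
    (hF : ∀ T, IsTri S T → insert s(u, w) (insert s(z, u) D) ⊆ T → Face S T u w z) :
    (trs S (insert s(u, w) (insert s(z, u) D))).card ≤ ((trs S D).filter (sh u w)).card := by
  refine le_trans (Finset.card_le_card ?_)
    (Finset.card_image_le (f := fun E => insert s(u, w) (insert s(z, u) (E \ crs u w E))))
  intro T hT
  rw [mem_trs] at hT
  obtain ⟨hT, hDT⟩ := hT
  have hface := hF T hT hDT
  have hDT' : D ⊆ T := ((Finset.subset_insert _ _).trans (Finset.subset_insert _ _)).trans hDT
  obtain ⟨r, v, hf⟩ := flippable_of_conv hS hT hD hDT' hface.e1 hn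
  obtain rfl := face_unique hS hT hface hf.f1
  have hT1 := fl_isTri hS hT hf
  have hD1 : D ⊆ fl T u w z v := by
    intro e he
    refine Finset.mem_insert_of_mem (Finset.mem_erase.mpr ⟨?_, hDT' he⟩)
    rintro rfl; exact hn he
  have hF1 : Face S (fl T u w z v) z u v := (fl_face1 hS hT hf).rot.rot
  obtain ⟨r, y, hf2⟩ := flippable_of_conv hS hT1 hD hD1 hF1.e1 hn2
  obtain rfl := face_unique hS hT1 hF1 hf2.f1
  obtain ⟨k1, k2, k3⟩ := fam2_core hT hface.e1 hface.e3 hf.cx hf2.cx (T2 := fl (fl T u w z v) z u v y) rfl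
  rw [Finset.mem_image]
  refine ⟨_, ?_, k3⟩
  rw [Finset.mem_filter, mem_trs]
  refine ⟨⟨fl_isTri hS hT1 hf2, ?_⟩, ?_, v, ?_, ?_⟩
  · intro e he
    refine Finset.mem_insert_of_mem (Finset.mem_erase.mpr ⟨?_, hD1 he⟩)
    rintro rfl; exact hn2 he
  · rw [k1, Finset.card_pair k2]
  · have := hf.f2.pos
    rw [cr_swap] at this; linarith
  · rw [k1]; simp

lemma fam2b (hS : GP S) (hD : Conv S D) {u w z : Pt} (hn : s(u, w) ∉ D) (hn2 : s(w, z) ∉ D)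
    (hF : ∀ T, IsTri S T → insert s(u, w) (insert s(w, z) D) ⊆ T → Face S T u w z) :
    (trs S (insert s(u, w) (insert s(w, z) D))).card ≤ ((trs S D).filter (sh u w)).card := by
  refine le_trans (Finset.card_le_card ?_)
    (Finset.card_image_le (f := fun E => insert s(u, w) (insert s(w, z) (E \ crs u w E))))
  intro T hT
  rw [mem_trs] at hT
  obtain ⟨hT, hDT⟩ := hT
  have hface := hF T hT hDT
  have hDT' : D ⊆ T := ((Finset.subset_insert _ _).trans (Finset.subset_insert _ _)).trans hDT
  obtain ⟨r, v, hf⟩ := flippable_of_conv hS hT hD hDT' hface.e1 hn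
  obtain rfl := face_unique hS hT hface hf.f1
  have hT1 := fl_isTri hS hT hf
  have hD1 : D ⊆ fl T u w z v := by
    intro e he
    refine Finset.mem_insert_of_mem (Finset.mem_erase.mpr ⟨?_, hDT' he⟩)
    rintro rfl; exact hn he
  have hF1 : Face S (fl T u w z v) w z v := fl_face2 hS hT hf
  obtain ⟨r, y, hf2⟩ := flippable_of_conv hS hT1 hD hD1 hF1.e1 hn2
  obtain rfl := face_unique hS hT1 hF1 hf2.f1
  obtain ⟨k1, k2, k3⟩ := fam2_core hT (u := w) (w := u) (z := z) (v := v) (y := y) (IsTri.sw hface.e1)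
    (IsTri.sw hface.e2) hf.cx.symm1 hf2.cx.symm1 (T2 := fl (fl T u w z v) w z v y) (by
      unfold fl; rw [Sym2.eq_swap (a := w) (b := z), Sym2.eq_swap (a := w) (b := u)])
  rw [crs_symm] at k1 k3
  rw [Sym2.eq_swap (a := w) (b := u), Sym2.eq_swap (a := z) (b := w)] at k3
  rw [Finset.mem_image]
  refine ⟨_, ?_, k3⟩
  rw [Finset.mem_filter, mem_trs]
  refine ⟨⟨fl_isTri hS hT1 hf2, ?_⟩, ?_, v, ?_, ?_⟩
  · intro e he
    refine Finset.mem_insert_of_mem (Finset.mem_erase.mpr ⟨?_, hD1 he⟩)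
    rintro rfl; exact hn2 he
  · rw [k1, Finset.card_pair k2]
  · have := hf.f2.pos
    rw [cr_swap] at this; linarith
  · rw [k1]; simp

lemma fam_sum {p q : Pt} :
    (trs S (insert s(p, q) D)).card + ((trs S D).filter (fun E => (crs p q E).card = 1)).card +
    ((trs S D).filter (sh p q)).card + ((trs S D).filter (sh q p)).card ≤ (trs S D).card := by
  have h0 : trs S (insert s(p, q) D) ⊆ (trs S D).filter (fun E => (crs p q E).card = 0) := by
    intro E hE
    have hE' := mem_trs.mp hE
    rw [Finset.mem_filter]
    refine ⟨trs_anti (Finset.subset_insert _ _) hE, ?_⟩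
    rw [crs_empty hE'.1 (hE'.2 (Finset.mem_insert_self _ _))]; rfl
  refine le_trans (Nat.add_le_add_right (Nat.add_le_add_right (Nat.add_le_add_right
    (Finset.card_le_card h0) _) _) _) ?_
  have hd : ∀ E, sh p q E → sh q p E → False := by
    rintro E ⟨h1, v, h2, h3⟩ ⟨-, v', h2', h3'⟩
    rw [crs_symm] at h3'
    have hne : v ≠ v' := by rintro rfl; rw [cr_swap] at h2'; linarith
    obtain ⟨a, b, hab, hE⟩ := Finset.card_eq_two.mp h1
    rw [hE] at h3 h3'
    have ha := (Sym2.mem_and_mem_iff hne).mp ⟨h3 a (by simp), h3' a (by simp)⟩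
    have hb := (Sym2.mem_and_mem_iff hne).mp ⟨h3 b (by simp), h3' b (by simp)⟩
    exact hab (ha.trans hb.symm)
  have hs : ∀ E, sh q p E → (crs p q E).card = 2 := by
    rintro E ⟨h1, -⟩; rw [crs_symm] at h1; exact h1
  rw [← Finset.card_union_of_disjoint, ← Finset.card_union_of_disjoint,
    ← Finset.card_union_of_disjoint]
  · apply Finset.card_le_card
    intro E hE
    simp only [Finset.mem_union, Finset.mem_filter] at hE
    tauto
  all_goals
    rw [Finset.disjoint_left]
    intro E h1 h2
    simp only [Finset.mem_union, Finset.mem_filter] at h1 h2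
  · rcases h1 with (h1 | h1) | h1
    · have := hs E h2.2; omega
    · have := hs E h2.2; omega
    · exact hd E h1.2 h2.2
  · have := h2.2.1; rcases h1 with h1 | h1 <;> omega
  · omega

end

section

variable {S : Finset Pt} {T D A : Finset (Sym2 Pt)}

structure XV (x : ℝ) : Prop where
  lo : 1 < x
  hi : x < 6 / 5
  cub : x ^ 3 = x ^ 2 + 1 / 4

/-- triangles with exactly two edges in `A`, rotated so that the edge outside `A` is first -/
def Mid (S : Finset Pt) (T A : Finset (Sym2 Pt)) (w z u : Pt) : Prop :=
  Face S T w z u ∧ s(w, z) ∉ A ∧ s(z, u) ∈ A ∧ s(u, w) ∈ A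

def mids (S : Finset Pt) (T A : Finset (Sym2 Pt)) : Finset (Pt × Pt × Pt) :=
  (S ×ˢ S ×ˢ S).filter (fun m => Mid S T A m.1 m.2.1 m.2.2)

lemma mem_mids (hT : IsTri S T) {m : Pt × Pt × Pt} : m ∈ mids S T A ↔ Mid S T A m.1 m.2.1 m.2.2 := by
  unfold mids
  simp only [Finset.mem_filter, Finset.mem_product]
  refine ⟨fun h => h.2, fun h => ⟨h.1.mem hT, h⟩⟩

/-- mids using the directed edge `ab` as an `A`-edge -/
def ld (S : Finset Pt) (T A : Finset (Sym2 Pt)) (a b : Pt) : Finset (Pt × Pt × Pt) :=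
  (mids S T A).filter (fun m => (m.2.1 = a ∧ m.2.2 = b) ∨ (m.2.2 = a ∧ m.1 = b))

lemma ld_unique (hS : GP S) (hT : IsTri S T) {a b : Pt} {m m' : Pt × Pt × Pt} (h : m ∈ ld S T A a b)
    (h' : m' ∈ ld S T A a b) : m = m' := by
  obtain ⟨w, z, u⟩ := m
  obtain ⟨w', z', u'⟩ := m'
  unfold ld at h h'
  rw [Finset.mem_filter, mem_mids hT] at h h'
  obtain ⟨⟨f, h1, h2, h3⟩, h⟩ := h
  obtain ⟨⟨f', h1', h2', h3'⟩, h'⟩ := h'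
  simp only at f f' h1 h2 h3 h1' h2' h3' h h'
  rcases h with ⟨rfl, rfl⟩ | ⟨rfl, rfl⟩ <;> rcases h' with ⟨rfl, rfl⟩ | ⟨rfl, rfl⟩
  · rw [face_unique hS hT f.rot f'.rot]
  · have := face_unique hS hT f.rot f'.rot.rot
    subst this
    exact absurd h3 h1'
  · have := face_unique hS hT f.rot.rot f'.rot
    subst this
    exact absurd h3' h1
  · rw [face_unique hS hT f.rot.rot f'.rot.rot]

lemma ld_card (hS : GP S) (hT : IsTri S T) (a b : Pt) : (ld S T A a b).card ≤ 1 :=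
  Finset.card_le_one.mpr fun _ h _ h' => ld_unique hS hT h h'

/-- loss when removing edges -/
lemma mids_erase (hT : IsTri S T) (a b : Pt) :
    mids S T A ⊆ mids S T (A.erase s(a, b)) ∪ (ld S T A a b ∪ ld S T A b a) := by
  intro m hm
  by_contra hn
  simp only [Finset.mem_union, not_or] at hn
  obtain ⟨n1, n2, n3⟩ := hn
  unfold ld at n2 n3
  rw [Finset.mem_filter] at n2 n3
  apply n1
  have hm' := (mem_mids hT).mp hm
  rw [mem_mids hT]
  refine ⟨hm'.1, fun h => hm'.2.1 (Finset.mem_of_mem_erase h), Finset.mem_erase.mpr ⟨?_, hm'.2.2.1⟩,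
    Finset.mem_erase.mpr ⟨?_, hm'.2.2.2⟩⟩
  · intro h
    rcases Sym2.eq_iff.mp h with h | h
    · exact n2 ⟨hm, Or.inl h⟩
    · exact n3 ⟨hm, Or.inl h⟩
  · intro h
    rcases Sym2.eq_iff.mp h with h | h
    · exact n2 ⟨hm, Or.inr h⟩
    · exact n3 ⟨hm, Or.inr h⟩

lemma ld_erase (hT : IsTri S T) (a b : Pt) {c d : Pt} :
    ld S T A c d ⊆ mids S T (A.erase s(a, b)) ∪ (ld S T A a b ∪ ld S T A b a) :=
  (Finset.filter_subset _ _).trans (mids_erase hT a b)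

/-- double loss -/
lemma mids_erase2 (hT : IsTri S T) (a b c d : Pt) :
    mids S T A ⊆ mids S T ((A.erase s(a, b)).erase s(c, d)) ∪
      ((ld S T A a b ∪ ld S T A b a) ∪ (ld S T A c d ∪ ld S T A d c)) := by
  intro m hm
  by_contra hn
  simp only [Finset.mem_union, not_or] at hn
  obtain ⟨n1, ⟨n2, n3⟩, n4, n5⟩ := hn
  unfold ld at n2 n3 n4 n5
  rw [Finset.mem_filter] at n2 n3 n4 n5
  apply n1
  have hm' := (mem_mids hT).mp hm
  rw [mem_mids hT]
  refine ⟨hm'.1, fun h => hm'.2.1 (Finset.mem_of_mem_erase (Finset.mem_of_mem_erase h)),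
    Finset.mem_erase.mpr ⟨?_, Finset.mem_erase.mpr ⟨?_, hm'.2.2.1⟩⟩,
    Finset.mem_erase.mpr ⟨?_, Finset.mem_erase.mpr ⟨?_, hm'.2.2.2⟩⟩⟩
  all_goals
    intro h
    rcases Sym2.eq_iff.mp h with h | h
  · exact n4 ⟨hm, Or.inl h⟩
  · exact n5 ⟨hm, Or.inl h⟩
  · exact n2 ⟨hm, Or.inl h⟩
  · exact n3 ⟨hm, Or.inl h⟩
  · exact n4 ⟨hm, Or.inr h⟩
  · exact n5 ⟨hm, Or.inr h⟩
  · exact n2 ⟨hm, Or.inr h⟩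
  · exact n3 ⟨hm, Or.inr h⟩

lemma sdiff_erase_ins {e : Sym2 Pt} (hA : A ⊆ T) (he : e ∈ A) : T \ A.erase e = insert e (T \ A) := by
  ext f
  simp only [Finset.mem_sdiff, Finset.mem_erase, Finset.mem_insert]
  constructor
  · rintro ⟨h1, h2⟩
    by_cases h : f = e
    · exact Or.inl h
    · exact Or.inr ⟨h1, fun h' => h2 ⟨h, h'⟩⟩
  · rintro (rfl | ⟨h1, h2⟩)
    · exact ⟨hA he, fun h => h.1 rfl⟩
    · exact ⟨h1, fun h => h2 h.2⟩

lemma pow_loss {x : ℝ} (hx : XV x) {m m' k : ℕ} (h : m ≤ m' + k) : x ^ m ≤ x ^ m' * x ^ k := by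
  rw [← pow_add]
  exact pow_le_pow_right₀ hx.lo.le h

/-- the face of any triangulation containing the three edges -/
lemma face_in {T' : Finset (Sym2 Pt)} {a b c : Pt} (h : Face S T a b c) (h1 : s(a, b) ∈ T')
    (h2 : s(b, c) ∈ T') (h3 : s(c, a) ∈ T') : Face S T' a b c := ⟨h1, h2, h3, h.pos, h.emp⟩

theorem lemmaK (hS : GP S) (hT : IsTri S T) {x : ℝ} (hx : XV x) :
    ∀ (n : ℕ) (A : Finset (Sym2 Pt)), A.card = n → A ⊆ T → Conv S (T \ A) →
      2 ^ A.card * x ^ (mids S T A).card ≤ ((trs S (T \ A)).card : ℝ) := by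
  intro n
  induction n using Nat.strong_induction_on with
  | _ n ih =>
  intro A hAn hA hC
  have x0 : 0 < x := by linarith [hx.lo]
  have hquad : x ^ 2 - x - 1 / 4 ≤ 0 := by nlinarith [hx.lo, hx.hi]
  -- induction hypothesis for one edge
  have ih1 : ∀ e ∈ A, 2 ^ (A.card - 1) * x ^ (mids S T (A.erase e)).card ≤
      ((trs S (insert e (T \ A))).card : ℝ) := by
    intro e he
    have := ih (A.card - 1) (by have := Finset.card_pos.mpr ⟨e, he⟩; omega) (A.erase e)
      (Finset.card_erase_of_mem he) ((Finset.erase_subset _ _).trans hA)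
      (by rw [sdiff_erase_ins hA he]; exact hC.mono (Finset.subset_insert _ _))
    rw [sdiff_erase_ins hA he, Finset.card_erase_of_mem he] at this
    exact this
  have ih2 : ∀ e ∈ A, ∀ f ∈ A, e ≠ f → 2 ^ (A.card - 2) * x ^ (mids S T ((A.erase e).erase f)).card ≤
      ((trs S (insert e (insert f (T \ A)))).card : ℝ) := by
    intro e he f hf hef
    have hf' : f ∈ A.erase e := Finset.mem_erase.mpr ⟨hef.symm, hf⟩
    have hc : ((A.erase e).erase f).card = A.card - 2 := by
      rw [Finset.card_erase_of_mem hf', Finset.card_erase_of_mem he]; omega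
    have hs : T \ ((A.erase e).erase f) = insert e (insert f (T \ A)) := by
      rw [sdiff_erase_ins ((Finset.erase_subset _ _).trans hA) hf', sdiff_erase_ins hA he,
        Finset.insert_comm]
    have := ih (A.card - 2) (by have := Finset.card_pos.mpr ⟨e, he⟩; omega) ((A.erase e).erase f)
      hc (((Finset.erase_subset _ _).trans (Finset.erase_subset _ _)).trans hA)
      (by rw [hs]; exact hC.mono ((Finset.subset_insert _ _).trans (Finset.subset_insert _ _)))
    rw [hs, hc] at this
    exact this
  have nD : ∀ e ∈ A, e ∉ T \ A := fun e he h => (Finset.mem_sdiff.mp h).2 he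
  rcases Finset.eq_empty_or_nonempty (mids S T A) with hm | ⟨⟨w, z, u⟩, hm⟩
  · rcases Finset.eq_empty_or_nonempty A with rfl | ⟨e, he⟩
    · rw [hm]
      simp only [Finset.card_empty, pow_zero, mul_one, Finset.sdiff_empty]
      have : 0 < (trs S T).card := Finset.card_pos.mpr ⟨T, mem_trs.mpr ⟨hT, subset_rfl⟩⟩
      exact_mod_cast this
    · have h1 := ih1 e he
      induction e with | _ p q =>
      have h2 := fam1 hS hC (nD _ he)
      have h3 := fam_sum (S := S) (D := T \ A) (p := p) (q := q)
      have h4 : 2 * (trs S (insert s(p, q) (T \ A))).card ≤ (trs S (T \ A)).card := by omega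
      have h4' : (2 : ℝ) * (trs S (insert s(p, q) (T \ A))).card ≤ (trs S (T \ A)).card := by
        exact_mod_cast h4
      rw [hm, Finset.card_empty, pow_zero, mul_one]
      have h5 : (1 : ℝ) ≤ x ^ (mids S T (A.erase s(p, q))).card := one_le_pow₀ hx.lo.le
      obtain ⟨k, hk⟩ : ∃ k, A.card = k + 1 := ⟨A.card - 1, by have := Finset.card_pos.mpr ⟨_, he⟩; omega⟩
      rw [hk] at h1 ⊢
      simp only [Nat.add_sub_cancel] at h1
      have : (0 : ℝ) < 2 ^ k := by positivity
      rw [pow_succ]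
      nlinarith
  · have hm' := (mem_mids hT).mp hm
    simp only at hm'
    obtain ⟨hF, hwz, hzu, huw⟩ := hm'
    have hFu : Face S T u w z := hF.rot.rot
    have hwzD : s(w, z) ∈ T \ A := Finset.mem_sdiff.mpr ⟨hF.e1, hwz⟩
    have hne : s(u, w) ≠ s(z, u) := by
      intro h
      rcases Sym2.eq_iff.mp h with ⟨h1, h2⟩ | ⟨h1, h2⟩
      · exact hF.ne12.2.1 h1.symm
      · exact hF.ne12.1 h2
    have g1 := ih1 _ huw
    have g2 := ih2 _ huw _ hzu hne
    have f1 := fam1 hS hC (nD _ huw)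
    have f2 := fam2a hS hC (nD _ huw) (nD _ hzu) (fun T' _ h => face_in hFu
      (h (by simp)) (h (by simp [hwzD])) (h (by simp)))
    have f0 := fam_sum (S := S) (D := T \ A) (p := u) (q := w)
    have hk : 2 ≤ A.card := by
      rw [← Finset.card_pair hne]
      exact Finset.card_le_card (by intro e he; simp at he; rcases he with rfl | rfl <;> assumption)
    obtain ⟨k, hk⟩ : ∃ k, A.card = k + 2 := ⟨A.card - 2, by omega⟩
    have m0 : (w, z, u) ∈ ld S T A u w := by
      unfold ld; rw [Finset.mem_filter]; exact ⟨hm, Or.inr ⟨rfl, rfl⟩⟩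
    have m0' : (w, z, u) ∈ ld S T A z u := by
      unfold ld; rw [Finset.mem_filter]; exact ⟨hm, Or.inl ⟨rfl, rfl⟩⟩
    have hsub : ∀ {a b}, (w, z, u) ∈ ld S T A a b → ld S T A a b ⊆ {(w, z, u)} := by
      intro a b h m hm
      rw [Finset.mem_singleton]; exact ld_unique hS hT hm h
    have card1 : ∀ X : Finset (Pt × Pt × Pt), mids S T A ⊆ X → (mids S T A).card ≤ X.card :=
      fun X h => Finset.card_le_card h
    have L1 : (mids S T A).card ≤ (mids S T (A.erase s(u, w))).card + (1 + (ld S T A w u).card) := by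
      refine (card1 _ (mids_erase hT u w)).trans ((Finset.card_union_le _ _).trans ?_)
      gcongr
      refine (Finset.card_union_le _ _).trans ?_
      gcongr
      exact ld_card hS hT _ _
    have L2 : (mids S T A).card ≤ (mids S T ((A.erase s(u, w)).erase s(z, u))).card +
        (2 + (ld S T A w u).card) := by
      refine (card1 _ (mids_erase2 hT u w z u)).trans ((Finset.card_union_le _ _).trans ?_)
      gcongr
      have : ((ld S T A u w ∪ ld S T A w u) ∪ (ld S T A z u ∪ ld S T A u z)) ⊆
          ({(w, z, u)} ∪ ld S T A u z) ∪ ld S T A w u := by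
        intro m hm
        simp only [Finset.mem_union] at hm ⊢
        rcases hm with (h | h) | (h | h)
        · exact Or.inl (Or.inl (hsub m0 h))
        · exact Or.inr h
        · exact Or.inl (Or.inl (hsub m0' h))
        · exact Or.inl (Or.inr h)
      refine (Finset.card_le_card this).trans ((Finset.card_union_le _ _).trans ?_)
      gcongr
      refine (Finset.card_union_le _ _).trans ?_
      have := ld_card (A := A) hS hT u z
      simp; omega
    rw [hk] at g1 g2 ⊢
    simp only [Nat.add_sub_cancel, show k + 2 - 1 = k + 1 by omega] at g1 g2
    have k0 : (0 : ℝ) < 2 ^ k := by positivity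
    rcases Finset.eq_empty_or_nonempty (ld S T A w u) with he | ⟨m1, hm1⟩
    · rw [he, Finset.card_empty] at L1 L2
      have P1 := pow_loss hx L1
      have P2 := pow_loss hx L2
      have key : 2 * (trs S (insert s(u, w) (T \ A))).card +
        (trs S (insert s(u, w) (insert s(z, u) (T \ A)))).card ≤ (trs S (T \ A)).card := by omega
      have key' : (2 : ℝ) * (trs S (insert s(u, w) (T \ A))).card +
        (trs S (insert s(u, w) (insert s(z, u) (T \ A)))).card ≤ (trs S (T \ A)).card := by
        exact_mod_cast key
      refine le_trans ?_ key'
      refine le_trans ?_ (add_le_add (mul_le_mul_of_nonneg_left g1 two_pos.le) g2)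
      have q2 : 0 < x ^ (mids S T A).card := by positivity
      generalize x ^ (mids S T A).card = X at *
      generalize x ^ (mids S T (A.erase s(u, w))).card = Y at *
      generalize x ^ (mids S T ((A.erase s(u, w)).erase s(z, u))).card = Z at *
      have : 4 * X ≤ 4 * Y + Z := by
        simp only [add_zero, pow_one] at P1 P2
        have q1 : X * x ≤ Y * x ^ 2 := by nlinarith
        have : 4 * X * x ^ 2 ≤ (4 * Y + Z) * x ^ 2 := by nlinarith
        exact le_of_mul_le_mul_right this (by positivity)
      rw [pow_succ, pow_succ]
      nlinarith
    · obtain ⟨c, d, hcd, hcdA, hcdne, f3⟩ : ∃ c d, m1 ∈ ld S T A c d ∧ s(c, d) ∈ A ∧ s(u, w) ≠ s(c, d) ∧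
          (trs S (insert s(u, w) (insert s(c, d) (T \ A)))).card ≤
            ((trs S (T \ A)).filter (sh w u)).card := by
        obtain ⟨w', z', u'⟩ := m1
        have hm1' := hm1
        unfold ld at hm1'
        rw [Finset.mem_filter] at hm1'
        obtain ⟨hmm, hor⟩ := hm1'
        have hmm' := (mem_mids hT).mp hmm
        simp only at hmm' hor
        obtain ⟨hF', n1, n2, n3⟩ := hmm'
        have hD' : s(w', z') ∈ T \ A := Finset.mem_sdiff.mpr ⟨hF'.e1, n1⟩
        have hwu : s(w, u) ∉ T \ A := by rw [Sym2.eq_swap]; exact nD _ huw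
        rcases hor with ⟨rfl, rfl⟩ | ⟨rfl, rfl⟩
        · refine ⟨u', w', ?_, n3, ?_, ?_⟩
          · unfold ld; rw [Finset.mem_filter]; exact ⟨hmm, Or.inr ⟨rfl, rfl⟩⟩
          · intro h
            rcases Sym2.eq_iff.mp h with ⟨h1, h2⟩ | ⟨h1, h2⟩
            · exact hF'.ne12.1 h2.symm
            · exact hF'.ne12.2.1 h2
          · rw [Sym2.eq_swap (a := u') (b := z')]
            exact fam2b hS hC hwu (nD _ n3) (fun T' _ h => face_in hF'.rot
              (h (by simp)) (h (by simp)) (h (by simp [hD'])))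
        · refine ⟨z', u', ?_, n2, ?_, ?_⟩
          · unfold ld; rw [Finset.mem_filter]; exact ⟨hmm, Or.inl ⟨rfl, rfl⟩⟩
          · intro h
            rcases Sym2.eq_iff.mp h with ⟨h1, h2⟩ | ⟨h1, h2⟩
            · exact hF'.ne12.1 h1
            · exact hF'.ne12.2.2 h1
          · rw [Sym2.eq_swap (a := w') (b := u')]
            exact fam2a hS hC hwu (nD _ n2) (fun T' _ h => face_in hF'.rot.rot
              (h (by simp)) (h (by simp [hD'])) (h (by simp)))
      have g3 := ih2 _ huw _ hcdA hcdne
      have L3 : (mids S T A).card ≤ (mids S T ((A.erase s(u, w)).erase s(c, d))).card + 3 := by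
        refine (card1 _ (mids_erase2 hT u w c d)).trans ((Finset.card_union_le _ _).trans ?_)
        gcongr
        have hs1 : ∀ {a b}, m1 ∈ ld S T A a b → ld S T A a b ⊆ {m1} := by
          intro a b h m hm
          rw [Finset.mem_singleton]; exact ld_unique hS hT hm h
        have : ((ld S T A u w ∪ ld S T A w u) ∪ (ld S T A c d ∪ ld S T A d c)) ⊆
            ({m1} ∪ ld S T A u w) ∪ ld S T A d c := by
          intro m hm
          simp only [Finset.mem_union] at hm ⊢
          rcases hm with (h | h) | (h | h)
          · exact Or.inl (Or.inr h)
          · exact Or.inl (Or.inl (hs1 hm1 h))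
          · exact Or.inl (Or.inl (hs1 hcd h))
          · exact Or.inr h
        refine (Finset.card_le_card this).trans ((Finset.card_union_le _ _).trans ?_)
        have h1 := Finset.card_union_le {m1} (ld S T A u w)
        have h2 := ld_card (A := A) hS hT d c
        have h3 := ld_card (A := A) hS hT u w
        rw [Finset.card_singleton] at h1; omega
      have hl := ld_card (A := A) hS hT w u
      have P1 := pow_loss hx (L1.trans (Nat.add_le_add_left (Nat.add_le_add_left hl _) _))
      have P2 := pow_loss hx (L2.trans (Nat.add_le_add_left (Nat.add_le_add_left hl _) _))
      have P3 := pow_loss hx L3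
      have key : 2 * (trs S (insert s(u, w) (T \ A))).card +
        (trs S (insert s(u, w) (insert s(z, u) (T \ A)))).card +
        (trs S (insert s(u, w) (insert s(c, d) (T \ A)))).card ≤ (trs S (T \ A)).card := by omega
      have key' : (2 : ℝ) * (trs S (insert s(u, w) (T \ A))).card +
        (trs S (insert s(u, w) (insert s(z, u) (T \ A)))).card +
        (trs S (insert s(u, w) (insert s(c, d) (T \ A)))).card ≤ (trs S (T \ A)).card := by
        exact_mod_cast key
      refine le_trans ?_ key'
      rw [hk] at g3
      simp only [Nat.add_sub_cancel] at g3
      refine le_trans ?_ (add_le_add (add_le_add (mul_le_mul_of_nonneg_left g1 two_pos.le) g2) g3)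
      have q2 : 0 < x ^ (mids S T A).card := by positivity
      generalize x ^ (mids S T A).card = X at *
      generalize x ^ (mids S T (A.erase s(u, w))).card = Y at *
      generalize x ^ (mids S T ((A.erase s(u, w)).erase s(z, u))).card = Z at *
      generalize x ^ (mids S T ((A.erase s(u, w)).erase s(c, d))).card = W at *
      have : 4 * X ≤ 4 * Y + Z + W := by
        norm_num at P1 P2
        have q1 : X * x ≤ Y * x ^ 3 := by nlinarith
        have c3 := hx.cub
        have : 4 * X * x ^ 3 ≤ (4 * Y + Z + W) * x ^ 3 := by
          have : 4 * X * x ^ 3 ≤ 4 * (X * x) + X + X := by rw [c3]; nlinarith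
          nlinarith
        exact le_of_mul_le_mul_right this (by positivity)
      rw [pow_succ, pow_succ]
      nlinarith

end

section

variable {S : Finset Pt} {T D A B : Finset (Sym2 Pt)}

def Qd (p q r s : Pt) : Finset (Sym2 Pt) := {s(p, r), s(r, q), s(q, s), s(s, p)}

lemma Qd_card (p q r s : Pt) : (Qd p q r s).card ≤ 4 := Finset.card_le_four

lemma fl_conv (hT : IsTri S T) {p q r s : Pt} (h : Fl S T p q r s)
    (hC : Conv S (T \ A)) : Conv S (fl T p q r s \ (A \ Qd p q r s)) := by
  have main : ∀ p q r s, Fl S T p q r s → ∀ u, 0 < dt u p q →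
      ∃ z, s(p, z) ∈ fl T p q r s \ (A \ Qd p q r s) ∧ 0 < dt u p z := by
    intro p q r s h u hu
    have e1 := dt_cr u p s r q
    have g := h.sg.1
    have p1 := h.f1.pos
    have p2 := h.f2.pos
    have i1 := cr_rot q p s
    have hn := h.cx.ne
    have : 0 < dt u p s ∨ 0 < dt u p r := by
      by_contra hh
      push Not at hh
      nlinarith [mul_pos g hu]
    rcases this with h1 | h1
    · refine ⟨s, ?_, h1⟩
      rw [Finset.mem_sdiff, Finset.mem_sdiff]
      refine ⟨Finset.mem_insert_of_mem (Finset.mem_erase.mpr ⟨?_, h.f2.e2⟩), fun hh => hh.2 ?_⟩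
      · intro h'; rcases Sym2.eq_iff.mp h' with ⟨h1, h2⟩ | ⟨h1, h2⟩
        · exact hn.2.2.2.2.2 h2.symm
        · exact hn.1 h1
      · simp [Qd, Sym2.eq_swap (a := p) (b := s)]
    · refine ⟨r, ?_, h1⟩
      rw [Finset.mem_sdiff, Finset.mem_sdiff]
      refine ⟨Finset.mem_insert_of_mem (Finset.mem_erase.mpr ⟨?_, IsTri.sw h.f1.e3⟩), fun hh => hh.2 ?_⟩
      · intro h'; rcases Sym2.eq_iff.mp h' with ⟨h1, h2⟩ | ⟨h1, h2⟩
        · exact hn.2.2.2.2.1 h2.symm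
        · exact hn.1 h1
      · simp [Qd]
  intro v hv u hu
  obtain ⟨z, hz, hz'⟩ := hC v hv u hu
  by_cases he : s(v, z) = s(p, q)
  · rcases Sym2.eq_iff.mp he with ⟨rfl, rfl⟩ | ⟨rfl, rfl⟩
    · exact main _ _ _ _ h u hz'
    · have := main _ _ _ _ h.symm u hz'
      rw [fl_symm] at this
      have hQ : Qd v z s r = Qd z v r s := by
        unfold Qd
        rw [Sym2.eq_swap (a := v) (b := s), Sym2.eq_swap (a := s) (b := z), Sym2.eq_swap (a := z) (b := r),
          Sym2.eq_swap (a := r) (b := v)]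
        ext e; simp only [Finset.mem_insert, Finset.mem_singleton]; tauto
      rw [hQ] at this
      exact this
  · refine ⟨z, ?_, hz'⟩
    rw [Finset.mem_sdiff] at hz ⊢
    exact ⟨Finset.mem_insert_of_mem (Finset.mem_erase.mpr ⟨he, hz.1⟩),
      fun h => hz.2 (Finset.mem_sdiff.mp h).1⟩

lemma fl_persist (hS : GP S) (hT : IsTri S T) {p q r s a b c d : Pt} (h : Fl S T p q r s)
    (h' : Fl S T a b c d) (hne : s(a, b) ≠ s(p, q)) (hQ : s(a, b) ∉ Qd p q r s) :
    Fl S (fl T p q r s) a b c d := by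
  have main : ∀ a b c, Face S T a b c → s(a, b) ≠ s(p, q) → s(a, b) ∉ Qd p q r s →
      Face S (fl T p q r s) a b c := by
    intro a b c hf hne hQ
    refine fl_face hf hne ?_ ?_
    · intro he
      rcases Sym2.eq_iff.mp he with ⟨rfl, rfl⟩ | ⟨rfl, rfl⟩
      · have := face_unique hS hT hf.rot h.f1
        subst this
        exact hQ (by simp [Qd, Sym2.eq_swap])
      · have := face_unique hS hT hf.rot h.f2
        subst this
        exact hQ (by simp [Qd, Sym2.eq_swap])
    · intro he
      rcases Sym2.eq_iff.mp he with ⟨rfl, rfl⟩ | ⟨rfl, rfl⟩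
      · have := face_unique hS hT hf.rot.rot h.f1
        subst this
        exact hQ (by simp [Qd, Sym2.eq_swap])
      · have := face_unique hS hT hf.rot.rot h.f2
        subst this
        exact hQ (by simp [Qd, Sym2.eq_swap])
  refine ⟨main _ _ _ h'.f1 hne hQ, main _ _ _ h'.f2 ?_ ?_, h'.cx⟩
  · rw [Sym2.eq_swap]; exact hne
  · rw [Sym2.eq_swap]; exact hQ

lemma x_ineq {x : ℝ} (hx : XV x) {α β : ℕ} (h1 : α ≤ 2) (h2 : α + β ≤ 4) :
    2 ^ α * x ^ β * (x - 1) ≤ 1 := by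
  have x1 := hx.lo
  have c := hx.cub
  have hb : x ^ β ≤ x ^ (4 - α) := pow_le_pow_right₀ x1.le (by omega)
  have : 2 ^ α * x ^ β * (x - 1) ≤ 2 ^ α * x ^ (4 - α) * (x - 1) := by
    have : 0 ≤ x - 1 := by linarith
    gcongr
  refine this.trans ?_
  have hi := hx.hi
  interval_cases α
  · norm_num
    have : x ^ 4 * (x - 1) = x ^ 2 * (x ^ 3 - x ^ 2) := by ring
    rw [this, c]; nlinarith
  · norm_num
    have : 2 * x ^ 3 * (x - 1) = 2 * x * (x ^ 3 - x ^ 2) := by ring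
    rw [this, c]; nlinarith
  · norm_num
    nlinarith

/-- The support lemma. -/
theorem support_lemma (hS : GP S) {x : ℝ} (hx : XV x) :
    ∀ (n : ℕ) (T A B : Finset (Sym2 Pt)), B.card = n → IsTri S T → A ⊆ T → B ⊆ T → Disjoint A B →
      Conv S (T \ A) → (∀ p q, s(p, q) ∈ B → ∃ r s, Fl S T p q r s) →
      2 ^ A.card * x ^ B.card ≤ ((trs S (T \ (A ∪ B))).card : ℝ) := by
  intro n
  induction n using Nat.strong_induction_on with
  | _ n ih =>
  intro T A B hBn hT hA hB hAB hC hFl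
  have x0 : 0 < x := by linarith [hx.lo]
  by_cases hex : ∃ p q r s, s(p, q) ∈ B ∧ Fl S T p q r s ∧ (s(p, r) ∉ A ∨ s(r, q) ∉ A) ∧
      (s(q, s) ∉ A ∨ s(s, p) ∉ A)
  · obtain ⟨p, q, r, s, hpq, hf, ho1, ho2⟩ := hex
    have hBpos : 0 < B.card := Finset.card_pos.mpr ⟨_, hpq⟩
    have hpqT := hB hpq
    have hpqA : s(p, q) ∉ A := fun h => Finset.disjoint_left.mp hAB h hpq
    have hrs : s(r, s) ∉ T := fun h => hT.pl.nc _ _ _ _ hpqT h hf.cx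
    set Q := Qd p q r s with hQ
    -- first family
    have I1 := ih (B.card - 1) (by omega) T A (B.erase s(p, q)) (Finset.card_erase_of_mem hpq) hT hA
      ((Finset.erase_subset _ _).trans hB) (hAB.mono_right (Finset.erase_subset _ _)) hC
      (fun a b hab => hFl a b (Finset.mem_of_mem_erase hab))
    -- second family
    set B2 := B.erase s(p, q) \ Q with hB2
    have hsubT : ∀ e ∈ T, e ≠ s(p, q) → e ∈ fl T p q r s := fun e he hne =>
      Finset.mem_insert_of_mem (Finset.mem_erase.mpr ⟨hne, he⟩)
    have hBQ : B ∩ Q ⊆ B.erase s(p, q) := by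
      intro e he
      rw [Finset.mem_inter] at he
      refine Finset.mem_erase.mpr ⟨?_, he.1⟩
      rintro rfl
      have hn := hf.cx.ne
      have := he.2
      simp only [hQ, Qd, Finset.mem_insert, Finset.mem_singleton, Sym2.eq_iff] at this
      tauto
    have hcB2 : B2.card = B.card - 1 - (B ∩ Q).card := by
      rw [hB2, Finset.card_sdiff, Finset.card_erase_of_mem hpq]
      congr 2
      ext e
      simp only [Finset.mem_inter]
      constructor
      · rintro ⟨h1, h2⟩; exact ⟨Finset.mem_of_mem_erase h2, h1⟩
      · rintro ⟨h1, h2⟩; exact ⟨h2, hBQ (Finset.mem_inter.mpr ⟨h1, h2⟩)⟩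
    have hcA2 : (A \ Q).card = A.card - (A ∩ Q).card := by
      rw [Finset.card_sdiff, Finset.inter_comm]
    have I2 := ih B2.card (by omega) (fl T p q r s) (A \ Q) B2 rfl (fl_isTri hS hT hf)
      (by
        intro e he
        rw [Finset.mem_sdiff] at he
        exact hsubT e (hA he.1) (by rintro rfl; exact hpqA he.1))
      (by
        intro e he
        rw [hB2, Finset.mem_sdiff, Finset.mem_erase] at he
        exact hsubT e (hB he.1.2) he.1.1)
      (hAB.mono Finset.sdiff_subset (Finset.sdiff_subset.trans (Finset.erase_subset _ _)))
      (fl_conv hT hf hC)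
      (by
        intro a b hab
        rw [hB2, Finset.mem_sdiff, Finset.mem_erase] at hab
        obtain ⟨c, d, h'⟩ := hFl a b hab.1.2
        exact ⟨c, d, fl_persist hS hT hf h' hab.1.1 hab.2⟩)
    have hsum : (trs S (T \ (A ∪ B.erase s(p, q)))).card +
        (trs S (fl T p q r s \ (A \ Q ∪ B2))).card ≤ (trs S (T \ (A ∪ B))).card := by
      rw [← Finset.card_union_of_disjoint]
      · apply Finset.card_le_card
        apply Finset.union_subset
        · apply trs_anti
          apply Finset.sdiff_subset_sdiff subset_rfl
          exact Finset.union_subset_union subset_rfl (Finset.erase_subset _ _)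
        · apply trs_anti
          intro e he
          rw [Finset.mem_sdiff, Finset.mem_union] at he ⊢
          refine ⟨hsubT e he.1 ?_, ?_⟩
          · rintro rfl; exact he.2 (Or.inr hpq)
          · rintro (h | h)
            · exact he.2 (Or.inl (Finset.mem_sdiff.mp h).1)
            · exact he.2 (Or.inr (Finset.mem_of_mem_erase (Finset.mem_sdiff.mp h).1))
      · rw [Finset.disjoint_left]
        intro E h1 h2
        rw [mem_trs] at h1 h2
        refine h1.1.pl.nc p q r s (h1.2 ?_) (h2.2 ?_) hf.cx
        · simp [hpqT, hpqA]
        · rw [Finset.mem_sdiff, Finset.mem_union]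
          refine ⟨Finset.mem_insert_self _ _, ?_⟩
          rintro (h | h)
          · exact hrs (hA (Finset.mem_sdiff.mp h).1)
          · exact hrs (hB (Finset.mem_of_mem_erase (Finset.mem_sdiff.mp h).1))
    have hsum' : ((trs S (T \ (A ∪ B.erase s(p, q)))).card : ℝ) +
        (trs S (fl T p q r s \ (A \ Q ∪ B2))).card ≤ (trs S (T \ (A ∪ B))).card := by exact_mod_cast hsum
    refine le_trans ?_ hsum'
    refine le_trans ?_ (add_le_add I1 I2)
    rw [hcB2, hcA2, Finset.card_erase_of_mem hpq]
    have hα : (A ∩ Q).card ≤ 2 := by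
      have hp2 : ∀ a b : Sym2 Pt, A ∩ Q ⊆ {a, b} → (A ∩ Q).card ≤ 2 := fun a b h =>
        (Finset.card_le_card h).trans Finset.card_le_two
      have hQm : ∀ e, e ∈ Q ↔ e = s(p, r) ∨ e = s(r, q) ∨ e = s(q, s) ∨ e = s(s, p) := by
        intro e; simp [hQ, Qd]
      rcases ho1 with h1 | h1 <;> rcases ho2 with h2 | h2
      · apply hp2 (s(r, q)) (s(s, p))
        intro e he; rw [Finset.mem_inter, hQm] at he; rw [Finset.mem_insert, Finset.mem_singleton]
        rcases he with ⟨hA, rfl | rfl | rfl | rfl⟩ <;> tauto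
      · apply hp2 (s(r, q)) (s(q, s))
        intro e he; rw [Finset.mem_inter, hQm] at he; rw [Finset.mem_insert, Finset.mem_singleton]
        rcases he with ⟨hA, rfl | rfl | rfl | rfl⟩ <;> tauto
      · apply hp2 (s(p, r)) (s(s, p))
        intro e he; rw [Finset.mem_inter, hQm] at he; rw [Finset.mem_insert, Finset.mem_singleton]
        rcases he with ⟨hA, rfl | rfl | rfl | rfl⟩ <;> tauto
      · apply hp2 (s(p, r)) (s(q, s))
        intro e he; rw [Finset.mem_inter, hQm] at he; rw [Finset.mem_insert, Finset.mem_singleton]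
        rcases he with ⟨hA, rfl | rfl | rfl | rfl⟩ <;> tauto
    have hαβ : (A ∩ Q).card + (B ∩ Q).card ≤ 4 := by
      rw [← Finset.card_union_of_disjoint (hAB.mono Finset.inter_subset_left Finset.inter_subset_left)]
      exact (Finset.card_le_card (Finset.union_subset Finset.inter_subset_right
        Finset.inter_subset_right)).trans (Qd_card p q r s)
    have hα' : (A ∩ Q).card ≤ A.card := Finset.card_le_card Finset.inter_subset_left
    have hβ' : (B ∩ Q).card ≤ B.card - 1 := by
      rw [← Finset.card_erase_of_mem hpq]; exact Finset.card_le_card hBQ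
    have xi := x_ineq hx hα hαβ
    obtain ⟨k, hk⟩ := Nat.exists_eq_add_of_le hα'
    obtain ⟨l, hl⟩ := Nat.exists_eq_add_of_le hβ'
    have hBl : B.card = (B ∩ Q).card + l + 1 := by omega
    generalize (A ∩ Q).card = α at *
    generalize (B ∩ Q).card = β at *
    rw [hBl, hk, show β + l + 1 - 1 = β + l by omega, Nat.add_sub_cancel_left, Nat.add_sub_cancel_left]
    have h1 : (2 : ℝ) ^ (α + k) * x ^ (β + l + 1) =
        2 ^ k * x ^ l * (2 ^ α * x ^ β * (x - 1)) + 2 ^ (α + k) * x ^ (β + l) := by ring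
    rw [h1]
    have : (0 : ℝ) ≤ 2 ^ k * x ^ l := by positivity
    nlinarith
  · push Not at hex
    have hK := lemmaK hS hT hx _ A rfl hA hC
    have hle : (trs S (T \ A)).card ≤ (trs S (T \ (A ∪ B))).card :=
      Finset.card_le_card (trs_anti (Finset.sdiff_subset_sdiff subset_rfl Finset.subset_union_left))
    have hle' : ((trs S (T \ A)).card : ℝ) ≤ (trs S (T \ (A ∪ B))).card := by exact_mod_cast hle
    refine le_trans ?_ (hK.trans hle')
    have hm : B.card ≤ (mids S T A).card := by
      refine le_trans (Finset.card_le_card ?_)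
        (Finset.card_image_le (s := mids S T A) (f := fun m => s(m.1, m.2.1)))
      intro e he
      induction e with | _ p q =>
      have hpqA : s(p, q) ∉ A := fun h => Finset.disjoint_left.mp hAB h he
      obtain ⟨r, s, hf⟩ := hFl p q he
      rw [Finset.mem_image]
      by_cases h1 : s(p, r) ∈ A ∧ s(r, q) ∈ A
      · refine ⟨(p, q, r), (mem_mids hT).mpr ⟨hf.f1, hpqA, ?_, ?_⟩, rfl⟩
        · rw [Sym2.eq_swap]; exact h1.2
        · rw [Sym2.eq_swap]; exact h1.1
      · have h2 := hex p q r s he hf (by by_contra h; push Not at h; exact h1 h)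
        refine ⟨(q, p, s), (mem_mids hT).mpr ⟨hf.f2, ?_, ?_, ?_⟩, Sym2.eq_swap⟩
        · simp only; rw [Sym2.eq_swap]; exact hpqA
        · simp only; rw [Sym2.eq_swap]; exact h2.2
        · simp only; rw [Sym2.eq_swap]; exact h2.1
    have := pow_le_pow_right₀ hx.lo.le hm
    gcongr

end

section

variable {S : Finset Pt} {T D A B : Finset (Sym2 Pt)}

def Gen (S : Finset Pt) (u : Pt) : Prop := ∀ p ∈ S, ∀ q ∈ S, p ≠ q → dt u p q ≠ 0

lemma exists_gen (S : Finset Pt) : ∃ u, Gen S u := by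
  obtain ⟨t, ht⟩ := exists_gx_inj S
  refine ⟨(1, t), fun p hp q hq hne h => hne (ht hp hq ?_)⟩
  simp only [dt, gx] at h ⊢
  linarith

lemma dt_neg (u p z : Pt) : dt (-u) p z = - dt u p z := by simp [dt]; ring

lemma Gen.neg {u : Pt} (h : Gen S u) : Gen S (-u) := by
  intro p hp q hq hne h'
  rw [dt_neg] at h'
  exact h p hp q hq hne (by linarith)

def UpF (S : Finset Pt) (u p : Pt) : Prop :=
  ∃ q ∈ S, ∃ r ∈ S, 0 < dt u p q ∧ dt u p r < 0 ∧ 0 < cr p q r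

lemma no_up {u p m q r : Pt} (hm : 0 < dt u p m) (hq : 0 < dt u p q) (hr : dt u p r < 0)
    (h1 : cr p m q ≤ 0) (h2 : cr p m r ≤ 0) : cr p q r ≤ 0 := by
  have e := dt_cr u p q r m
  have s := cr_swap' p m q
  by_contra h
  push Not at h
  nlinarith [mul_pos h hm, mul_nonneg (neg_nonneg.mpr h2) hq.le, mul_nonneg (neg_nonneg.mpr h1) (neg_pos.mpr hr).le]

lemma up_face (hS : GP S) (hT : IsTri S T) {u p : Pt} (hu : Gen S u) (hp : p ∈ S) (h : UpF S u p) :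
    ∃ q r, Face S T p q r ∧ 0 < dt u p q ∧ dt u p r < 0 := by
  obtain ⟨q0, hq0, r0, hr0, hq0', hr0', hc⟩ := h
  obtain ⟨q1, hq1, hq1'⟩ := exists_nbr hS hT hp hq0 u hq0'
  obtain ⟨r1, hr1, hr1'⟩ := exists_nbr hS hT hp hr0 (-u) (by rw [dt_neg]; linarith)
  rw [dt_neg] at hr1'
  obtain ⟨q, hq, hqm⟩ := ang_min (-1) p u (S.filter (fun z => s(p, z) ∈ T ∧ 0 < dt u p z))
    ⟨q1, by simp [hq1, hq1', (hT.pl.mem _ _ hq1).2.1]⟩ (fun z hz => (Finset.mem_filter.mp hz).2.2)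
  obtain ⟨r, hr, hrm⟩ := ang_min 1 p (-u) (S.filter (fun z => s(p, z) ∈ T ∧ dt u p z < 0))
    ⟨r1, by simp [hr1, (hT.pl.mem _ _ hr1).2.1]; linarith⟩
    (fun z hz => by rw [dt_neg]; linarith [(Finset.mem_filter.mp hz).2.2])
  simp only [Finset.mem_filter] at hq hqm hr hrm
  obtain ⟨hqS, hqT, hqd⟩ := hq
  obtain ⟨hrS, hrT, hrd⟩ := hr
  have hqr : q ≠ r := by rintro rfl; linarith
  have hpos : 0 < cr p q r := by
    by_contra hneg
    push Not at hneg
    have hneg : cr p q r < 0 := lt_of_le_of_ne hneg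
      (hS p hp q hqS r hrS (hT.pl.mem _ _ hqT).2.2 (hT.pl.mem _ _ hrT).2.2 hqr)
    have hall : ∀ z, s(p, z) ∈ T → cr p q z ≤ 0 := by
      intro z hz
      obtain ⟨-, hzS, hzp⟩ := hT.pl.mem _ _ hz
      rcases lt_or_gt_of_ne (hu p hp z hzS hzp) with hd | hd
      · have h1 := hrm z ⟨hzS, hz, hd⟩
        have e := dt_cr u p q z r
        by_contra hh
        push Not at hh
        nlinarith [mul_pos hh (neg_pos.mpr hrd), mul_pos (neg_pos.mpr hneg) (neg_pos.mpr hd), mul_nonneg h1 hqd.le]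
      · have := hqm z ⟨hzS, hz, hd⟩
        linarith
    have hall2 : ∀ z ∈ S, cr p q z ≤ 0 := by
      intro z hz
      by_contra hh
      push Not at hh
      obtain ⟨y, hy, hy'⟩ := exists_nbr hS hT hp hz (nrm p q) (by rw [dt_nrm]; exact hh)
      rw [dt_nrm] at hy'
      linarith [hall y hy]
    linarith [no_up hqd hq0' hr0' (hall2 _ hq0) (hall2 _ hr0)]
  refine ⟨q, r, face_of_consec hS hT hqT hrT hpos ?_, hqd, hrd⟩
  rintro z hz ⟨h1, h2⟩
  obtain ⟨-, hzS, hzp⟩ := hT.pl.mem _ _ hz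
  rcases lt_or_gt_of_ne (hu p hp z hzS hzp) with hd | hd
  · have := hrm z ⟨hzS, hz, hd⟩
    rw [cr_swap'] at this; linarith
  · have := hqm z ⟨hzS, hz, hd⟩
    linarith

lemma up_face_unique (hS : GP S) (hT : IsTri S T) {u p q r q' r' : Pt}
    (h : Face S T p q r) (hq : 0 < dt u p q) (hr : dt u p r < 0)
    (h' : Face S T p q' r') (hq' : 0 < dt u p q') (hr' : dt u p r' < 0) : q = q' ∧ r = r' := by
  have main : ∀ q r q' r', Face S T p q r → 0 < dt u p q → dt u p r < 0 → Face S T p q' r' →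
      0 < dt u p q' → dt u p r' < 0 → ¬ 0 < cr p q q' := by
    intro q r q' r' h hq hr h' hq' hr' hc
    by_cases h2 : 0 < cr p q' r
    · exact corner hS hT h h'.e1 hc h2
    · push Not at h2
      have e1 := dt_cr u p r' r q'
      have p' := h'.pos
      have s1 := cr_swap' p q' r'
      have a1 : 0 < cr p r' r := by
        by_contra hh
        push Not at hh
        nlinarith [mul_nonneg (neg_nonneg.mpr h2) (neg_pos.mpr hr').le, mul_pos p' (neg_pos.mpr hr),
          mul_nonneg (neg_nonneg.mpr hh) hq'.le]
      have e2 := dt_cr u p q r' r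
      have s2 := cr_swap' p r' r
      have a2 : 0 < cr p q r' := by
        by_contra hh
        push Not at hh
        nlinarith [mul_pos a1 hq, mul_pos h.pos (neg_pos.mpr hr'), mul_nonneg (neg_nonneg.mpr hh) (neg_pos.mpr hr).le]
      exact corner hS hT h (IsTri.sw h'.e3) a2 a1
  have hqq : q = q' := by
    by_contra hne
    obtain ⟨hp, hqS, -⟩ := h.mem hT
    obtain ⟨-, hqS', -⟩ := h'.mem hT
    rcases lt_or_gt_of_ne (hS p hp q hqS q' hqS' h.ne12.1 h'.ne12.1 hne) with hc | hc
    · exact main q' r' q r h' hq' hr' h hq hr (by rw [cr_swap']; linarith)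
    · exact main q r q' r' h hq hr h' hq' hr' hc
  subst hqq
  exact ⟨rfl, face_unique hS hT h h'⟩

/-- oriented faces -/
def FT (S : Finset Pt) (T : Finset (Sym2 Pt)) : Finset (Pt × Pt × Pt) :=
  (S ×ˢ S ×ˢ S).filter (fun m => Face S T m.1 m.2.1 m.2.2)

lemma mem_FT (hT : IsTri S T) {p q r : Pt} : (p, q, r) ∈ FT S T ↔ Face S T p q r := by
  unfold FT
  simp only [Finset.mem_filter, Finset.mem_product]
  exact ⟨fun h => h.2, fun h => ⟨h.mem hT, h⟩⟩

def FU (S : Finset Pt) (T : Finset (Sym2 Pt)) (u : Pt) : Finset (Pt × Pt × Pt) :=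
  (FT S T).filter (fun m => 0 < dt u m.1 m.2.1 ∧ dt u m.1 m.2.2 < 0)

lemma FU_card (hS : GP S) (hT : IsTri S T) {u : Pt} (hu : Gen S u) :
    (FU S T u).card = (S.filter (UpF S u)).card := by
  apply Finset.card_bij (fun m _ => m.1)
  · rintro ⟨p, q, r⟩ h
    unfold FU at h
    rw [Finset.mem_filter, mem_FT hT] at h
    obtain ⟨hf, h1, h2⟩ := h
    obtain ⟨hp, hq, hr⟩ := hf.mem hT
    rw [Finset.mem_filter]
    exact ⟨hp, q, hq, r, hr, h1, h2, hf.pos⟩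
  · rintro ⟨p, q, r⟩ h ⟨p', q', r'⟩ h' hpp
    unfold FU at h h'
    rw [Finset.mem_filter, mem_FT hT] at h h'
    obtain ⟨hf, h1, h2⟩ := h
    obtain ⟨hf', h1', h2'⟩ := h'
    simp only at hpp h1 h2 h1' h2'
    subst hpp
    obtain ⟨rfl, rfl⟩ := up_face_unique hS hT hf h1 h2 hf' h1' h2'
    rfl
  · intro p hp
    rw [Finset.mem_filter] at hp
    obtain ⟨q, r, hf, h1, h2⟩ := up_face hS hT hu hp.1 hp.2
    refine ⟨(p, q, r), ?_, rfl⟩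
    unfold FU
    rw [Finset.mem_filter, mem_FT hT]
    exact ⟨hf, h1, h2⟩

lemma dt_diff (u p q : Pt) : dt u p q = (u.1 * q.1 + u.2 * q.2) - (u.1 * p.1 + u.2 * p.2) := by
  unfold dt; ring

lemma FT_card (hT : IsTri S T) {u : Pt} (hu : Gen S u) :
    (FT S T).card = 3 * ((FU S T u).card + (FU S T (-u)).card) := by
  -- middle-first faces
  set f : Pt → ℝ := fun p => u.1 * p.1 + u.2 * p.2 with hf
  have hd : ∀ p q, dt u p q = f q - f p := fun p q => dt_diff u p q
  set md : Pt → Pt → Pt → Prop := fun p q r => (f r < f p ∧ f p < f q) ∨ (f q < f p ∧ f p < f r) with hmd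
  have h1 : (FU S T u).card + (FU S T (-u)).card =
      ((FT S T).filter (fun m => md m.1 m.2.1 m.2.2)).card := by
    rw [← Finset.card_union_of_disjoint]
    · congr 1
      ext m
      unfold FU
      simp only [Finset.mem_union, Finset.mem_filter, dt_neg, hd, hmd]
      constructor
      · rintro (⟨h, h1, h2⟩ | ⟨h, h1, h2⟩)
        · exact ⟨h, Or.inl ⟨by linarith, by linarith⟩⟩
        · exact ⟨h, Or.inr ⟨by linarith, by linarith⟩⟩
      · rintro ⟨h, ⟨h1, h2⟩ | ⟨h1, h2⟩⟩
        · exact Or.inl ⟨h, by linarith, by linarith⟩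
        · exact Or.inr ⟨h, by linarith, by linarith⟩
    · rw [Finset.disjoint_left]
      intro m h1 h2
      unfold FU at h1 h2
      simp only [Finset.mem_filter, dt_neg] at h1 h2
      linarith [h1.2.1, h2.2.1]
  have h2 : ((FT S T).filter (fun m => md m.1 m.2.1 m.2.2)).card =
      ((FT S T).filter (fun m => md m.2.1 m.2.2 m.1)).card := by
    apply Finset.card_bij (fun m _ => (m.2.2, m.1, m.2.1))
    · rintro ⟨p, q, r⟩ h
      rw [Finset.mem_filter, mem_FT hT] at h ⊢
      exact ⟨h.1.rot.rot, h.2⟩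
    · rintro ⟨p, q, r⟩ _ ⟨p', q', r'⟩ _ h
      simp only [Prod.mk.injEq] at h ⊢
      tauto
    · rintro ⟨p, q, r⟩ h
      rw [Finset.mem_filter, mem_FT hT] at h
      refine ⟨(q, r, p), ?_, rfl⟩
      rw [Finset.mem_filter, mem_FT hT]
      exact ⟨h.1.rot, h.2⟩
  have h3 : ((FT S T).filter (fun m => md m.1 m.2.1 m.2.2)).card =
      ((FT S T).filter (fun m => md m.2.2 m.1 m.2.1)).card := by
    apply Finset.card_bij (fun m _ => (m.2.1, m.2.2, m.1))
    · rintro ⟨p, q, r⟩ h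
      rw [Finset.mem_filter, mem_FT hT] at h ⊢
      exact ⟨h.1.rot, h.2⟩
    · rintro ⟨p, q, r⟩ _ ⟨p', q', r'⟩ _ h
      simp only [Prod.mk.injEq] at h ⊢
      tauto
    · rintro ⟨p, q, r⟩ h
      rw [Finset.mem_filter, mem_FT hT] at h
      refine ⟨(r, p, q), ?_, rfl⟩
      rw [Finset.mem_filter, mem_FT hT]
      exact ⟨h.1.rot.rot, h.2⟩
  have h4 : (FT S T).card = ((FT S T).filter (fun m => md m.1 m.2.1 m.2.2)).card +
      ((FT S T).filter (fun m => md m.2.1 m.2.2 m.1)).card +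
      ((FT S T).filter (fun m => md m.2.2 m.1 m.2.1)).card := by
    rw [← Finset.card_union_of_disjoint, ← Finset.card_union_of_disjoint]
    · congr 1
      ext ⟨p, q, r⟩
      simp only [Finset.mem_union, Finset.mem_filter]
      constructor
      · intro h
        have hF := (mem_FT hT).mp h
        obtain ⟨hp, hq, hr⟩ := hF.mem hT
        obtain ⟨n1, n2, n3⟩ := hF.ne12
        have e1 := hu p hp q hq n1
        have e2 := hu q hq r hr n2
        have e3 := hu p hp r hr n3
        rw [hd] at e1 e2 e3
        simp only [hmd, h, true_and]
        rcases lt_or_gt_of_ne e1 with a | a <;> rcases lt_or_gt_of_ne e2 with b | b <;>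
          rcases lt_or_gt_of_ne e3 with c | c <;> simp only [sub_neg, gt_iff_lt, sub_pos] at a b c <;>
          first | tauto | linarith
      · tauto
    all_goals
      rw [Finset.disjoint_left]
      intro m h1 h2
      simp only [Finset.mem_union, Finset.mem_filter, hmd] at h1 h2
    · rcases h1 with ⟨-, ⟨a, b⟩ | ⟨a, b⟩⟩ | ⟨-, ⟨a, b⟩ | ⟨a, b⟩⟩ <;>
        rcases h2.2 with ⟨c, d⟩ | ⟨c, d⟩ <;> linarith
    · rcases h1.2 with ⟨a, b⟩ | ⟨a, b⟩ <;>
        rcases h2.2 with ⟨c, d⟩ | ⟨c, d⟩ <;> linarith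
  omega

/-- directed hull edges (the set lies to the right) -/
def HE (S : Finset Pt) : Finset (Pt × Pt) :=
  (S ×ˢ S).filter (fun e => e.1 ≠ e.2 ∧ ∀ z ∈ S, cr e.1 e.2 z ≤ 0)

lemma mem_HE {p q : Pt} : (p, q) ∈ HE S ↔ p ∈ S ∧ q ∈ S ∧ p ≠ q ∧ ∀ z ∈ S, cr p q z ≤ 0 := by
  unfold HE
  simp only [Finset.mem_filter, Finset.mem_product]
  tauto

lemma HE_inj (hS : GP S) {p q q' : Pt} (h : (p, q) ∈ HE S) (h' : (p, q') ∈ HE S) : q = q' := by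
  rw [mem_HE] at h h'
  by_contra hne
  have h1 := h.2.2.2 q' h'.2.1
  have h2 := h'.2.2.2 q h.2.1
  rw [cr_swap'] at h2
  exact hS p h.1 q h.2.1 q' h'.2.1 h.2.2.1 h'.2.2.1 hne (by linarith)

lemma HE_sub (hT : IsTri S T) {p q : Pt} (h : (p, q) ∈ HE S) : s(p, q) ∈ T := by
  rw [mem_HE] at h
  refine hT.mx p h.1 q h.2.1 h.2.2.1 ?_
  intro r s hrs hc
  obtain ⟨hr, hs, -⟩ := hT.pl.mem _ _ hrs
  have := mul_nonneg_of_nonpos_of_nonpos (h.2.2.2 r hr) (h.2.2.2 s hs)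
  linarith [hc.1]

lemma HEr_card (hS : GP S) (hne : S.Nonempty) {u : Pt} (hu : Gen S u) :
    ((HE S).filter (fun e => 0 < dt u e.1 e.2)).card + 1 = (S.filter (fun p => ¬ UpF S u p)).card := by
  obtain ⟨m, hm, hmax⟩ := S.exists_max_image (fun p => u.1 * p.1 + u.2 * p.2) hne
  have hmd : ∀ z ∈ S, dt u m z ≤ 0 := fun z hz => by rw [dt_diff]; linarith [hmax z hz]
  have hmU : m ∈ S.filter (fun p => ¬ UpF S u p) := by
    rw [Finset.mem_filter]
    refine ⟨hm, ?_⟩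
    rintro ⟨q, hq, r, hr, h1, -⟩
    linarith [hmd q hq]
  have : ((HE S).filter (fun e => 0 < dt u e.1 e.2)).card =
      ((S.filter (fun p => ¬ UpF S u p)).erase m).card := by
    apply Finset.card_bij (fun e _ => e.1)
    · rintro ⟨p, q⟩ h
      rw [Finset.mem_filter, mem_HE] at h
      obtain ⟨⟨hp, hq, -, hz⟩, hd⟩ := h
      rw [Finset.mem_erase, Finset.mem_filter]
      refine ⟨?_, hp, ?_⟩
      · rintro rfl; linarith [hmd q hq]
      · rintro ⟨q', hq', r', hr', h1, h2, h3⟩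
        linarith [no_up hd h1 h2 (hz _ hq') (hz _ hr')]
    · rintro ⟨p, q⟩ h ⟨p', q'⟩ h' hpp
      simp only at hpp
      subst hpp
      rw [HE_inj hS (Finset.mem_filter.mp h).1 (Finset.mem_filter.mp h').1]
    · intro p hp
      rw [Finset.mem_erase, Finset.mem_filter] at hp
      obtain ⟨hpm, hp, hU⟩ := hp
      have hpm' : 0 < dt u p m := by
        refine lt_of_le_of_ne ?_ (hu p hp m hm hpm).symm
        have := hmd p hp
        rw [dt_diff] at this ⊢; linarith
      obtain ⟨q, hq, hqm⟩ := ang_min (-1) p u (S.filter (fun z => 0 < dt u p z))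
        ⟨m, by simp [hm, hpm']⟩ (fun z hz => (Finset.mem_filter.mp hz).2)
      simp only [Finset.mem_filter] at hq hqm
      refine ⟨(p, q), ?_, rfl⟩
      rw [Finset.mem_filter, mem_HE]
      refine ⟨⟨hp, hq.1, ?_, ?_⟩, hq.2⟩
      · rintro rfl; simp [dt_self] at hq
      · intro z hz
        by_cases hzp : p = z
        · rw [← hzp, cr_self2]
        rcases lt_or_gt_of_ne (hu p hp z hz hzp) with hd | hd
        · by_contra hh
          push Not at hh
          exact hU ⟨q, hq.1, z, hz, hq.2, hd, hh⟩
        · linarith [hqm z ⟨hz, hd⟩]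
  rw [this, Finset.card_erase_of_mem hmU]
  have := Finset.card_pos.mpr ⟨m, hmU⟩
  omega

lemma HE_card (hS : GP S) (hne : S.Nonempty) {u : Pt} (hu : Gen S u) :
    (HE S).card + 2 = (S.filter (fun p => ¬ UpF S u p)).card + (S.filter (fun p => ¬ UpF S (-u) p)).card := by
  rw [← HEr_card hS hne hu, ← HEr_card hS hne hu.neg]
  have : (HE S).card = ((HE S).filter (fun e => 0 < dt u e.1 e.2)).card +
      ((HE S).filter (fun e => 0 < dt (-u) e.1 e.2)).card := by
    rw [← Finset.card_filter_add_card_filter_not (s := HE S) (fun e => 0 < dt u e.1 e.2)]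
    congr 2
    apply Finset.filter_congr
    rintro ⟨p, q⟩ h
    rw [mem_HE] at h
    have := hu p h.1 q h.2.1 h.2.2.1
    rw [dt_neg]
    simp only
    constructor
    · intro h1; have := lt_of_le_of_ne (not_lt.mp h1) this; linarith
    · intro h1; linarith
  omega

/-- directed edges -/
def DE (S : Finset Pt) (T : Finset (Sym2 Pt)) : Finset (Pt × Pt) :=
  (S ×ˢ S).filter (fun e => s(e.1, e.2) ∈ T)

lemma mem_DE (hT : IsTri S T) {p q : Pt} : (p, q) ∈ DE S T ↔ s(p, q) ∈ T := by
  unfold DE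
  simp only [Finset.mem_filter, Finset.mem_product]
  exact ⟨fun h => h.2, fun h => ⟨⟨(hT.pl.mem _ _ h).1, (hT.pl.mem _ _ h).2.1⟩, h⟩⟩

lemma DE_card1 (hS : GP S) (hT : IsTri S T) : (DE S T).card = (FT S T).card + (HE S).card := by
  rw [← Finset.card_filter_add_card_filter_not (s := DE S T) (fun e => ∃ z ∈ S, 0 < cr e.1 e.2 z)]
  congr 1
  · symm
    apply Finset.card_bij (fun m _ => (m.1, m.2.1))
    · rintro ⟨p, q, r⟩ h
      rw [mem_FT hT] at h
      rw [Finset.mem_filter, mem_DE hT]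
      exact ⟨h.e1, r, (h.mem hT).2.2, h.pos⟩
    · rintro ⟨p, q, r⟩ h ⟨p', q', r'⟩ h' he
      rw [mem_FT hT] at h h'
      simp only [Prod.mk.injEq] at he
      obtain ⟨rfl, rfl⟩ := he
      rw [face_unique hS hT h h']
    · rintro ⟨p, q⟩ h
      rw [Finset.mem_filter, mem_DE hT] at h
      obtain ⟨h, z, hz, hz'⟩ := h
      obtain ⟨r, hr⟩ := left_face hS hT h hz hz'
      exact ⟨(p, q, r), (mem_FT hT).mpr hr, rfl⟩
  · congr 1
    ext ⟨p, q⟩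
    rw [Finset.mem_filter, mem_DE hT, mem_HE]
    constructor
    · rintro ⟨h1, h2⟩
      push Not at h2
      obtain ⟨hp, hq, hne⟩ := hT.pl.mem _ _ h1
      exact ⟨hp, hq, hne, h2⟩
    · intro h
      refine ⟨HE_sub hT (mem_HE.mpr h), ?_⟩
      push Not
      exact h.2.2.2

lemma DE_card2 (hT : IsTri S T) : (DE S T).card = 2 * T.card := by
  have h : ∀ e ∈ T, ((DE S T).filter (fun d => s(d.1, d.2) = e)).card = 2 := by
    intro e he
    induction e with | _ p q =>
    obtain ⟨hp, hq, hne⟩ := hT.pl.mem _ _ he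
    have : (DE S T).filter (fun d => s(d.1, d.2) = s(p, q)) = {(p, q), (q, p)} := by
      ext ⟨a, b⟩
      rw [Finset.mem_filter, mem_DE hT, Sym2.eq_iff, Finset.mem_insert, Finset.mem_singleton]
      simp only [Prod.mk.injEq]
      constructor
      · exact fun h => h.2
      · rintro (⟨rfl, rfl⟩ | ⟨rfl, rfl⟩)
        · exact ⟨he, Or.inl ⟨rfl, rfl⟩⟩
        · exact ⟨IsTri.sw he, Or.inr ⟨rfl, rfl⟩⟩
    rw [this, Finset.card_pair]
    simp only [ne_eq, Prod.mk.injEq, not_and]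
    exact fun h => absurd h hne
  rw [Finset.card_eq_sum_card_fiberwise (t := T) (f := fun d => s(d.1, d.2)), Finset.sum_congr rfl h]
  · simp [mul_comm]
  · rintro ⟨p, q⟩ h
    exact (mem_DE hT).mp h

/-- Euler's formula for triangulations. -/
theorem euler (hS : GP S) (hne : S.Nonempty) (hT : IsTri S T) : T.card + (HE S).card + 3 = 3 * S.card := by
  obtain ⟨u, hu⟩ := exists_gen S
  have h1 := DE_card1 hS hT
  have h2 := DE_card2 hT
  have h3 := FT_card hT hu
  have h4 := FU_card hS hT hu
  have h5 := FU_card hS hT hu.neg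
  have h6 := HE_card hS hne hu
  have h7 := Finset.card_filter_add_card_filter_not (s := S) (UpF S u)
  have h8 := Finset.card_filter_add_card_filter_not (s := S) (UpF S (-u))
  omega

end

section

variable {S : Finset Pt} {T D A B : Finset (Sym2 Pt)}

/-- A hull vertex has an incoming hull edge as well. -/
lemma hull_prev (hS : GP S) (h3 : 3 ≤ S.card) {p q : Pt} (h : (p, q) ∈ HE S) :
    ∃ r, (r, p) ∈ HE S ∧ 0 < cr p r q ∧ ∀ z ∈ S, 0 ≤ cr p r z := by
  obtain ⟨hp, hq, hne, hz⟩ := mem_HE.1 h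
  obtain ⟨w, hw, hwp, hwq⟩ : ∃ w ∈ S, w ≠ p ∧ w ≠ q := by
    by_contra hc
    push Not at hc
    have : S ⊆ {p, q} := by
      intro w hw
      by_cases hwp : w = p
      · simp [hwp]
      · simp [hc w hw hwp]
    have := Finset.card_le_card this
    have h2 : ({p, q} : Finset Pt).card ≤ 2 := Finset.card_le_two
    omega
  have hwn : cr p q w < 0 := lt_of_le_of_ne (hz w hw) (hS p hp q hq w hw hne (Ne.symm hwp) (Ne.symm hwq))
  obtain ⟨r, hr, hm⟩ := ang_min 1 p (-nrm p q) (S.filter (fun z => cr p q z < 0))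
    ⟨w, by simp [hw, hwn]⟩ (by intro z hz; rw [dt_neg, dt_nrm]; simp at hz; linarith [hz.2])
  simp only [Finset.mem_filter] at hr hm
  have hrq : 0 < cr p r q := by rw [cr_swap']; linarith [hr.2]
  have key : ∀ z ∈ S, 0 ≤ cr p r z := by
    intro z hzS
    by_cases hzn : cr p q z < 0
    · have := hm z ⟨hzS, hzn⟩; linarith
    · have h0 : cr p q z = 0 := le_antisymm (hz z hzS) (not_lt.1 hzn)
      by_cases hzp : z = p
      · subst hzp; rw [cr_swap', cr_self1]; simp
      · by_cases hzq : z = q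
        · subst hzq; exact hrq.le
        · exact absurd h0 (hS p hp q hq z hzS hne (Ne.symm hzp) (Ne.symm hzq))
  refine ⟨r, mem_HE.2 ⟨hr.1, hp, (cr_ne hrq.ne').1.symm, fun z hzS => ?_⟩, hrq, key⟩
  rw [cr_swap]; linarith [key z hzS]

/-- At an interior vertex, any edge can be completed to a positively spanning triple. -/
lemma triple (hS : GP S) (hT : IsTri S T) {p m : Pt} (hp : p ∈ S)
    (hInt : ∀ q, (p, q) ∉ HE S) (hm : s(p, m) ∈ T) :
    ∃ a b, s(p, a) ∈ T ∧ s(p, b) ∈ T ∧ 0 < cr p m a ∧ 0 < cr p b m ∧ 0 < cr p a b := by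
  obtain ⟨-, hmS, hpm⟩ := hT.pl.mem _ _ hm
  have hInt' : ∀ q ∈ S, p ≠ q → ∃ z ∈ S, 0 < cr p q z := by
    intro q hq hne
    by_contra hc
    push Not at hc
    exact hInt q (mem_HE.2 ⟨hp, hq, hne, hc⟩)
  obtain ⟨z1, hz1, hz1'⟩ := hInt' m hmS hpm
  obtain ⟨a0, ha0, ha0'⟩ := exists_nbr hS hT hp hz1 (nrm p m) (by rw [dt_nrm]; exact hz1')
  rw [dt_nrm] at ha0'
  -- a point on the right
  obtain ⟨z2, hz2, hz2'⟩ : ∃ z ∈ S, cr p m z < 0 := by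
    by_contra hc
    push Not at hc
    obtain ⟨q, hq, hqm⟩ := ang_min (-1) p (nrm p m) (S.filter (fun z => 0 < cr p m z))
      ⟨z1, by simp [hz1, hz1']⟩ (by intro z hz; rw [dt_nrm]; simp at hz; exact hz.2)
    simp only [Finset.mem_filter] at hq hqm
    obtain ⟨z, hz, hz'⟩ := hInt' q hq.1 (cr_ne hq.2.ne').2.2
    by_cases hzz : 0 < cr p m z
    · have := hqm z ⟨hz, hzz⟩; linarith
    · have h0 : cr p m z = 0 := le_antisymm (not_lt.1 hzz) (hc z hz)
      by_cases hzp : z = p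
      · subst hzp; rw [cr_swap', cr_self1] at hz'; simp at hz'
      · by_cases hzm : z = m
        · subst hzm; rw [cr_swap'] at hz'; linarith [hq.2]
        · exact absurd h0 (hS p hp m hmS z hz hpm (Ne.symm hzp) (Ne.symm hzm))
  obtain ⟨b0, hb0, hb0'⟩ := exists_nbr hS hT hp hz2 (-nrm p m) (by rw [dt_neg, dt_nrm]; linarith)
  rw [dt_neg, dt_nrm] at hb0'
  obtain ⟨a, ha, ham⟩ := ang_min (-1) p (nrm p m) (S.filter (fun z => s(p, z) ∈ T ∧ 0 < cr p m z))
      ⟨a0, by simp [ha0, ha0', (hT.pl.mem _ _ ha0).2.1]⟩ (by intro z hz; rw [dt_nrm]; simp at hz; exact hz.2.2)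
  obtain ⟨b, hb, hbm⟩ := ang_min 1 p (-nrm p m) (S.filter (fun z => s(p, z) ∈ T ∧ cr p m z < 0))
      ⟨b0, by simp [hb0, (hT.pl.mem _ _ hb0).2.1]; linarith⟩
      (by intro z hz; rw [dt_neg, dt_nrm]; simp at hz; linarith [hz.2.2])
  simp only [Finset.mem_filter] at ha ham hb hbm
  refine ⟨a, b, ha.2.1, hb.2.1, ha.2.2, by rw [cr_swap']; linarith [hb.2.2], ?_⟩
  by_contra hc
  push Not at hc
  obtain ⟨z, hz, hz'⟩ := hInt' a ha.1 (cr_ne ha.2.2.ne').2.2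
  obtain ⟨z3, h3, h3'⟩ := exists_nbr hS hT hp hz (nrm p a) (by rw [dt_nrm]; exact hz')
  rw [dt_nrm] at h3'
  obtain ⟨-, h3S, h3p⟩ := hT.pl.mem _ _ h3
  rcases lt_trichotomy (cr p m z3) 0 with h | h | h
  · have h1 := hbm z3 ⟨h3S, h3, h⟩
    have : cr p a z3 * cr p m b = cr p b z3 * cr p m a + cr p a b * cr p m z3 := by unfold cr; ring
    have h4 := mul_pos_of_neg_of_neg hb.2.2 (neg_neg_of_pos h3')
    have h5 := mul_nonneg (show 0 ≤ cr p b z3 by linarith) ha.2.2.le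
    have h6 := mul_nonneg_of_nonpos_of_nonpos hc h.le
    nlinarith
  · have : z3 = m := by
      by_contra hzm
      exact hS p hp m hmS z3 h3S hpm h3p (Ne.symm hzm) h
    subst this
    rw [cr_swap'] at h3'; linarith [ha.2.2]
  · have := ham z3 ⟨h3S, h3, h⟩; linarith

lemma pm_card {M : Finset (Sym2 Pt)} (hE : PlaneE S T) (hM : M ∈ pmSet S T) : 2 * M.card = S.card := by
  simp only [pmSet, Finset.mem_filter, Finset.mem_powerset] at hM
  obtain ⟨hMT, hM⟩ := hM
  have h1 : ∑ e ∈ M, (S.filter (fun p => p ∈ e)).card = ∑ p ∈ S, (M.filter (fun e => p ∈ e)).card :=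
    Finset.sum_card_bipartiteAbove_eq_sum_card_bipartiteBelow (fun e p => p ∈ e)
  have h2 : ∀ e ∈ M, (S.filter (fun p => p ∈ e)).card = 2 := by
    intro e he
    induction e using Sym2.ind with
    | _ p q =>
      obtain ⟨hp, hq, hne⟩ := hE.mem p q (hMT he)
      have : S.filter (fun z => z ∈ s(p, q)) = {p, q} := by
        ext z; simp only [Finset.mem_filter, Sym2.mem_iff, Finset.mem_insert, Finset.mem_singleton]
        constructor
        · exact fun h => h.2
        · rintro (rfl | rfl) <;> simp [*]
      rw [this, Finset.card_pair hne]
  have h3 : ∀ p ∈ S, (M.filter (fun e => p ∈ e)).card = 1 := by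
    intro p hp
    obtain ⟨e, ⟨he, hpe⟩, hu⟩ := hM p hp
    rw [Finset.card_eq_one]
    refine ⟨e, ?_⟩
    ext e'
    simp only [Finset.mem_filter, Finset.mem_singleton]
    exact ⟨fun h => hu e' h, fun h => h ▸ ⟨he, hpe⟩⟩
  rw [Finset.sum_congr rfl h2, Finset.sum_congr rfl h3] at h1
  simp at h1
  omega

lemma exists_D (hS : GP S) (hT : IsTri S T) (h3 : 3 ≤ S.card) {M : Finset (Sym2 Pt)}
    (hM : M ∈ pmSet S T) : ∃ D ⊆ T, M ⊆ D ∧ Conv S D ∧ S.card ≤ 2 * ((T \ D).card + 3) := by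
  have hMc := pm_card hT.pl hM
  simp only [pmSet, Finset.mem_filter, Finset.mem_powerset] at hM
  obtain ⟨hMT, hM⟩ := hM
  have hpart : ∀ p ∈ S, ∃ m, s(p, m) ∈ M := by
    intro p hp
    obtain ⟨e, ⟨he, hpe⟩, hu⟩ := hM p hp
    obtain ⟨m, rfl⟩ := Sym2.mem_iff_exists.1 hpe
    exact ⟨m, he⟩
  set I : Finset Pt := S.filter (fun p => ∀ q, (p, q) ∉ HE S) with hI
  have htr : ∀ p, ∃ m a b, p ∈ I → s(p, m) ∈ M ∧ s(p, a) ∈ T ∧ s(p, b) ∈ T ∧ 0 < cr p m a ∧ 0 < cr p b m ∧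
      0 < cr p a b := by
    intro p
    by_cases hp : p ∈ I
    · have hp' := hp
      simp only [hI, Finset.mem_filter] at hp'
      obtain ⟨m, hm⟩ := hpart p hp'.1
      obtain ⟨a, b, h⟩ := triple hS hT hp'.1 hp'.2 (hMT hm)
      exact ⟨m, a, b, fun _ => ⟨hm, h⟩⟩
    · exact ⟨p, p, p, fun h => absurd h hp⟩
  choose m a b hab using htr
  set H : Finset (Sym2 Pt) := (HE S).image (fun z => s(z.1, z.2)) with hH
  refine ⟨M ∪ (H ∪ (I.image (fun p => s(p, a p)) ∪ I.image (fun p => s(p, b p)))), ?_, ?_, ?_, ?_⟩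
  · intro e he
    simp only [Finset.mem_union, hH, Finset.mem_image] at he
    rcases he with he | ⟨⟨p, q⟩, h, rfl⟩ | ⟨p, hp, rfl⟩ | ⟨p, hp, rfl⟩
    · exact hMT he
    · exact HE_sub hT h
    · exact (hab p hp).2.1
    · exact (hab p hp).2.2.1
  · exact Finset.subset_union_left
  · rintro p hp u ⟨q, hq, hdq⟩
    by_cases hpI : p ∈ I
    · obtain ⟨h1, h2, h3, h4, h5, h6⟩ := hab p hpI
      by_contra hc
      push Not at hc
      have e1 := hc (m p) (by simp [h1])
      have e2 := hc (a p) (by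
        simp only [Finset.mem_union, Finset.mem_image]; right; right; left; exact ⟨p, hpI, rfl⟩)
      have e3 := hc (b p) (by
        simp only [Finset.mem_union, Finset.mem_image]; right; right; right; exact ⟨p, hpI, rfl⟩)
      have id1 : cr p (a p) (b p) * dt u p (m p) + cr p (b p) (m p) * dt u p (a p)
        + cr p (m p) (a p) * dt u p (b p) = 0 := by unfold cr dt; ring
      have t1 := mul_nonpos_of_nonneg_of_nonpos h6.le e1
      have t2 := mul_nonpos_of_nonneg_of_nonpos h5.le e2
      have t3 := mul_nonpos_of_nonneg_of_nonpos h4.le e3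
      have z1 : dt u p (m p) = 0 := by
        have : cr p (a p) (b p) * dt u p (m p) = 0 := by linarith
        rcases mul_eq_zero.1 this with h | h
        · linarith
        · exact h
      have z2 : dt u p (a p) = 0 := by
        have : cr p (b p) (m p) * dt u p (a p) = 0 := by linarith
        rcases mul_eq_zero.1 this with h | h
        · linarith
        · exact h
      have := dt_cr u p (m p) (a p) q
      rw [z1, z2] at this
      have := mul_pos h4 hdq
      linarith
    · have : ∃ q, (p, q) ∈ HE S := by
        by_contra hc
        push Not at hc
        exact hpI (by simp [hI, hp]; exact fun a b => hc (a, b))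
      obtain ⟨n, hn⟩ := this
      obtain ⟨r, hr, hrn, hall⟩ := hull_prev hS h3 hn
      have hnn := (mem_HE.1 hn).2.2.2
      have hmemn : s(p, n) ∈ H := by rw [hH, Finset.mem_image]; exact ⟨_, hn, rfl⟩
      have hmemr : s(p, r) ∈ H := by rw [hH, Finset.mem_image]; exact ⟨_, hr, Sym2.eq_swap⟩
      by_contra hc
      push Not at hc
      have e1 := hc n (by simp [hmemn])
      have e2 := hc r (by simp [hmemr])
      have := dt_cr u p r n q
      have t1 := mul_pos hrn hdq
      have t2 := mul_nonpos_of_nonneg_of_nonpos (hall q hq) e1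
      have t3 := mul_nonpos_of_nonneg_of_nonpos (show 0 ≤ cr p q n by rw [cr_swap']; linarith [hnn q hq]) e2
      linarith
  · have hIc : I.card + (HE S).card = S.card := by
      have h1 : ((HE S).image Prod.fst).card = (HE S).card := by
        apply Finset.card_image_of_injOn
        rintro ⟨p, q⟩ h ⟨p', q'⟩ h' he
        simp only at he
        subst he
        rw [HE_inj hS h h']
      rw [← h1, ← Finset.card_union_of_disjoint]
      · congr 1
        ext p
        simp only [hI, Finset.mem_union, Finset.mem_filter, Finset.mem_image]
        constructor
        · rintro (h | ⟨⟨p', q⟩, h, rfl⟩)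
          · exact h.1
          · exact (mem_HE.1 h).1
        · intro hp
          by_cases h : ∃ q, (p, q) ∈ HE S
          · obtain ⟨q, h⟩ := h
            exact Or.inr ⟨(p, q), h, rfl⟩
          · push Not at h; exact Or.inl ⟨hp, h⟩
      · rw [Finset.disjoint_left]
        intro p h1 h2
        simp only [hI, Finset.mem_filter, Finset.mem_image] at h1 h2
        obtain ⟨⟨p', q⟩, hq, rfl⟩ := h2
        exact h1.2 q hq
    have hne : S.Nonempty := Finset.card_pos.1 (by omega)
    have he := euler hS hne hT
    set DD := M ∪ (H ∪ (I.image (fun p => s(p, a p)) ∪ I.image (fun p => s(p, b p))))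
    have c1 : DD.card ≤ M.card + ((HE S).card + (I.card + I.card)) := by
      refine (Finset.card_union_le _ _).trans (Nat.add_le_add_left ?_ _)
      refine (Finset.card_union_le _ _).trans (Nat.add_le_add Finset.card_image_le ?_)
      exact (Finset.card_union_le _ _).trans (Nat.add_le_add Finset.card_image_le Finset.card_image_le)
    have c2 : T.card ≤ (T \ DD).card + DD.card := by
      have := Finset.le_card_sdiff DD T
      omega
    omega

lemma exists_A (hS : GP S) (hT : IsTri S T) (h3 : 3 ≤ S.card) {M : Finset (Sym2 Pt)}
    (hM : M ∈ pmSet S T) : ∃ A ⊆ T, Disjoint A M ∧ Conv S (T \ A) ∧ A.card = S.card / 2 - 3 ∧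
      ∀ p q, s(p, q) ∈ A → ∃ r s, Fl S T p q r s := by
  obtain ⟨D, hDT, hMD, hD, hc⟩ := exists_D hS hT h3 hM
  obtain ⟨A, hA, hAc⟩ := Finset.exists_subset_card_eq (s := T \ D) (n := S.card / 2 - 3) (by omega)
  have hAD : Disjoint A D := Finset.disjoint_of_subset_left hA Finset.sdiff_disjoint
  refine ⟨A, hA.trans Finset.sdiff_subset, Finset.disjoint_of_subset_right hMD hAD, hD.mono ?_, hAc, ?_⟩
  · intro e he
    exact Finset.mem_sdiff.2 ⟨hDT he, fun h => Finset.disjoint_left.1 hAD h he⟩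
  · intro p q h
    have := Finset.mem_sdiff.1 (hA h)
    exact flippable_of_conv hS hT hD hDT this.1 this.2

end

section

variable {S : Finset Pt}

lemma lpt_eq (p q : Pt) (t : ℝ) : lpt p q t = (1 - t) • p + t • q := by
  unfold lpt; ext <;> simp <;> ring

lemma mem_seg {p q z : Pt} : z ∈ segment ℝ p q ↔ ∃ t, 0 ≤ t ∧ t ≤ 1 ∧ z = lpt p q t := by
  constructor
  · rintro ⟨a, b, ha, hb, hab, rfl⟩
    refine ⟨b, hb, by linarith, ?_⟩
    rw [lpt_eq]; congr 2; linarith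
  · rintro ⟨t, h0, h1, rfl⟩
    exact ⟨1 - t, t, by linarith, h0, by ring, (lpt_eq _ _ _).symm⟩

lemma mem_oseg {p q z : Pt} : z ∈ openSegment ℝ p q ↔ ∃ t, 0 < t ∧ t < 1 ∧ z = lpt p q t := by
  constructor
  · rintro ⟨a, b, ha, hb, hab, rfl⟩
    refine ⟨b, hb, by linarith, ?_⟩
    rw [lpt_eq]; congr 2; linarith
  · rintro ⟨t, h0, h1, rfl⟩
    exact ⟨1 - t, t, by linarith, h0, by ring, (lpt_eq _ _ _).symm⟩

lemma frac_mem {a b : ℝ} (h : a * b < 0) : 0 < a / (a - b) ∧ a / (a - b) < 1 := by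
  rcases mul_neg_iff.1 h with ⟨h1, h2⟩ | ⟨h1, h2⟩
  · exact ⟨div_pos h1 (by linarith), (div_lt_one (by linarith)).2 (by linarith)⟩
  · exact ⟨div_pos_of_neg_of_neg h1 (by linarith), (div_lt_one_of_neg (by linarith)).2 (by linarith)⟩

lemma cross_meet {p q r s : Pt} (h : Cross p q r s) :
    ∃ z, z ∈ openSegment ℝ p q ∧ z ∈ openSegment ℝ r s := by
  have h1 := frac_mem h.1
  have h2 := frac_mem h.2
  have hne : cr r s p - cr r s q ≠ 0 := by
    intro h0
    have : cr r s p = cr r s q := by linarith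
    have h3 := h.2
    rw [this] at h3
    nlinarith [mul_self_nonneg (cr r s q)]
  exact ⟨_, mem_oseg.2 ⟨_, h2.1, h2.2, rfl⟩, mem_oseg.2 ⟨_, h1.1, h1.2, lp_cross hne⟩⟩

lemma neg_of_comb {a b t : ℝ} (h0 : 0 ≤ t) (h1 : t ≤ 1) (ha : a ≠ 0) (hb : b ≠ 0)
    (h : (1 - t) * a + t * b = 0) : a * b < 0 := by
  by_contra hc
  push Not at hc
  rcases mul_nonneg_iff.1 hc with ⟨h2, h3⟩ | ⟨h2, h3⟩
  · have h2 := lt_of_le_of_ne h2 (Ne.symm ha)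
    have h3 := lt_of_le_of_ne h3 (Ne.symm hb)
    rcases le_or_gt t (1/2) with ht | ht
    · have := mul_pos (show 0 < 1 - t by linarith) h2
      nlinarith [mul_nonneg h0 h3.le]
    · have := mul_pos (show 0 < t by linarith) h3
      nlinarith [mul_nonneg (show 0 ≤ 1 - t by linarith) h2.le]
  · have h2 := lt_of_le_of_ne h2 ha
    have h3 := lt_of_le_of_ne h3 hb
    rcases le_or_gt t (1/2) with ht | ht
    · have := mul_pos (show 0 < 1 - t by linarith) (neg_pos.2 h2)
      nlinarith [mul_nonneg h0 (neg_pos.2 h3).le]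
    · have := mul_pos (show 0 < t by linarith) (neg_pos.2 h3)
      nlinarith [mul_nonneg (show 0 ≤ 1 - t by linarith) (neg_pos.2 h2).le]

lemma cr_on (p q : Pt) (t : ℝ) : cr p q (lpt p q t) = 0 := by unfold cr lpt; ring

lemma cross_of_meet (hS : GP S) {p q r s : Pt} (hp : p ∈ S) (hq : q ∈ S) (hr : r ∈ S) (hs : s ∈ S)
    (pq : p ≠ q) (rs : r ≠ s) (pr : p ≠ r) (ps : p ≠ s) (qr : q ≠ r) (qs : q ≠ s) {t t' : ℝ}
    (h0 : 0 ≤ t) (h1 : t ≤ 1) (h0' : 0 ≤ t') (h1' : t' ≤ 1) (h : lpt p q t = lpt r s t') :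
    Cross p q r s := by
  constructor
  · apply neg_of_comb h0' h1' (hS p hp q hq r hr pq pr qr) (hS p hp q hq s hs pq ps qs)
    rw [← cr_lp, ← h, cr_on]
  · apply neg_of_comb h0 h1 (hS r hr s hs p hp rs pr.symm ps.symm) (hS r hr s hs q hq rs qr.symm qs.symm)
    rw [← cr_lp, h, cr_on]

lemma cross_distinct {p q r s : Pt} (h : Cross p q r s) : p ≠ q ∧ r ≠ s ∧ p ≠ r ∧ p ≠ s ∧ q ≠ r ∧ q ≠ s := by
  refine ⟨?_, ?_, ?_, ?_, ?_, ?_⟩ <;> rintro rfl <;> simp [Cross, cr_self1, cr_self2, cr_self3] at h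

lemma PlaneGraph.planeE (G : PlaneGraph S) : PlaneE S G.edges := by
  constructor
  · intro p q h
    exact ⟨G.endpoint_mem _ h p (by simp), G.endpoint_mem _ h q (by simp), by
      have := G.not_isDiag _ h; simpa using this⟩
  · intro p q r s h1 h2 hc
    obtain ⟨z, hz1, hz2⟩ := cross_meet hc
    obtain ⟨-, -, pr, ps, qr, qs⟩ := cross_distinct hc
    have hne : s(p, q) ≠ s(r, s) := by
      intro h
      simp only [Sym2.eq_iff] at h
      rcases h with h | h
      · exact pr h.1
      · exact ps h.1
    have := G.noncrossing _ h1 _ h2 hne z ⟨openSegment_subset_segment ℝ _ _ hz1, openSegment_subset_segment ℝ _ _ hz2⟩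
    simp only [Sym2.mem_iff] at this
    obtain ⟨h3, h4⟩ := this
    rcases h3 with rfl | rfl <;> rcases h4 with h | h <;> contradiction

lemma share_core (hS : GP S) {p q s : Pt} (hp : p ∈ S) (hq : q ∈ S) (hs : s ∈ S)
    (pq : p ≠ q) (ps : p ≠ s) (qs : q ≠ s) {t t' : ℝ} (h : lpt p q t = lpt p s t') : lpt p q t = p := by
  have h1 : cr p q (lpt p s t') = 0 := by rw [← h, cr_on]
  rw [cr_lp, cr_swap', cr_self1] at h1
  have h2 : t' = 0 := by
    have : t' * cr p q s = 0 := by linarith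
    rcases mul_eq_zero.1 this with h | h
    · exact h
    · exact absurd h (hS p hp q hq s hs pq ps qs)
  rw [h, h2]
  simp [lpt]

lemma lpt_swap (p q : Pt) (t : ℝ) : lpt p q t = lpt q p (1 - t) := by
  unfold lpt; ext <;> simp <;> ring

def mkPG (hS : GP S) (E : Finset (Sym2 Pt)) (hE : PlaneE S E) : PlaneGraph S where
  edges := E
  endpoint_mem := by
    intro e he p hp
    obtain ⟨q, rfl⟩ := Sym2.mem_iff_exists.1 hp
    exact (hE.mem _ _ he).1
  not_isDiag := by
    intro e he
    induction e using Sym2.ind with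
    | _ p q => simpa using (hE.mem _ _ he).2.2
  noncrossing := by
    intro e₁ h1 e₂ h2 hne z hz
    induction e₁ using Sym2.ind with
    | _ p q =>
    induction e₂ using Sym2.ind with
    | _ r s =>
      obtain ⟨hp, hq, pq⟩ := hE.mem _ _ h1
      obtain ⟨hr, hs, rs⟩ := hE.mem _ _ h2
      obtain ⟨hz1, hz2⟩ := hz
      obtain ⟨t, t0, t1, rfl⟩ := mem_seg.1 hz1
      obtain ⟨t', t0', t1', h⟩ := mem_seg.1 hz2
      have hn : ¬ ((p = r ∧ q = s) ∨ (p = s ∧ q = r)) := by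
        rw [← Sym2.eq_iff]; exact hne
      by_cases pr : p = r
      · subst pr
        have qs : q ≠ s := fun h => hn (by simp [h])
        rw [share_core hS hp hq hs pq rs qs h]; simp
      by_cases ps : p = s
      · subst ps
        have qr : q ≠ r := fun h => hn (by simp [h])
        rw [lpt_swap r p] at h
        rw [share_core hS hp hq hr pq rs.symm qr h]; simp
      by_cases qr : q = r
      · subst qr
        have qs : p ≠ s := ps
        rw [lpt_swap p q] at h ⊢
        rw [share_core hS hq hp hs pq.symm rs qs h]; simp
      by_cases qs : q = s
      · subst qs
        rw [lpt_swap p q, lpt_swap r q] at h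
        rw [lpt_swap p q]
        rw [share_core hS hq hp hr pq.symm rs.symm pr h]; simp
      exact absurd (cross_of_meet hS hp hq hr hs pq rs pr ps qr qs t0 t1 t0' t1' h) (hE.nc _ _ _ _ h1 h2)

lemma pg_ext {G H : PlaneGraph S} (h : G.edges = H.edges) : G = H := by
  cases G; cases H; simp at h; simp [h]

lemma isTri_iff (hS : GP S) (T : PlaneGraph S) : IsTriangulation T ↔ IsTri S T.edges := by
  constructor
  · intro h
    refine ⟨T.planeE, ?_⟩
    intro p hp q hq pq hc
    have key : PlaneE S (insert s(p, q) T.edges) := by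
      constructor
      · intro a b hab
        rcases Finset.mem_insert.1 hab with hab | hab
        · rcases Sym2.eq_iff.1 hab with ⟨rfl, rfl⟩ | ⟨rfl, rfl⟩
          · exact ⟨hp, hq, pq⟩
          · exact ⟨hq, hp, pq.symm⟩
        · exact T.planeE.mem _ _ hab
      · intro a b c d hab hcd hx
        rcases Finset.mem_insert.1 hab with hab1 | hab1 <;> rcases Finset.mem_insert.1 hcd with hcd1 | hcd1
        · obtain ⟨-, -, pr, ps, qr, qs⟩ := cross_distinct hx
          have := hab1.trans hcd1.symm
          rcases Sym2.eq_iff.1 this with ⟨rfl, rfl⟩ | ⟨rfl, rfl⟩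
          · exact pr rfl
          · exact ps rfl
        · rcases Sym2.eq_iff.1 hab1 with ⟨rfl, rfl⟩ | ⟨rfl, rfl⟩
          · exact hc _ _ hcd1 hx
          · exact hc _ _ hcd1 hx.symm1
        · have hx := hx.swap
          rcases Sym2.eq_iff.1 hcd1 with ⟨rfl, rfl⟩ | ⟨rfl, rfl⟩
          · exact hc _ _ hab1 hx
          · exact hc _ _ hab1 hx.symm1
        · exact T.planeE.nc _ _ _ _ hab1 hcd1 hx
    have := h (mkPG hS _ key) (Finset.subset_insert _ _)
    rw [← this]
    exact Finset.mem_insert_self _ _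
  · intro h G hG
    refine Finset.Subset.antisymm ?_ hG
    intro e he
    induction e using Sym2.ind with
    | _ p q =>
      obtain ⟨hp, hq, pq⟩ := G.planeE.mem _ _ he
      exact h.mx p hp q hq pq (fun r s hrs => G.planeE.nc _ _ _ _ he (hG hrs))

lemma supp_eq (hS : GP S) (C : PlaneGraph S) : supp C = (trs S C.edges).card := by
  unfold supp
  rw [← Nat.card_eq_finsetCard]
  refine Nat.card_congr (Equiv.ofBijective
    (fun T => ⟨T.1.edges, mem_trs.2 ⟨(isTri_iff hS _).1 T.2.1, T.2.2⟩⟩) ⟨?_, ?_⟩)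
  · rintro ⟨G, hG⟩ ⟨H, hH⟩ h
    simp only [Subtype.mk.injEq] at h
    exact Subtype.ext (pg_ext h)
  · rintro ⟨E, hE⟩
    have hE' := mem_trs.1 hE
    exact ⟨⟨mkPG hS E hE'.1.pl, (isTri_iff hS _).2 hE'.1, hE'.2⟩, rfl⟩

lemma cr_cont (a b : Pt) : Continuous (fun z => cr a b z) := by unfold cr; fun_prop

lemma hull_half {a b c z : Pt} (h : 0 ≤ cr a b c) (hz : z ∈ convexHull ℝ ({a, b, c} : Set Pt)) :
    0 ≤ cr a b z := by
  have hcv : Convex ℝ {z : Pt | 0 ≤ cr a b z} := by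
    intro u hu v hv s t hs ht hst
    simp only [Set.mem_setOf_eq] at *
    have : cr a b (s • u + t • v) = s * cr a b u + t * cr a b v := by
      have : s = 1 - t := by linarith
      subst this
      unfold cr; simp; ring
    rw [this]
    positivity
  refine convexHull_min ?_ hcv hz
  rintro w (rfl | rfl | rfl)
  · simp [cr]
  · simp [cr]; linarith
  · exact h

lemma hull_half_int {a b c z : Pt} (h : 0 < cr a b c)
    (hz : z ∈ interior (convexHull ℝ ({a, b, c} : Set Pt))) : 0 < cr a b z := by
  have hn := mem_interior_iff_mem_nhds.1 hz
  have hc : Filter.Tendsto (fun ε : ℝ => z - ε • nrm a b) (nhds 0) (nhds z) := by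
    have : Continuous (fun ε : ℝ => z - ε • nrm a b) := by fun_prop
    simpa using this.tendsto 0
  have hev := hc.eventually hn
  obtain ⟨ε, he, hε⟩ := ((hev.filter_mono nhdsWithin_le_nhds).and (self_mem_nhdsWithin (s := Set.Ioi (0:ℝ)))).exists
  have h1 := hull_half h.le he
  have h2 : cr a b (z - ε • nrm a b) = cr a b z - ε * ((b.1 - a.1)^2 + (b.2 - a.2)^2) := by
    unfold cr nrm; simp; ring
  have h3 : 0 < (b.1 - a.1)^2 + (b.2 - a.2)^2 := by
    by_contra hc
    have e1 : b.1 - a.1 = 0 := by nlinarith [sq_nonneg (b.1 - a.1), sq_nonneg (b.2 - a.2)]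
    have e2 : b.2 - a.2 = 0 := by nlinarith [sq_nonneg (b.1 - a.1), sq_nonneg (b.2 - a.2)]
    unfold cr at h
    rw [e1, e2] at h
    simp at h
  have := mul_pos (show 0 < ε from hε) h3
  linarith

lemma hull_int {a b c z : Pt} (h1 : 0 < cr a b z) (h2 : 0 < cr b c z) (h3 : 0 < cr c a z) :
    z ∈ interior (convexHull ℝ ({a, b, c} : Set Pt)) := by
  refine interior_maximal (s := convexHull ℝ ({a, b, c} : Set Pt))
    (t := {z | 0 < cr a b z} ∩ {z | 0 < cr b c z} ∩ {z | 0 < cr c a z}) ?_ ?_ ⟨⟨h1, h2⟩, h3⟩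
  · rintro w ⟨⟨w1, w2⟩, w3⟩
    simp only [Set.mem_setOf_eq] at w1 w2 w3
    have hs := cr_sum a b c w
    have hpos : 0 < cr a b c := by linarith
    have : w = (cr b c w / cr a b c) • a + (cr c a w / cr a b c) • b + (cr a b w / cr a b c) • c := by
      ext
      · simp; field_simp; unfold cr; ring
      · simp; field_simp; unfold cr; ring
    have hm := (convex_convexHull ℝ ({a, b, c} : Set Pt)).sum_mem (t := Finset.univ)
      (w := ![cr b c w / cr a b c, cr c a w / cr a b c, cr a b w / cr a b c]) (z := ![a, b, c])
      (by intro i _; fin_cases i <;> simp <;> positivity)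
      (by rw [Fin.sum_univ_three]; simp; field_simp; linarith)
      (by intro i _; apply subset_convexHull; fin_cases i <;> simp)
    rw [Fin.sum_univ_three] at hm
    simp only [Matrix.cons_val_zero, Matrix.cons_val_one, Matrix.cons_val_two, Matrix.cons_val] at hm
    rw [this]; exact hm
  · exact ((isOpen_lt continuous_const (cr_cont a b)).inter (isOpen_lt continuous_const (cr_cont b c))).inter
      (isOpen_lt continuous_const (cr_cont c a))

lemma triFace_of_face (hS : GP S) {T : PlaneGraph S} {p q r : Pt} (h : Face S T.edges p q r) :
    IsTriFace T p q r := by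
  refine ⟨(T.planeE.mem _ _ h.e1).1, (T.planeE.mem _ _ h.e2).1, (T.planeE.mem _ _ h.e3).1, h.e1, h.e2, ?_, ?_⟩
  · rw [Sym2.eq_swap]; exact h.e3
  · intro z hz hzi
    refine h.emp z hz ⟨hull_half_int h.pos hzi, ?_, ?_⟩
    · apply hull_half_int (c := p)
      · rw [cr_rot]; exact h.pos
      · convert hzi using 3
        ext w; simp; tauto
    · apply hull_half_int (c := q)
      · rw [← cr_rot]; exact h.pos
      · convert hzi using 3
        ext w; simp; tauto

lemma triFace_swap {T : PlaneGraph S} {p q r : Pt} (h : IsTriFace T p q r) : IsTriFace T q p r := by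
  obtain ⟨h1, h2, h3, h4, h5, h6, h7⟩ := h
  refine ⟨h2, h1, h3, ?_, h6, h5, ?_⟩
  · rw [Sym2.eq_swap]; exact h4
  · intro z hz
    rw [Set.insert_comm]; exact h7 z hz

lemma face_of_triFace {T : PlaneGraph S} {p q r : Pt} (h : IsTriFace T p q r) (hpos : 0 < cr p q r) :
    Face S T.edges p q r := by
  obtain ⟨h1, h2, h3, h4, h5, h6, h7⟩ := h
  refine ⟨h4, h5, ?_, hpos, ?_⟩
  · rw [Sym2.eq_swap]; exact h6
  · rintro z hz ⟨a1, a2, a3⟩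
    exact h7 z hz (hull_int a1 a2 a3)

lemma flippable_of_fl (hS : GP S) {T : PlaneGraph S} {p q r s : Pt} (h : Fl S T.edges p q r s) :
    IsFlippable T s(p, q) := by
  refine ⟨h.f1.e1, p, q, r, s, rfl, (cross_distinct h.cx).2.1, triFace_of_face hS h.f1,
    triFace_swap (triFace_of_face hS h.f2), ?_⟩
  obtain ⟨z, h1, h2⟩ := cross_meet h.cx
  exact ⟨z, h1, h2⟩

lemma fl_of_flippable (hS : GP S) {T : PlaneGraph S} {p q : Pt} (h : IsFlippable T s(p, q)) :
    ∃ r s, Fl S T.edges p q r s := by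
  obtain ⟨-, a, b, c, d, he, hcd, hc, hd, z, hz1, hz2⟩ := h
  suffices ∃ r s, Fl S T.edges a b r s by
    rcases Sym2.eq_iff.1 he with ⟨rfl, rfl⟩ | ⟨rfl, rfl⟩
    · exact this
    · obtain ⟨r, s, h⟩ := this
      exact ⟨s, r, h.symm⟩
  obtain ⟨t, t0, t1, rfl⟩ := mem_oseg.1 hz1
  obtain ⟨t', t0', t1', h⟩ := mem_oseg.1 hz2
  have hab := (T.planeE.mem _ _ hc.2.2.2.1).2.2
  have hbc := (T.planeE.mem _ _ hc.2.2.2.2.1).2.2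
  have hac := (T.planeE.mem _ _ hc.2.2.2.2.2.1).2.2
  have hbd := (T.planeE.mem _ _ hd.2.2.2.2.1).2.2
  have had := (T.planeE.mem _ _ hd.2.2.2.2.2.1).2.2
  have hx := cross_of_meet hS hc.1 hc.2.1 hc.2.2.1 hd.2.2.1 hab hcd hac had hbc hbd t0.le t1.le t0'.le t1'.le h
  rcases mul_neg_iff.1 hx.1 with ⟨h1, h2⟩ | ⟨h1, h2⟩
  · exact ⟨c, d, face_of_triFace hc h1, face_of_triFace (triFace_swap hd) (by rw [cr_swap]; linarith), hx⟩
  · exact ⟨d, c, face_of_triFace hd h2, face_of_triFace (triFace_swap hc) (by rw [cr_swap]; linarith), hx.symm2⟩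

end

section

variable {S : Finset Pt}

lemma rot_val {n : ℕ} (i : Fin n) : (finRotate n i).val = if i.val + 1 = n then 0 else i.val + 1 := by
  cases n with
  | zero => exact i.elim0
  | succ n =>
    rw [finRotate_succ_apply, Fin.val_add_one]
    simp only [Fin.ext_iff, Fin.val_last]
    split_ifs <;> omega

lemma rot_parity {n : ℕ} (hn : Even n) (i : Fin n) : (finRotate n i).val % 2 ≠ i.val % 2 := by
  rw [rot_val]
  obtain ⟨k, hk⟩ := hn
  split_ifs <;> omega

lemma rot_rot {n : ℕ} (hn : 3 ≤ n) (i : Fin n) : finRotate n (finRotate n i) ≠ i := by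
  intro h
  have := congrArg Fin.val h
  rw [rot_val, rot_val] at this
  have := i.2
  split_ifs at * <;> omega

/-- One parity class of the edges of a cycle. -/
def half (f : Fin S.card ≃ {p : Pt // p ∈ S}) (c : ℕ) : Finset (Sym2 Pt) :=
  Finset.image (fun i : Fin S.card => s(((f i : Pt)), ((f (finRotate S.card i) : Pt))))
    (Finset.univ.filter (fun i => i.val % 2 = c))

lemma half_pm (hev : Even S.card) (f : Fin S.card ≃ {p : Pt // p ∈ S}) {c : ℕ} (hc : c < 2) :
    ∀ p ∈ S, ∃! e, e ∈ half f c ∧ p ∈ e := by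
  intro p hp
  obtain ⟨j, hj⟩ := f.surjective ⟨p, hp⟩
  have hpj : (f j : Pt) = p := by rw [hj]
  have inj : ∀ i, (f i : Pt) = p → i = j := by
    intro i hi
    apply f.injective
    rw [hj]; exact Subtype.ext hi
  by_cases hjc : j.val % 2 = c
  · refine ⟨s(((f j : Pt)), ((f (finRotate S.card j) : Pt))), ⟨?_, ?_⟩, ?_⟩
    · exact Finset.mem_image_of_mem _ (by simp [hjc])
    · simp [hpj]
    · rintro e ⟨he, hpe⟩
      simp only [half, Finset.mem_image, Finset.mem_filter, Finset.mem_univ, true_and] at he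
      obtain ⟨i, hi, rfl⟩ := he
      rcases Sym2.mem_iff.1 hpe with h | h
      · rw [inj i h.symm]
      · have := inj _ h.symm
        have h2 := rot_parity hev i
        rw [this] at h2
        omega
  · set k := (finRotate S.card).symm j with hk
    have hkj : finRotate S.card k = j := Equiv.apply_symm_apply _ _
    have hkc : k.val % 2 = c := by
      have := rot_parity hev k
      rw [hkj] at this
      omega
    refine ⟨s(((f k : Pt)), ((f (finRotate S.card k) : Pt))), ⟨?_, ?_⟩, ?_⟩
    · exact Finset.mem_image_of_mem _ (by simp [hkc])
    · simp [hkj, hpj]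
    · rintro e ⟨he, hpe⟩
      simp only [half, Finset.mem_image, Finset.mem_filter, Finset.mem_univ, true_and] at he
      obtain ⟨i, hi, rfl⟩ := he
      rcases Sym2.mem_iff.1 hpe with h | h
      · have := inj i h.symm
        rw [this] at hi
        omega
      · have := inj _ h.symm
        have : i = k := by rw [hk, ← this, Equiv.symm_apply_apply]
        rw [this]

lemma half_disj (h3 : 3 ≤ S.card) (f : Fin S.card ≃ {p : Pt // p ∈ S}) :
    Disjoint (half f 0) (half f 1) := by
  rw [Finset.disjoint_left]
  intro e h0 h1
  simp only [half, Finset.mem_image, Finset.mem_filter, Finset.mem_univ, true_and] at h0 h1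
  obtain ⟨i, hi, rfl⟩ := h0
  obtain ⟨j, hj, he⟩ := h1
  rcases Sym2.eq_iff.1 he with ⟨h, -⟩ | ⟨h, h'⟩
  · have := f.injective (Subtype.ext h)
    subst this; omega
  · have e1 := f.injective (Subtype.ext h)
    have e2 := f.injective (Subtype.ext h')
    rw [e1] at e2
    exact rot_rot h3 i e2

lemma half_union (f : Fin S.card ≃ {p : Pt // p ∈ S}) :
    half f 0 ∪ half f 1 =
      Finset.image (fun i : Fin S.card => s(((f i : Pt)), ((f (finRotate S.card i) : Pt)))) Finset.univ := by
  unfold half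
  rw [← Finset.image_union]
  congr 1
  ext i
  simp
  omega

lemma mem_pmSet {E M : Finset (Sym2 Pt)} : M ∈ pmSet S E ↔ M ⊆ E ∧ ∀ p ∈ S, ∃! e, e ∈ M ∧ p ∈ e := by
  simp [pmSet]

lemma cycle_split (hev : Even S.card) {C T : PlaneGraph S} (hC : IsSpanningCycle C) (hCT : C.edges ⊆ T.edges) :
    ∃ M1 ∈ pmSet S T.edges, ∃ M2 ∈ pmSet S (T.edges \ M1), C.edges = M1 ∪ M2 := by
  obtain ⟨h3, f, hf⟩ := hC
  rw [← half_union] at hf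
  have hd := half_disj h3 f
  refine ⟨half f 0, mem_pmSet.2 ⟨?_, half_pm hev f (by norm_num)⟩, half f 1,
    mem_pmSet.2 ⟨?_, half_pm hev f (by norm_num)⟩, hf⟩
  · exact (Finset.subset_union_left.trans hf.symm.subset).trans hCT
  · intro e he
    exact Finset.mem_sdiff.2 ⟨hCT (hf ▸ Finset.mem_union_right _ he), fun h => Finset.disjoint_left.1 hd h he⟩

lemma sum_split (hS : GP S) (hev : Even S.card) (T : PlaneGraph S) :
    (∑ᶠ C : {C : PlaneGraph S // IsSpanningCycle C ∧ C.edges ⊆ T.edges}, (1 : ℝ) / (supp C.1 : ℝ)) ≤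
    ∑ M1 ∈ pmSet S T.edges, ∑ M2 ∈ pmSet S (T.edges \ M1), (1 : ℝ) / ((trs S (M1 ∪ M2)).card : ℝ) := by
  have h : ∀ C : {C : PlaneGraph S // IsSpanningCycle C ∧ C.edges ⊆ T.edges},
      ∃ P : (Σ _ : Finset (Sym2 Pt), Finset (Sym2 Pt)),
        P ∈ (pmSet S T.edges).sigma (fun M1 => pmSet S (T.edges \ M1)) ∧ C.1.edges = P.1 ∪ P.2 := by
    intro C
    obtain ⟨M1, h1, M2, h2, h3⟩ := cycle_split hev C.2.1 C.2.2
    exact ⟨⟨M1, M2⟩, Finset.mem_sigma.2 ⟨h1, h2⟩, h3⟩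
  choose Φ hΦ hΦ' using h
  have hinj : Function.Injective Φ := by
    intro C C' hcc
    apply Subtype.ext
    apply pg_ext
    rw [hΦ', hΦ', hcc]
  set K := (pmSet S T.edges).sigma (fun M1 => pmSet S (T.edges \ M1)) with hK
  have hfin : Finite {C : PlaneGraph S // IsSpanningCycle C ∧ C.edges ⊆ T.edges} :=
    Finite.of_injective (fun C => (⟨Φ C, hΦ C⟩ : {P // P ∈ K})) (fun C C' hcc => hinj (by simpa using hcc))
  have := Fintype.ofFinite {C : PlaneGraph S // IsSpanningCycle C ∧ C.edges ⊆ T.edges}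
  rw [finsum_eq_sum_of_fintype]
  rw [Finset.sum_sigma']
  calc _ = ∑ C, (1 : ℝ) / ((trs S ((Φ C).1 ∪ (Φ C).2)).card : ℝ) := by
        refine Finset.sum_congr rfl (fun C _ => ?_)
        rw [supp_eq hS, hΦ']
    _ = ∑ P ∈ Finset.univ.image Φ, (1 : ℝ) / ((trs S (P.1 ∪ P.2)).card : ℝ) := by
        rw [Finset.sum_image (fun a _ b _ h => hinj h)]
    _ ≤ _ := by
        apply Finset.sum_le_sum_of_subset_of_nonneg
        · intro P hP
          obtain ⟨C, -, rfl⟩ := Finset.mem_image.1 hP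
          exact hΦ C
        · intros; positivity

end

section

variable {S : Finset Pt}

lemma prod_two (M A B : Finset (Sym2 Pt)) (hAB : Disjoint A B) (a b : ℝ) :
    ∏ e ∈ M, (if e ∈ A then a else if e ∈ B then b else 1) = a ^ (A ∩ M).card * b ^ (B ∩ M).card := by
  have h : ∀ e ∈ M, (if e ∈ A then a else if e ∈ B then b else 1) =
      (if e ∈ A then a else 1) * (if e ∈ B then b else 1) := by
    intro e _
    by_cases h1 : e ∈ A
    · have : e ∉ B := Finset.disjoint_left.1 hAB h1
      simp [h1, this]
    · simp [h1]
  rw [Finset.prod_congr rfl h, Finset.prod_mul_distrib]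
  rw [Finset.prod_ite, Finset.prod_ite]
  simp only [Finset.prod_const, Finset.prod_const_one, mul_one, one_pow, Finset.filter_mem_eq_inter,
    Finset.inter_comm]

lemma sum_two (E A B : Finset (Sym2 Pt)) (hAB : Disjoint A B) (hA : A ⊆ E) (hB : B ⊆ E) (a b : ℝ) :
    ∑ e ∈ E, (if e ∈ A then a else if e ∈ B then b else 1) ^ 2 =
      E.card + (a ^ 2 - 1) * A.card + (b ^ 2 - 1) * B.card := by
  have h : ∀ e ∈ E, (if e ∈ A then a else if e ∈ B then b else 1) ^ 2 =
      1 + (if e ∈ A then (a ^ 2 - 1) else 0) + (if e ∈ B then (b ^ 2 - 1) else 0) := by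
    intro e _
    by_cases h1 : e ∈ A
    · have : e ∉ B := Finset.disjoint_left.1 hAB h1
      simp [h1, this]
    · by_cases h2 : e ∈ B <;> simp [h1, h2]
  rw [Finset.sum_congr rfl h, Finset.sum_add_distrib, Finset.sum_add_distrib]
  rw [← Finset.sum_filter, ← Finset.sum_filter]
  simp only [Finset.sum_const, Finset.filter_mem_eq_inter, nsmul_eq_mul, mul_one,
    Finset.inter_eq_right.2 hA, Finset.inter_eq_right.2 hB]
  ring

/-- The pair bound. -/
lemma pair_bound (hS : GP S) {x : ℝ} (hx : XV x) {T F A M1 M2 : Finset (Sym2 Pt)} (hT : IsTri S T)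
    (hF : F ⊆ T) (hFl : ∀ p q, s(p, q) ∈ F → ∃ r s, Fl S T p q r s)
    (hAT : A ⊆ T) (hAM : Disjoint A M1) (hcv : Conv S (T \ A))
    (h1 : M1 ⊆ T) (h2 : M2 ⊆ T) :
    (1 : ℝ) / ((trs S (M1 ∪ M2)).card : ℝ) ≤
      (∏ e ∈ M2, (if e ∈ A then 2 else if e ∈ (F \ M1) \ A then x else 1)) /
        (2 ^ A.card * x ^ ((F \ M1) \ A).card) := by
  have hx0 : 0 < x := by linarith [hx.lo]
  set B := (F \ M1) \ A with hB
  have hAB : Disjoint A B := Finset.disjoint_sdiff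
  have hBF : B ⊆ F := Finset.sdiff_subset.trans Finset.sdiff_subset
  have key := support_lemma hS hx _ T (A \ M2) (B \ M2) rfl hT (Finset.sdiff_subset.trans hAT)
    (Finset.sdiff_subset.trans (hBF.trans hF))
    (Finset.disjoint_of_subset_left Finset.sdiff_subset (Finset.disjoint_of_subset_right Finset.sdiff_subset hAB))
    (hcv.mono (Finset.sdiff_subset_sdiff le_rfl Finset.sdiff_subset))
    (fun p q h => hFl p q (hBF (Finset.mem_sdiff.1 h).1))
  have hsub : M1 ∪ M2 ⊆ T \ ((A \ M2) ∪ (B \ M2)) := by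
    intro e he
    rw [Finset.mem_sdiff]
    refine ⟨(Finset.union_subset h1 h2) he, ?_⟩
    intro h
    simp only [hB, Finset.mem_union, Finset.mem_sdiff] at h he
    have hd : e ∈ A → e ∉ M1 := fun h => (Finset.disjoint_left.1 hAM) h
    tauto
  have hcard : ((trs S (T \ ((A \ M2) ∪ (B \ M2)))).card : ℝ) ≤ ((trs S (M1 ∪ M2)).card : ℝ) := by
    exact_mod_cast Finset.card_le_card (trs_anti hsub)
  rw [prod_two _ _ _ hAB]
  have e1 : (A \ M2).card + (A ∩ M2).card = A.card := Finset.card_sdiff_add_card_inter A M2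
  have e2 : (B \ M2).card + (B ∩ M2).card = B.card := Finset.card_sdiff_add_card_inter B M2
  have hpos : 0 < (2:ℝ) ^ (A \ M2).card * x ^ (B \ M2).card := by positivity
  rw [div_le_div_iff₀ (by linarith) (by positivity), ← e1, ← e2, pow_add, pow_add]
  have : (0:ℝ) ≤ 2 ^ (A ∩ M2).card * x ^ (B ∩ M2).card := by positivity
  nlinarith [mul_le_mul_of_nonneg_left (key.trans hcard) this]

/-- Summing over the second matching. -/
lemma second_sum (hS : GP S) (h3 : 3 ≤ S.card) (hev : Even S.card) {x κ : ℝ} (hx : XV x) (hκ : 0 ≤ κ)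
    {T F M1 : Finset (Sym2 Pt)} (hT : IsTri S T)
    (hF : ∀ p q, s(p, q) ∈ F ↔ ∃ r s, Fl S T p q r s)
    (hFc : (F.card : ℝ) = (S.card : ℝ) / 2 - 3 + κ * S.card)
    (hM : M1 ∈ pmSet S T) :
    ∑ M2 ∈ pmSet S (T \ M1), (1 : ℝ) / ((trs S (M1 ∪ M2)).card : ℝ) ≤
      8 * 2 ^ (-(S.card : ℝ) / 2) * x ^ (-(κ * S.card)) * (2 * (4 + (x ^ 2 - 1) * κ)) ^ ((S.card : ℝ) / 4) *
        (x * Real.exp (-(x ^ 2 - 1) / (4 * (4 + (x ^ 2 - 1) * κ)))) ^ (F ∩ M1).card := by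
  have hx1 := hx.lo
  have hx0 : 0 < x := by linarith
  have hxs : 0 < x ^ 2 - 1 := by nlinarith
  set N := S.card with hN
  have hNpos : (0 : ℝ) < N := by exact_mod_cast (by omega : 0 < N)
  set Q := 4 + (x ^ 2 - 1) * κ with hQ
  have hQ4 : 4 ≤ Q := by rw [hQ]; nlinarith [mul_nonneg hxs.le hκ]
  have hFT : F ⊆ T := by
    intro e he
    induction e using Sym2.ind with
    | _ p q => obtain ⟨r, s, h⟩ := (hF p q).1 he; exact h.f1.e1
  obtain ⟨A, hAT, hAM, hcv, hAc, hAFl⟩ := exists_A hS hT h3 hM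
  have hAF : A ⊆ F := by
    intro e he
    induction e using Sym2.ind with
    | _ p q => exact (hF p q).2 (hAFl p q he)
  have hM1 := (mem_pmSet.1 hM).1
  set B := (F \ M1) \ A with hB
  have hAB : Disjoint A B := Finset.disjoint_sdiff
  set w : Sym2 Pt → ℝ := fun e => if e ∈ A then 2 else if e ∈ B then x else 1 with hw
  set m := (F ∩ M1).card with hm
  -- cardinalities
  have cB : B.card + A.card + m = F.card := by
    have a1 : (F \ M1).card + m = F.card := Finset.card_sdiff_add_card_inter F M1
    have a2 : A ⊆ F \ M1 := fun e he => Finset.mem_sdiff.2 ⟨hAF he, Finset.disjoint_left.1 hAM he⟩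
    have a3 : B.card + A.card = (F \ M1).card := Finset.card_sdiff_add_card_eq_card a2
    omega
  have cBr : (B.card : ℝ) + A.card + m = (N : ℝ) / 2 - 3 + κ * N := by rw [← hFc]; exact_mod_cast cB
  obtain ⟨k, hk⟩ := hev
  have hkr : (N : ℝ) = 2 * k := by rw [hk]; push_cast; ring
  have cA1 : (N : ℝ) / 2 - 3 ≤ A.card := by
    rw [hkr]
    have : k ≤ A.card + 3 := by omega
    have : (k : ℝ) ≤ A.card + 3 := by exact_mod_cast this
    linarith
  have cA2 : (A.card : ℝ) ≤ N / 2 := by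
    rw [hkr]
    have : A.card ≤ k := by omega
    have : (A.card : ℝ) ≤ k := by exact_mod_cast this
    linarith
  -- step 1
  have s1 : ∑ M2 ∈ pmSet S (T \ M1), (1 : ℝ) / ((trs S (M1 ∪ M2)).card : ℝ) ≤
      (∑ M2 ∈ pmSet S (T \ M1), ∏ e ∈ M2, w e) / (2 ^ A.card * x ^ B.card) := by
    rw [Finset.sum_div]
    refine Finset.sum_le_sum (fun M2 h2 => ?_)
    exact pair_bound hS hx hT hFT (fun p q h => (hF p q).1 h) hAT hAM hcv hM1
      ((mem_pmSet.1 h2).1.trans Finset.sdiff_subset)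
  -- step 2
  have s2 := kasteleyn (E := T \ M1) hS (by omega) ⟨k, hk⟩ (hT.pl.mono Finset.sdiff_subset) w
    (by intro e; simp only [hw]; split_ifs <;> linarith)
  have s3 : ∑ e ∈ T \ M1, w e ^ 2 ≤ N * Q - (x ^ 2 - 1) * m := by
    have hA' : A ⊆ T \ M1 := fun e he => Finset.mem_sdiff.2 ⟨hAT he, Finset.disjoint_left.1 hAM he⟩
    have hB' : B ⊆ T \ M1 := Finset.sdiff_subset.trans (Finset.sdiff_subset_sdiff hFT le_rfl)
    simp only [hw]
    rw [sum_two _ _ _ hAB hA' hB']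
    have c1 : (T \ M1).card + M1.card = T.card := Finset.card_sdiff_add_card_eq_card hM1
    have c2 := pm_card hT.pl hM
    have c3 := euler hS (Finset.card_pos.1 (by omega)) hT
    have c4 : ((T \ M1).card : ℝ) + N / 2 ≤ 3 * N := by
      rw [hkr]
      have : (T \ M1).card + k ≤ 3 * (2 * k) := by omega
      have : ((T \ M1).card : ℝ) + k ≤ 3 * (2 * k) := by exact_mod_cast this
      linarith
    have c5 : (B.card : ℝ) ≤ κ * N - m := by linarith
    have c6 := mul_le_mul_of_nonneg_left c5 hxs.le
    have : (N:ℝ) * Q = 4 * N + (x^2-1) * (κ * N) := by rw [hQ]; ring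
    rw [this]
    nlinarith
  have s4 : ∑ M2 ∈ pmSet S (T \ M1), ∏ e ∈ M2, w e ≤
      (2 * Q) ^ ((N : ℝ) / 4) * Real.exp (-(x ^ 2 - 1) / (4 * Q)) ^ m := by
    refine s2.trans ?_
    have b1 : 2 / (N : ℝ) * ∑ e ∈ T \ M1, w e ^ 2 ≤ 2 * Q * Real.exp (-((x ^ 2 - 1) * m / (Q * N))) := by
      have d1 : 2 / (N : ℝ) * ∑ e ∈ T \ M1, w e ^ 2 ≤ 2 / (N : ℝ) * (N * Q - (x ^ 2 - 1) * m) :=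
        mul_le_mul_of_nonneg_left s3 (by positivity)
      have d2 : 2 / (N : ℝ) * (N * Q - (x ^ 2 - 1) * m) = 2 * Q * (1 - (x ^ 2 - 1) * m / (Q * N)) := by
        have : Q ≠ 0 := by linarith
        field_simp
      rw [d2] at d1
      refine d1.trans (mul_le_mul_of_nonneg_left ?_ (by linarith))
      exact Real.one_sub_le_exp_neg _
    refine (Real.rpow_le_rpow (mul_nonneg (by positivity) (Finset.sum_nonneg (fun _ _ => sq_nonneg _))) b1
      (by positivity)).trans (le_of_eq ?_)
    rw [Real.mul_rpow (by linarith) (Real.exp_pos _).le, ← Real.exp_mul, ← Real.exp_nat_mul]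
    rw [← hN]
    congr 2
    have : Q ≠ 0 := by linarith
    field_simp
  -- step 5 : the denominator
  have s5 : (2 ^ ((N : ℝ) / 2) / 8) * x ^ (κ * N) / x ^ m ≤ 2 ^ A.card * x ^ B.card := by
    have hb : (B.card : ℝ) = ((N : ℝ) / 2 - 3 - A.card) + (κ * N - m) := by linarith
    have r1 : x ^ B.card = x ^ ((N : ℝ) / 2 - 3 - A.card) * (x ^ (κ * N) / x ^ m) := by
      rw [← Real.rpow_natCast x B.card, hb, Real.rpow_add hx0, Real.rpow_sub hx0 (κ * N), Real.rpow_natCast]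
    have r2 : (2 : ℝ) ^ ((N : ℝ) / 2 - 3 - A.card) ≤ x ^ ((N : ℝ) / 2 - 3 - A.card) :=
      Real.rpow_le_rpow_of_nonpos hx0 (by linarith [hx.hi]) (by linarith)
    have r3 : (2 : ℝ) ^ ((N : ℝ) / 2) / 8 = 2 ^ A.card * 2 ^ ((N : ℝ) / 2 - 3 - A.card) := by
      rw [← Real.rpow_natCast 2 A.card, ← Real.rpow_add (by norm_num)]
      have : (A.card : ℝ) + ((N : ℝ) / 2 - 3 - A.card) = (N : ℝ) / 2 - 3 := by ring
      rw [this, Real.rpow_sub (by norm_num)]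
      norm_num
    rw [r1, r3, mul_div_assoc, mul_assoc, ]
    gcongr
  have hden : 0 < (2 ^ ((N : ℝ) / 2) / 8) * x ^ (κ * N) / x ^ m := by positivity
  refine s1.trans ((div_le_div₀ (by positivity) s4 hden s5).trans (le_of_eq ?_))
  rw [mul_pow, Real.rpow_neg hx0.le, neg_div (2:ℝ) (N:ℝ), Real.rpow_neg (by norm_num)]
  field_simp

lemma xv_of (x : ℝ) (hx : 1 + 4 * x ^ 2 - 4 * x ^ 3 = 0) : XV x := by
  have h1 : 1 < x := by
    by_contra hc
    nlinarith [mul_nonneg (sq_nonneg x) (sub_nonneg.2 (not_lt.1 hc))]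
  refine ⟨h1, ?_, by linarith⟩
  by_contra hc
  push Not at hc
  nlinarith [mul_nonneg (sq_nonneg x) (sub_nonneg.2 hc), sq_nonneg (x - 6/5)]

lemma gamma_gt {x κ γ : ℝ} (hx : XV x) (hκ : 0 ≤ κ)
    (hγ : γ = x * Real.exp (-(x ^ 2 - 1) / (4 * (4 + (x ^ 2 - 1) * κ)))) : 1 < γ := by
  have hx1 := hx.lo
  have hx2 := hx.hi
  have hxs : 0 < x ^ 2 - 1 := by nlinarith
  have h1 : 1.1 < x := by
    by_contra hc
    have := hx.cub
    nlinarith [mul_nonneg (sq_nonneg x) (sub_nonneg.2 (not_lt.1 hc))]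
  have h2 : -((x ^ 2 - 1) / 16) ≤ -(x ^ 2 - 1) / (4 * (4 + (x ^ 2 - 1) * κ)) := by
    rw [neg_div, neg_le_neg_iff]
    apply div_le_div_of_nonneg_left hxs.le (by norm_num)
    nlinarith [mul_nonneg hxs.le hκ]
  have h3 : 1 - (x ^ 2 - 1) / 16 ≤ Real.exp (-(x ^ 2 - 1) / (4 * (4 + (x ^ 2 - 1) * κ))) :=
    (Real.one_sub_le_exp_neg _).trans (Real.exp_le_exp.2 h2)
  rw [hγ]
  have h4 : x ^ 2 < 1.44 := by nlinarith
  have h5 : (0.97 : ℝ) ≤ Real.exp (-(x ^ 2 - 1) / (4 * (4 + (x ^ 2 - 1) * κ))) := by linarith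
  nlinarith

lemma first_sum (hS : GP S) (h3 : 3 ≤ S.card) (hev : Even S.card) {κ γ : ℝ} (hγ : 1 < γ)
    {T F : Finset (Sym2 Pt)} (hT : IsTri S T) (hFT : F ⊆ T)
    (hFc : (F.card : ℝ) = (S.card : ℝ) / 2 - 3 + κ * S.card) :
    ∑ M1 ∈ pmSet S T, γ ^ (F ∩ M1).card < (2 * (3 + (γ ^ 2 - 1) * (κ + 1 / 2))) ^ ((S.card : ℝ) / 4) := by
  have hNpos : (0 : ℝ) < S.card := by exact_mod_cast (by omega : 0 < S.card)
  have hg : 0 < γ ^ 2 - 1 := by nlinarith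
  have k1 := kasteleyn hS (by omega) hev hT.pl (fun e => if e ∈ F then γ else if e ∈ (∅ : Finset (Sym2 Pt)) then 1 else 1)
    (by intro e; split_ifs <;> linarith)
  simp only [prod_two _ F ∅ (Finset.disjoint_empty_right F)] at k1
  rw [sum_two _ _ _ (Finset.disjoint_empty_right F) hFT (Finset.empty_subset _)] at k1
  simp only [one_pow, mul_one, sub_self, zero_mul, add_zero] at k1
  refine k1.trans_lt (Real.rpow_lt_rpow (by positivity) ?_ (by positivity))
  have c3 := euler hS (Finset.card_pos.1 (by omega)) hT
  have c4 : (T.card : ℝ) < 3 * S.card := by exact_mod_cast (by omega : T.card < 3 * S.card)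
  rw [hFc, div_mul_eq_mul_div, div_lt_iff₀ hNpos]
  nlinarith

theorem main11 (S : Finset Pt) (hS : GenPos S) (heven : Even S.card)
    (T : PlaneGraph S) (hT : IsTriangulation T)
    (κ : ℝ) (hκ : 0 ≤ κ)
    (hflip : (flipCount T : ℝ) = (S.card : ℝ) / 2 - 3 + κ * (S.card : ℝ))
    (x : ℝ) (hx : 1 + 4 * x ^ 2 - 4 * x ^ 3 = 0)
    (γ : ℝ) (hγ : γ = x * Real.exp (-(x ^ 2 - 1) / (4 * (4 + (x ^ 2 - 1) * κ)))) :
    (∑ᶠ C : {C : PlaneGraph S // IsSpanningCycle C ∧ C.edges ⊆ T.edges},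
        (1 : ℝ) / (supp C.1 : ℝ)) <
      8 * (((3 + (γ ^ 2 - 1) * (κ + 1 / 2)) * (4 + (x ^ 2 - 1) * κ)) /
        x ^ (4 * κ)) ^ ((S.card : ℝ) / 4) := by
  have hX := xv_of x hx
  have hg := gamma_gt hX hκ hγ
  have hx1 := hX.lo
  have hx0 : 0 < x := by linarith
  have hxs : 0 < x ^ 2 - 1 := by nlinarith
  have hgs : 0 < γ ^ 2 - 1 := by nlinarith
  set Q := 4 + (x ^ 2 - 1) * κ with hQ
  set R := 3 + (γ ^ 2 - 1) * (κ + 1 / 2) with hR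
  have hQ0 : 0 < Q := by rw [hQ]; positivity
  have hR0 : 0 < R := by rw [hR]; positivity
  by_cases h3 : 3 ≤ S.card
  · have hS' := hS.gp
    have hT' := (isTri_iff hS' T).1 hT
    set F := T.edges.filter (fun e => IsFlippable T e) with hF
    have hFT : F ⊆ T.edges := Finset.filter_subset _ _
    have hFi : ∀ p q, s(p, q) ∈ F ↔ ∃ r s, Fl S T.edges p q r s := by
      intro p q
      rw [hF, Finset.mem_filter]
      constructor
      · exact fun h => fl_of_flippable hS' h.2
      · rintro ⟨r, s, h⟩
        exact ⟨h.f1.e1, flippable_of_fl hS' h⟩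
    have hFc : (F.card : ℝ) = (S.card : ℝ) / 2 - 3 + κ * S.card := hflip
    refine (sum_split hS' heven T).trans_lt ?_
    refine (Finset.sum_le_sum (fun M1 hM => second_sum hS' h3 heven hX hκ hT' hFi hFc hM)).trans_lt ?_
    rw [← Finset.mul_sum, ← hQ, ← hγ]
    refine (mul_lt_mul_of_pos_left (first_sum hS' h3 heven hg hT' hFT hFc) (by positivity)).trans_eq ?_
    rw [← hR, Real.div_rpow (by positivity) (by positivity), Real.mul_rpow hR0.le hQ0.le,
      Real.mul_rpow (by norm_num) hQ0.le, Real.mul_rpow (by norm_num) hR0.le, ← Real.rpow_mul hx0.le]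
    have e1 : 4 * κ * ((S.card : ℝ) / 4) = κ * S.card := by ring
    have e2 : (2 : ℝ) ^ (-(S.card : ℝ) / 2) * (2 ^ ((S.card : ℝ) / 4) * 2 ^ ((S.card : ℝ) / 4)) = 1 := by
      rw [← Real.rpow_add (by norm_num), ← Real.rpow_add (by norm_num)]
      have : -(S.card : ℝ) / 2 + ((S.card : ℝ) / 4 + (S.card : ℝ) / 4) = 0 := by ring
      rw [this, Real.rpow_zero]
    rw [e1, Real.rpow_neg hx0.le]
    generalize (2 : ℝ) ^ (-(S.card : ℝ) / 2) = u1 at e2 ⊢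
    generalize (2 : ℝ) ^ ((S.card : ℝ) / 4) = u2 at e2 ⊢
    generalize Q ^ ((S.card : ℝ) / 4) = u3
    generalize R ^ ((S.card : ℝ) / 4) = u4
    generalize x ^ (κ * (S.card : ℝ)) = u5
    linear_combination (8 * u5⁻¹ * u3 * u4) * e2
  · have : IsEmpty {C : PlaneGraph S // IsSpanningCycle C ∧ C.edges ⊆ T.edges} :=
      ⟨fun C => h3 C.2.1.1⟩
    rw [finsum_of_isEmpty]
    positivity

end

/-- the `flip(T)`-sensitive bound on `∑_{C ∈ SC(T)} 1/supp(C)`. -/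
theorem statement11 (S : Finset Pt) (hS : GenPos S) (heven : Even S.card)
    (T : PlaneGraph S) (hT : IsTriangulation T)
    (κ : ℝ) (hκ : 0 ≤ κ)
    (hflip : (flipCount T : ℝ) = (S.card : ℝ) / 2 - 3 + κ * (S.card : ℝ))
    (x : ℝ) (hx : 1 + 4 * x ^ 2 - 4 * x ^ 3 = 0)
    (γ : ℝ) (hγ : γ = x * Real.exp (-(x ^ 2 - 1) / (4 * (4 + (x ^ 2 - 1) * κ)))) :
    (∑ᶠ C : {C : PlaneGraph S // IsSpanningCycle C ∧ C.edges ⊆ T.edges},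
        (1 : ℝ) / (supp C.1 : ℝ)) <
      8 * (((3 + (γ ^ 2 - 1) * (κ + 1 / 2)) * (4 + (x ^ 2 - 1) * κ)) /
        x ^ (4 * κ)) ^ ((S.card : ℝ) / 4) := by
  exact main11 S hS heven T hT κ hκ hflip x hx γ hγ

end
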